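/- For every s ∈ (1/2,1), with d, θ_0, ξ_0, p_0 as defined, there exist a compact set A ⊂ [1,2] and a Borel probability measure ν on ℝ whose support equals A such that ν is Ahlfors s-regular and such that for every p > p_0 the unrestricted maximal operator M̄_ν f(x) = sup_{r>0} ∫ |f(x+ry)| dν(y) is bounded on L^p(ℝ), i.e. there is C < ∞ with ‖M̄_ν f‖_{L^p(ℝ)} ≤ C‖f‖_{L^p(ℝ)} for every measurable f: ℝ → ℝ. -/

import Mathlib

open MeasureTheory Set

/-- The unrestricted maximal operator `M̄_ν f(x) = sup_{r > 0} ∫ |f(x+ry)| dν(y)`. -/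
noncomputable def unrestrictedMax (ν : Measure ℝ) (f : ℝ → ℝ) (x : ℝ) : ℝ :=
  ⨆ r : Ioi (0 : ℝ), ∫ y, |f (x + (r : ℝ) * y)| ∂ν

/-- The (topological) support of a measure on `ℝ`. -/
def msupport (ν : Measure ℝ) : Set ℝ :=
  {x | ∀ ε > 0, 0 < ν (Metric.ball x ε)}

/-- Ahlfors `s`-regularity of a measure on `ℝ`. -/
def IsAhlforsRegular (ν : Measure ℝ) (s : ℝ) : Prop :=
  ∃ C : ℝ, 1 ≤ C ∧ ∀ x ∈ msupport ν, ∀ r : ℝ, 0 < r → r ≤ 1 →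
    ENNReal.ofReal (C⁻¹ * r ^ s) ≤ ν (Icc (x - r) (x + r)) ∧
      ν (Icc (x - r) (x + r)) ≤ ENNReal.ofReal (C * r ^ s)

/-- The sign attached to a coin flip. -/
def coinSign (t : Bool) : ℝ := if t then 1 else -1

lemma coinSign_not (t : Bool) : coinSign (!t) = -coinSign t := by
  cases t <;> simp [coinSign]

lemma abs_coinSign (t : Bool) : |coinSign t| = 1 := by
  cases t <;> simp [coinSign]

lemma coinSign_eq (t : Bool) : coinSign t = 1 ∨ coinSign t = -1 := by
  cases t <;> simp [coinSign]

/-- Summing over all sign patterns is invariant under flipping one of the coordinates. -/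
lemma sum_flip {ι : Type*} [Fintype ι] [DecidableEq ι] (i : ι) (F : (ι → Bool) → ℝ) :
    ∑ ω : ι → Bool, F (Function.update ω i (!(ω i))) = ∑ ω : ι → Bool, F ω := by
  refine Fintype.sum_bijective (fun ω : ι → Bool => Function.update ω i (!(ω i))) ?_ _ _
    (fun _ => rfl)
  apply Function.Involutive.bijective
  intro ω
  ext j
  by_cases h : j = i
  · subst h; simp
  · simp [h]

/-- Exponential moments of a Rademacher chaos. -/
lemma chaos_mgf {Z ι : Type*} [Fintype ι] [DecidableEq ι] (v : Z → ℝ) (C : Z → Finset ι) (t : ℝ)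
    (F : Finset ι) :
    ∀ s : Finset Z, (∀ z ∈ s, (C z).Nonempty ∧ C z ⊆ F) →
    ∑ ω : ι → Bool, Real.exp (t * ∑ z ∈ s, v z * ∏ i ∈ C z, coinSign (ω i)) ≤
      2 ^ Fintype.card ι *
        Real.exp (t ^ 2 / 2 * ∑ i ∈ F, (∑ z ∈ s with i ∈ C z, |v z|) ^ 2) := by
  classical
  induction F using Finset.induction_on with
  | empty =>
    intro s hs
    have : s = ∅ := by
      apply Finset.eq_empty_of_forall_notMem
      intro z hz
      obtain ⟨⟨i, hi⟩, h2⟩ := hs z hz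
      simpa using h2 hi
    subst this
    simp
  | insert i F hi ih =>
    intro s hs
    set s0 := s.filter (fun z => i ∉ C z) with hs0
    set s1 := s.filter (fun z => i ∈ C z) with hs1
    set Q0 : (ι → Bool) → ℝ := fun ω => ∑ z ∈ s0, v z * ∏ j ∈ C z, coinSign (ω j) with hQ0
    set Y : (ι → Bool) → ℝ :=
      fun ω => ∑ z ∈ s1, v z * ∏ j ∈ (C z).erase i, coinSign (ω j) with hY
    have hsplit : ∀ ω : ι → Bool, ∑ z ∈ s, v z * ∏ j ∈ C z, coinSign (ω j) =
        Q0 ω + coinSign (ω i) * Y ω := by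
      intro ω
      rw [← Finset.sum_filter_add_sum_filter_not s (fun z => i ∈ C z), add_comm]
      congr 1
      rw [hY, Finset.mul_sum]
      refine Finset.sum_congr rfl fun z hz => ?_
      rw [← Finset.mul_prod_erase (C z) _ (Finset.mem_filter.1 hz).2]
      ring
    have hQflip : ∀ ω : ι → Bool, Q0 (Function.update ω i (!(ω i))) = Q0 ω := by
      intro ω
      refine Finset.sum_congr rfl fun z hz => ?_
      congr 1
      refine Finset.prod_congr rfl fun j hj => ?_
      have : j ≠ i := by
        rintro rfl
        exact (Finset.mem_filter.1 hz).2 hj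
      simp [this]
    have hYflip : ∀ ω : ι → Bool, Y (Function.update ω i (!(ω i))) = Y ω := by
      intro ω
      refine Finset.sum_congr rfl fun z hz => ?_
      congr 1
      refine Finset.prod_congr rfl fun j hj => ?_
      simp [(Finset.mem_erase.1 hj).1]
    have hYb : ∀ ω, |Y ω| ≤ ∑ z ∈ s1, |v z| := by
      intro ω
      refine (Finset.abs_sum_le_sum_abs _ _).trans (Finset.sum_le_sum fun z _ => ?_)
      rw [abs_mul, Finset.abs_prod]
      simp [abs_coinSign]
    have key : ∑ ω : ι → Bool, Real.exp (t * ∑ z ∈ s, v z * ∏ j ∈ C z, coinSign (ω j)) =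
        ∑ ω : ι → Bool, Real.exp (t * Q0 ω) * Real.cosh (t * Y ω) := by
      have h1 : ∑ ω : ι → Bool, Real.exp (t * ∑ z ∈ s, v z * ∏ j ∈ C z, coinSign (ω j)) =
          ∑ ω : ι → Bool, Real.exp (t * (Q0 ω + coinSign (ω i) * Y ω)) :=
        Finset.sum_congr rfl fun ω _ => by rw [hsplit]
      have h2 := sum_flip i (fun ω => Real.exp (t * (Q0 ω + coinSign (ω i) * Y ω)))
      simp only [hQflip, hYflip, Function.update_self, coinSign_not] at h2
      have h3 : ∀ ω : ι → Bool, Real.exp (t * Q0 ω) * Real.cosh (t * Y ω) =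
          (Real.exp (t * (Q0 ω + coinSign (ω i) * Y ω)) +
            Real.exp (t * (Q0 ω + -coinSign (ω i) * Y ω))) / 2 := by
        intro ω
        rw [Real.cosh_eq]
        rcases coinSign_eq (ω i) with h | h <;> rw [h] <;>
          simp only [mul_add, Real.exp_add] <;> ring_nf
      rw [h1]
      simp only [h3]
      rw [← Finset.sum_div, Finset.sum_add_distrib, h2]
      ring
    rw [key]
    have hB : ∀ ω, Real.cosh (t * Y ω) ≤ Real.exp (t ^ 2 / 2 * (∑ z ∈ s1, |v z|) ^ 2) := by
      intro ω
      refine (Real.cosh_le_exp_half_sq _).trans (Real.exp_le_exp.2 ?_)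
      have := sq_le_sq' (by linarith [abs_le.1 (hYb ω)]) (abs_le.1 (hYb ω)).2
      nlinarith [sq_nonneg t]
    have hih := ih s0 (by
      intro z hz
      obtain ⟨hz1, hz2⟩ := Finset.mem_filter.1 hz
      refine ⟨(hs z hz1).1, fun j hj => ?_⟩
      rcases Finset.mem_insert.1 ((hs z hz1).2 hj) with h | h
      · exact absurd (h ▸ hj) hz2
      · exact h)
    calc ∑ ω : ι → Bool, Real.exp (t * Q0 ω) * Real.cosh (t * Y ω)
        ≤ ∑ ω : ι → Bool, Real.exp (t * Q0 ω) *
            Real.exp (t ^ 2 / 2 * (∑ z ∈ s1, |v z|) ^ 2) :=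
          Finset.sum_le_sum fun ω _ => mul_le_mul_of_nonneg_left (hB ω) (Real.exp_pos _).le
      _ = (∑ ω : ι → Bool, Real.exp (t * Q0 ω)) *
            Real.exp (t ^ 2 / 2 * (∑ z ∈ s1, |v z|) ^ 2) := by rw [Finset.sum_mul]
      _ ≤ (2 ^ Fintype.card ι *
            Real.exp (t ^ 2 / 2 * ∑ i ∈ F, (∑ z ∈ s0 with i ∈ C z, |v z|) ^ 2)) *
            Real.exp (t ^ 2 / 2 * (∑ z ∈ s1, |v z|) ^ 2) :=
          mul_le_mul_of_nonneg_right hih (Real.exp_pos _).le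
      _ ≤ _ := by
          rw [mul_assoc, ← Real.exp_add, Finset.sum_insert hi]
          refine mul_le_mul_of_nonneg_left (Real.exp_le_exp.2 ?_) (by positivity)
          rw [← mul_add, add_comm]
          refine mul_le_mul_of_nonneg_left ?_ (by positivity)
          refine add_le_add le_rfl (Finset.sum_le_sum fun j _ => ?_)
          refine pow_le_pow_left₀ (Finset.sum_nonneg fun _ _ => abs_nonneg _) ?_ 2
          refine Finset.sum_le_sum_of_subset_of_nonneg ?_ (fun _ _ _ => abs_nonneg _)
          exact Finset.filter_subset_filter _ (Finset.filter_subset _ _)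

/-- Deviation bound for a Rademacher chaos, by counting sign patterns. -/
lemma card_chaos_large {Z ι : Type*} [Fintype ι] [DecidableEq ι] (v : Z → ℝ) (C : Z → Finset ι)
    (s : Finset Z) (hs : ∀ z ∈ s, (C z).Nonempty) (V X : ℝ)
    (hV : ∑ i, (∑ z ∈ s with i ∈ C z, |v z|) ^ 2 ≤ V) (hX : 0 ≤ X) :
    ((Finset.univ.filter fun ω : ι → Bool =>
      X * Real.sqrt V < |∑ z ∈ s, v z * ∏ i ∈ C z, coinSign (ω i)|).card : ℝ) ≤
      2 ^ Fintype.card ι * (4 * Real.exp (-X)) := by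
  classical
  have hV0 : 0 ≤ V := le_trans (Finset.sum_nonneg fun _ _ => sq_nonneg _) hV
  set Q : (ι → Bool) → ℝ := fun ω => ∑ z ∈ s, v z * ∏ i ∈ C z, coinSign (ω i) with hQ
  rcases hV0.eq_or_lt with h0 | hpos
  · have hz : ∀ z ∈ s, v z = 0 := by
      intro z hz
      obtain ⟨i, hi⟩ := hs z hz
      have h1 : (∑ z ∈ s with i ∈ C z, |v z|) ^ 2 ≤ 0 := by
        refine le_trans ?_ (h0 ▸ hV)
        exact Finset.single_le_sum (f := fun i => (∑ z ∈ s with i ∈ C z, |v z|) ^ 2)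
          (fun _ _ => sq_nonneg _) (Finset.mem_univ i)
      have h2 : ∑ z ∈ s with i ∈ C z, |v z| = 0 := by
        have := sq_nonneg (∑ z ∈ s with i ∈ C z, |v z|)
        exact pow_eq_zero_iff (two_ne_zero) |>.1 (le_antisymm h1 this)
      have h3 := (Finset.sum_eq_zero_iff_of_nonneg (fun _ _ => abs_nonneg _)).1 h2 z
        (Finset.mem_filter.2 ⟨hz, hi⟩)
      exact abs_eq_zero.1 h3
    have hQ0 : ∀ ω, Q ω = 0 := fun ω => Finset.sum_eq_zero fun z h => by rw [hz z h, zero_mul]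
    have : (Finset.univ.filter fun ω : ι → Bool => X * Real.sqrt V < |Q ω|) = ∅ := by
      apply Finset.filter_eq_empty_iff.2
      intro ω _
      rw [hQ0, abs_zero, not_lt]
      positivity
    rw [this]
    simp only [Finset.card_empty, Nat.cast_zero]
    positivity
  · have hsq : 0 < Real.sqrt V := Real.sqrt_pos.2 hpos
    set t := (Real.sqrt V)⁻¹ with ht
    have htV : t ^ 2 * V = 1 := by
      rw [ht, inv_pow, Real.sq_sqrt hV0, inv_mul_cancel₀ hpos.ne']
    have hm : ∀ u : ℝ, u ^ 2 = t ^ 2 → ∑ ω : ι → Bool, Real.exp (u * Q ω) ≤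
        2 ^ Fintype.card ι * Real.exp (1 / 2) := by
      intro u hu
      refine (chaos_mgf v C u Finset.univ s fun z hz => ⟨hs z hz, Finset.subset_univ _⟩).trans ?_
      refine mul_le_mul_of_nonneg_left (Real.exp_le_exp.2 ?_) (by positivity)
      rw [hu]
      nlinarith [sq_nonneg t, mul_le_mul_of_nonneg_left hV (sq_nonneg t)]
    have h1 := hm t rfl
    have h2 := hm (-t) (by ring)
    have hcount : ((Finset.univ.filter fun ω : ι → Bool => X * Real.sqrt V < |Q ω|).card : ℝ) *
        Real.exp X ≤ ∑ ω : ι → Bool, (Real.exp (t * Q ω) + Real.exp (-t * Q ω)) := by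
      rw [← nsmul_eq_mul]
      refine (Finset.card_nsmul_le_sum _ (fun ω => Real.exp (t * Q ω) + Real.exp (-t * Q ω)) _
        ?_).trans (Finset.sum_le_sum_of_subset_of_nonneg (Finset.filter_subset _ _)
          fun _ _ _ => by positivity)
      intro ω hω
      have hω := (Finset.mem_filter.1 hω).2
      have hX' : X ≤ t * |Q ω| := by
        rw [ht, inv_mul_eq_div, le_div_iff₀ hsq]; exact hω.le
      rcases abs_cases (Q ω) with ⟨h, _⟩ | ⟨h, _⟩
      · rw [h] at hX'
        linarith [Real.exp_le_exp.2 hX', Real.exp_pos (-t * Q ω)]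
      · rw [h] at hX'
        have : X ≤ -t * Q ω := by linarith
        linarith [Real.exp_le_exp.2 this, Real.exp_pos (t * Q ω)]
    rw [Finset.sum_add_distrib] at hcount
    have he : Real.exp (1 / 2) ≤ 2 := by
      have := Real.exp_one_lt_d9
      have h3 : Real.exp (1 / 2) ^ 2 = Real.exp 1 := by
        rw [← Real.exp_nat_mul]; norm_num
      nlinarith [Real.exp_pos (1 / 2 : ℝ)]
    have : ((Finset.univ.filter fun ω : ι → Bool => X * Real.sqrt V < |Q ω|).card : ℝ) *
        Real.exp X ≤ 2 ^ Fintype.card ι * 4 := by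
      have h4 : (2 : ℝ) ^ Fintype.card ι * Real.exp (1 / 2) ≤ 2 ^ Fintype.card ι * 2 :=
        mul_le_mul_of_nonneg_left he (by positivity)
      linarith
    rw [Real.exp_neg, ← mul_assoc, ← div_eq_mul_inv, le_div_iff₀ (Real.exp_pos X)]
    exact this

/-- If the `(n, N)`-th bad event has probability at most `2 ^ -(n + N + 4)`, then some outcome of
a finite probability space avoids all bad events. -/
lemma exists_avoiding {Ω : Type*} [Fintype Ω] [Nonempty Ω] [DecidableEq Ω]
    (bad : ℕ → ℕ → Finset Ω)
    (h : ∀ n N, ((bad n N).card : ℝ) ≤ Fintype.card Ω * (1 / 2) ^ (n + N + 4)) :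
    ∃ ω, ∀ n N, ω ∉ bad n N := by
  by_contra! hc
  choose n N hn using hc
  set K := (Finset.univ.sup n) + (Finset.univ.sup N) + 1 with hK
  have hcov : (Finset.univ : Finset Ω) ⊆
      (Finset.range K).biUnion fun i => (Finset.range K).biUnion fun j => bad i j := by
    intro ω _
    have h1 : n ω ≤ Finset.univ.sup n := Finset.le_sup (Finset.mem_univ ω)
    have h2 : N ω ≤ Finset.univ.sup N := Finset.le_sup (Finset.mem_univ ω)
    simp only [Finset.mem_biUnion, Finset.mem_range]
    exact ⟨n ω, by omega, N ω, by omega, hn ω⟩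
  have hgeo : ∑ i ∈ Finset.range K, (1 / 2 : ℝ) ^ i ≤ 2 := by
    have := Summable.sum_le_tsum (Finset.range K) (fun i _ => by positivity)
      (summable_geometric_two)
    rwa [tsum_geometric_two] at this
  have hgeo0 : 0 ≤ ∑ i ∈ Finset.range K, (1 / 2 : ℝ) ^ i :=
    Finset.sum_nonneg fun _ _ => by positivity
  have hcard : (Fintype.card Ω : ℝ) ≤ ∑ i ∈ Finset.range K, ∑ j ∈ Finset.range K,
      Fintype.card Ω * (1 / 2 : ℝ) ^ (i + j + 4) := by
    have h1 : Fintype.card Ω ≤ ∑ i ∈ Finset.range K, ∑ j ∈ Finset.range K, (bad i j).card := by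
      rw [← Finset.card_univ]
      refine (Finset.card_le_card hcov).trans (Finset.card_biUnion_le.trans ?_)
      exact Finset.sum_le_sum fun i _ => Finset.card_biUnion_le
    calc (Fintype.card Ω : ℝ) ≤ ((∑ i ∈ Finset.range K, ∑ j ∈ Finset.range K,
          (bad i j).card : ℕ) : ℝ) := by exact_mod_cast h1
      _ ≤ _ := by
          push_cast
          exact Finset.sum_le_sum fun i _ => Finset.sum_le_sum fun j _ => h i j
  have heq : ∑ i ∈ Finset.range K, ∑ j ∈ Finset.range K,
      (Fintype.card Ω : ℝ) * (1 / 2 : ℝ) ^ (i + j + 4) =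
      Fintype.card Ω / 16 * ((∑ i ∈ Finset.range K, (1 / 2 : ℝ) ^ i) *
        ∑ i ∈ Finset.range K, (1 / 2 : ℝ) ^ i) := by
    rw [Finset.sum_mul_sum, Finset.mul_sum]
    refine Finset.sum_congr rfl fun i _ => ?_
    rw [Finset.mul_sum]
    refine Finset.sum_congr rfl fun j _ => ?_
    rw [pow_add, pow_add]; ring
  have hpos : (0 : ℝ) < Fintype.card Ω := by exact_mod_cast Fintype.card_pos
  rw [heq] at hcard
  nlinarith [mul_le_mul hgeo hgeo hgeo0 (by norm_num : (0 : ℝ) ≤ 2)]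

/-- Index of the dyadic cell of level `j` containing `(b - a) / c`. -/
def cellIdx (j a c b : ℕ) : ℕ := 2 ^ j * (b - a) / c

lemma cellIdx_succ_div_two (j a c b : ℕ) : cellIdx (j + 1) a c b / 2 = cellIdx j a c b := by
  unfold cellIdx
  rw [Nat.div_div_eq_div_mul, mul_comm c 2, pow_succ, mul_comm (2 ^ j) 2, mul_assoc,
    Nat.mul_div_mul_left _ _ (by norm_num)]

/-- Logarithmic size of the family of configurations of `n` affine maps on a grid of mesh
`2 ^ -N`. -/
def testSize (n N : ℕ) : ℕ := (N + 3) * (2 * n + 2) + 3 * n + N + 6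

/-- Points of `[b₁, b₂]` at which the cells of level `k` seen through the affine maps indexed by
`S` are pairwise distinct. -/
def transversal {n : ℕ} (k : ℕ) (a c : Fin n → ℕ) (S : Finset (Fin n)) (b₁ b₂ : ℕ) : Finset ℕ :=
  (Finset.Icc b₁ b₂).filter fun b => ∀ i ∈ S, ∀ l ∈ S,
    cellIdx k (a i) (c i) b = cellIdx k (a l) (c l) b → i = l

/-- The signs `ε` at level `k` behave randomly with respect to the weights `m`: square-root
cancellation for all products along affine maps with parameters on a grid. -/
def SignsGood (k : ℕ) (m ε : ℕ → ℝ) : Prop :=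
  ∀ (n N : ℕ) (a c : Fin n → ℕ), (∀ i, a i < 2 ^ (N + 3)) → (∀ i, c i < 2 ^ (N + 3)) →
    ∀ S T : Finset (Fin n), T ⊆ S → T.Nonempty →
    ∀ b₁ b₂ : ℕ, b₁ < 2 ^ (N + 3) → b₂ < 2 ^ (N + 3) → ∀ B : ℝ,
    (∀ q ∈ Finset.range (2 ^ (k + 1)),
      ∑ b ∈ Finset.Icc b₁ b₂ with ∃ i ∈ T, cellIdx k (a i) (c i) b = q,
      ∏ i ∈ S, m (cellIdx k (a i) (c i) b) ≤ B) →
    |∑ b ∈ transversal k a c S b₁ b₂, (∏ i ∈ S, m (cellIdx k (a i) (c i) b)) *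
      ∏ i ∈ T, (ε (cellIdx k (a i) (c i) b) * (-1) ^ cellIdx (k + 1) (a i) (c i) b)| ≤
    testSize n N * Real.sqrt (B * (n * ∑ b ∈ Finset.Icc b₁ b₂,
      ∏ i ∈ S, m (cellIdx k (a i) (c i) b)))

lemma sum_sq_fiber_le {n J : ℕ} (hJ : 0 < J) (s s' : Finset ℕ) (hs : s ⊆ s') (w : ℕ → ℝ)
    (hw : ∀ b, 0 ≤ w b) (T : Finset (Fin n)) (φ : Fin n → ℕ → ℕ) (B : ℝ)
    (hB : ∀ q ∈ Finset.range J, ∑ b ∈ s' with ∃ i ∈ T, φ i b = q, w b ≤ B) :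
    ∑ q ∈ Finset.range J, (∑ b ∈ s with ∃ i ∈ T, φ i b = q, w b) ^ 2 ≤
      B * (n * ∑ b ∈ s', w b) := by
  classical
  have hmono : ∀ q, ∑ b ∈ s with ∃ i ∈ T, φ i b = q, w b ≤
      ∑ b ∈ s' with ∃ i ∈ T, φ i b = q, w b := fun q =>
    Finset.sum_le_sum_of_subset_of_nonneg (Finset.filter_subset_filter _ hs) fun b _ _ => hw b
  have h0 : ∀ q, 0 ≤ ∑ b ∈ s' with ∃ i ∈ T, φ i b = q, w b := fun q =>
    Finset.sum_nonneg fun b _ => hw b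
  have hB0 : 0 ≤ B := (h0 0).trans (hB 0 (Finset.mem_range.2 hJ))
  have h1 : ∑ q ∈ Finset.range J, (∑ b ∈ s with ∃ i ∈ T, φ i b = q, w b) ^ 2 ≤
      ∑ q ∈ Finset.range J, B * ∑ b ∈ s' with ∃ i ∈ T, φ i b = q, w b := by
    refine Finset.sum_le_sum fun q hq => ?_
    rw [sq]
    exact mul_le_mul ((hmono q).trans (hB q hq)) (hmono q)
      (Finset.sum_nonneg fun b _ => hw b) hB0
  refine h1.trans ?_
  rw [← Finset.mul_sum]
  refine mul_le_mul_of_nonneg_left ?_ hB0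
  simp only [Finset.sum_filter]
  rw [Finset.sum_comm, Finset.mul_sum]
  refine Finset.sum_le_sum fun b _ => ?_
  rw [← Finset.sum_filter, Finset.sum_const, nsmul_eq_mul]
  refine mul_le_mul_of_nonneg_right ?_ (hw b)
  have : ((Finset.range J).filter fun q => ∃ i ∈ T, φ i b = q) ⊆ T.image fun i => φ i b := by
    intro q hq
    obtain ⟨i, hi, h⟩ := (Finset.mem_filter.1 hq).2
    exact Finset.mem_image.2 ⟨i, hi, h⟩
  have h2 := (Finset.card_le_card this).trans (Finset.card_image_le.trans (Finset.card_le_univ T))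
  rw [Fintype.card_fin] at h2
  exact_mod_cast h2

/-- Signs extended to all natural numbers. -/
def extendSigns {J : ℕ} (ω : Fin J → Bool) (q : ℕ) : ℝ :=
  if h : q < J then coinSign (ω ⟨q, h⟩) else 1

lemma extendSigns_eq {J : ℕ} (ω : Fin J → Bool) (q : ℕ) :
    extendSigns ω q = 1 ∨ extendSigns ω q = -1 := by
  unfold extendSigns
  split_ifs
  · exact coinSign_eq _
  · exact Or.inl rfl

open Classical in
lemma card_bad_le (k : ℕ) (m : ℕ → ℝ) (hm : ∀ q, 0 ≤ m q) (hsupp : ∀ q, m q ≠ 0 → q < 2 ^ (k + 1))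
    {n : ℕ} (X : ℝ) (hX : 0 ≤ X) (a c : Fin n → ℕ) (S T : Finset (Fin n)) (hTS : T ⊆ S)
    (hT : T.Nonempty) (b₁ b₂ : ℕ) :
    ((Finset.univ.filter fun ω : Fin (2 ^ (k + 1)) → Bool => ∃ B : ℝ,
      (∀ q ∈ Finset.range (2 ^ (k + 1)),
        ∑ b ∈ Finset.Icc b₁ b₂ with ∃ i ∈ T, cellIdx k (a i) (c i) b = q,
        ∏ i ∈ S, m (cellIdx k (a i) (c i) b) ≤ B) ∧
      X * Real.sqrt (B * (n * ∑ b ∈ Finset.Icc b₁ b₂,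
        ∏ i ∈ S, m (cellIdx k (a i) (c i) b))) <
      |∑ b ∈ transversal k a c S b₁ b₂, (∏ i ∈ S, m (cellIdx k (a i) (c i) b)) *
        ∏ i ∈ T, (extendSigns ω (cellIdx k (a i) (c i) b) *
          (-1) ^ cellIdx (k + 1) (a i) (c i) b)|).card : ℝ) ≤
      2 ^ (2 ^ (k + 1)) * (4 * Real.exp (-X)) := by
  classical
  set φ : Fin n → ℕ → ℕ := fun i b => cellIdx k (a i) (c i) b with hφ
  set w : ℕ → ℝ := fun b => ∏ i ∈ S, m (φ i b) with hw
  have hw0 : ∀ b, 0 ≤ w b := fun b => Finset.prod_nonneg fun i _ => hm _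
  set s := (transversal k a c S b₁ b₂).filter fun b => w b ≠ 0 with hs
  have hlt : ∀ b ∈ s, ∀ i ∈ S, φ i b < 2 ^ (k + 1) := by
    intro b hb i hi
    refine hsupp _ fun h => (Finset.mem_filter.1 hb).2 ?_
    exact Finset.prod_eq_zero hi h
  set C : ℕ → Finset (Fin (2 ^ (k + 1))) := fun b =>
    Finset.univ.filter fun q => ∃ i ∈ T, φ i b = q with hC
  set v : ℕ → ℝ := fun b => w b * ∏ i ∈ T, (-1) ^ cellIdx (k + 1) (a i) (c i) b with hv
  have hvabs : ∀ b, |v b| = w b := by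
    intro b
    rw [hv]
    simp only [abs_mul, Finset.abs_prod, abs_pow, abs_neg, abs_one, one_pow, Finset.prod_const_one,
      mul_one]
    exact abs_of_nonneg (hw0 b)
  have hsne : ∀ b ∈ s, (C b).Nonempty := by
    intro b hb
    obtain ⟨i, hi⟩ := hT
    refine ⟨⟨φ i b, hlt b hb i (hTS hi)⟩, ?_⟩
    simp only [hC, Finset.mem_filter, Finset.mem_univ, true_and]
    exact ⟨i, hi, rfl⟩
  have hsum : ∀ ω : Fin (2 ^ (k + 1)) → Bool,
      ∑ b ∈ transversal k a c S b₁ b₂, (∏ i ∈ S, m (cellIdx k (a i) (c i) b)) *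
        ∏ i ∈ T, (extendSigns ω (cellIdx k (a i) (c i) b) *
          (-1) ^ cellIdx (k + 1) (a i) (c i) b) =
      ∑ b ∈ s, v b * ∏ q ∈ C b, coinSign (ω q) := by
    intro ω
    have hfilt : ∑ b ∈ s, (∏ i ∈ S, m (cellIdx k (a i) (c i) b)) *
        ∏ i ∈ T, (extendSigns ω (cellIdx k (a i) (c i) b) *
          (-1) ^ cellIdx (k + 1) (a i) (c i) b) =
        ∑ b ∈ transversal k a c S b₁ b₂, (∏ i ∈ S, m (cellIdx k (a i) (c i) b)) *
        ∏ i ∈ T, (extendSigns ω (cellIdx k (a i) (c i) b) *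
          (-1) ^ cellIdx (k + 1) (a i) (c i) b) := by
      refine Finset.sum_filter_of_ne fun b _ hb h => hb ?_
      simp only [hw, hφ] at h
      rw [h, zero_mul]
    rw [← hfilt]
    refine Finset.sum_congr rfl fun b hb => ?_
    rw [Finset.prod_mul_distrib, mul_left_comm, mul_comm (∏ i ∈ T, extendSigns _ _)]
    congr 1
    refine Finset.prod_bij (fun i hi => ⟨φ i b, hlt b hb i (hTS hi)⟩) ?_ ?_ ?_ ?_
    · intro i hi
      simp only [hC, Finset.mem_filter, Finset.mem_univ, true_and]
      exact ⟨i, hi, rfl⟩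
    · intro i hi l hl h
      have hh := Fin.mk.inj_iff.1 h
      exact (Finset.mem_filter.1 (Finset.mem_filter.1 hb).1).2 i (hTS hi) l (hTS hl) hh
    · intro q hq
      obtain ⟨i, hi, h⟩ := (Finset.mem_filter.1 hq).2
      exact ⟨i, hi, Fin.ext h⟩
    · intro i hi
      have := hlt b hb i (hTS hi)
      simp only [extendSigns]
      rw [dif_pos this]
  have hsub : s ⊆ Finset.Icc b₁ b₂ :=
    (Finset.filter_subset _ _).trans (Finset.filter_subset _ _)
  set V : ℝ := ∑ q ∈ Finset.range (2 ^ (k + 1)), (∑ b ∈ s with ∃ i ∈ T, φ i b = q, w b) ^ 2 with hVdef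
  have hV : ∑ q, (∑ b ∈ s with q ∈ C b, |v b|) ^ 2 ≤ V := by
    rw [hVdef, Finset.sum_range]
    refine Finset.sum_le_sum fun q _ => le_of_eq ?_
    simp only [hvabs, hC, Finset.mem_filter, Finset.mem_univ, true_and]
  have hmain := card_chaos_large v C s hsne V X hV hX
  rw [Fintype.card_fin] at hmain
  refine le_trans (Nat.cast_le.2 (Finset.card_le_card ?_)) hmain
  intro ω hω
  obtain ⟨B, hB, hlarge⟩ := (Finset.mem_filter.1 hω).2
  refine Finset.mem_filter.2 ⟨Finset.mem_univ _, ?_⟩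
  rw [← hsum]
  refine lt_of_le_of_lt ?_ hlarge
  refine mul_le_mul_of_nonneg_left (Real.sqrt_le_sqrt ?_) hX
  exact sum_sq_fiber_le (by positivity) s _ hsub w hw0 T φ B hB

lemma exists_signsGood (k : ℕ) (m : ℕ → ℝ) (hm : ∀ q, 0 ≤ m q)
    (hsupp : ∀ q, m q ≠ 0 → q < 2 ^ (k + 1)) :
    ∃ ε : ℕ → ℝ, (∀ q, ε q = 1 ∨ ε q = -1) ∧ SignsGood k m ε := by
  classical
  set bad : ∀ n N : ℕ, ((Fin n → Fin (2 ^ (N + 3))) × (Fin n → Fin (2 ^ (N + 3)))) ×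
      (Finset (Fin n) × Finset (Fin n)) × (Fin (2 ^ (N + 3)) × Fin (2 ^ (N + 3))) →
      Finset (Fin (2 ^ (k + 1)) → Bool) := fun n N t =>
    if t.2.1.2 ⊆ t.2.1.1 ∧ t.2.1.2.Nonempty then
    (Finset.univ.filter fun ω : Fin (2 ^ (k + 1)) → Bool => ∃ B : ℝ,
      (∀ q ∈ Finset.range (2 ^ (k + 1)),
        ∑ b ∈ Finset.Icc (t.2.2.1 : ℕ) t.2.2.2 with
          ∃ i ∈ t.2.1.2, cellIdx k (t.1.1 i) (t.1.2 i) b = q,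
        ∏ i ∈ t.2.1.1, m (cellIdx k (t.1.1 i) (t.1.2 i) b) ≤ B) ∧
      testSize n N * Real.sqrt (B * (n * ∑ b ∈ Finset.Icc (t.2.2.1 : ℕ) t.2.2.2,
        ∏ i ∈ t.2.1.1, m (cellIdx k (t.1.1 i) (t.1.2 i) b))) <
      |∑ b ∈ transversal k (fun i => (t.1.1 i : ℕ)) (fun i => (t.1.2 i : ℕ)) t.2.1.1 t.2.2.1 t.2.2.2,
        (∏ i ∈ t.2.1.1, m (cellIdx k (t.1.1 i) (t.1.2 i) b)) *
        ∏ i ∈ t.2.1.2, (extendSigns ω (cellIdx k (t.1.1 i) (t.1.2 i) b) *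
          (-1) ^ cellIdx (k + 1) (t.1.1 i) (t.1.2 i) b)|) else ∅ with hbad
  have hcard : ∀ n N t, ((bad n N t).card : ℝ) ≤
      2 ^ (2 ^ (k + 1)) * (4 * Real.exp (-(testSize n N : ℝ))) := by
    intro n N t
    simp only [hbad]
    split_ifs with h
    · convert card_bad_le k m hm hsupp (testSize n N) (Nat.cast_nonneg _) (fun i => (t.1.1 i : ℕ))
        (fun i => (t.1.2 i : ℕ)) t.2.1.1 t.2.1.2 h.1 h.2 t.2.2.1 t.2.2.2
    · simp only [Finset.card_empty, Nat.cast_zero]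
      positivity
  obtain ⟨ω, hω⟩ := exists_avoiding (fun n N => Finset.univ.biUnion (bad n N)) (by
    intro n N
    have h1 : ((Finset.univ.biUnion (bad n N)).card : ℝ) ≤
        ∑ t, ((bad n N t).card : ℝ) := by exact_mod_cast Finset.card_biUnion_le
    refine h1.trans ((Finset.sum_le_sum fun t _ => hcard n N t).trans ?_)
    rw [Finset.sum_const, nsmul_eq_mul, Finset.card_univ]
    simp only [Fintype.card_prod, Fintype.card_pi, Fintype.card_fin, Finset.prod_const,
      Finset.card_univ, Fintype.card_finset, Fintype.card_bool]
    push_cast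
    have hexp : Real.exp (-(testSize n N : ℝ)) ≤ (1 / 2 : ℝ) ^ testSize n N := by
      have h2 : Real.exp (-1) ≤ 1 / 2 := by
        have := Real.exp_neg_one_lt_d9
        linarith
      have h3 : Real.exp (-(testSize n N : ℝ)) = Real.exp (-1) ^ testSize n N := by
        rw [← Real.exp_nat_mul]; ring_nf
      rw [h3]
      exact pow_le_pow_left₀ (Real.exp_pos _).le h2 _
    have hfin : ((2 : ℝ) ^ (N + 3)) ^ n * (2 ^ (N + 3)) ^ n * (2 ^ n * 2 ^ n *
        (2 ^ (N + 3) * 2 ^ (N + 3))) * (4 * (1 / 2 : ℝ) ^ testSize n N) =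
        (1 / 2) ^ (n + N + 4) := by
      have : testSize n N = (N + 3) * n + (N + 3) * n + n + n + (N + 3) + (N + 3) + 2 +
          (n + N + 4) := by unfold testSize; ring
      rw [this, pow_add _ _ (n + N + 4), ← mul_assoc, ← mul_assoc]
      have h4 : (4 : ℝ) = 2 ^ 2 := by norm_num
      have h5 : ((2 : ℝ) ^ (N + 3)) ^ n * (2 ^ (N + 3)) ^ n * (2 ^ n * 2 ^ n *
        (2 ^ (N + 3) * 2 ^ (N + 3))) * 4 =
          2 ^ ((N + 3) * n + (N + 3) * n + n + n + (N + 3) + (N + 3) + 2) := by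
        rw [h4, ← pow_mul]; ring
      rw [h5, ← mul_pow]; norm_num
    rw [← hfin]
    have hP : (0 : ℝ) ≤ ((2 : ℝ) ^ (N + 3)) ^ n * (2 ^ (N + 3)) ^ n * (2 ^ n * 2 ^ n *
        (2 ^ (N + 3) * 2 ^ (N + 3))) := by positivity
    have hQ : (0 : ℝ) ≤ 2 ^ 2 ^ (k + 1) := by positivity
    calc _ ≤ ((2 : ℝ) ^ (N + 3)) ^ n * (2 ^ (N + 3)) ^ n * (2 ^ n * 2 ^ n *
        (2 ^ (N + 3) * 2 ^ (N + 3))) * (2 ^ 2 ^ (k + 1) * (4 * (1 / 2 : ℝ) ^ testSize n N)) := by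
          gcongr
      _ = _ := by ring)
  refine ⟨extendSigns ω, extendSigns_eq ω, ?_⟩
  intro n N a c ha hc S T hTS hT b₁ b₂ hb₁ hb₂ B hB
  by_contra hlt
  rw [not_le] at hlt
  apply hω n N
  refine Finset.mem_biUnion.2 ⟨((fun i => ⟨a i, ha i⟩, fun i => ⟨c i, hc i⟩), (S, T),
    (⟨b₁, hb₁⟩, ⟨b₂, hb₂⟩)), Finset.mem_univ _, ?_⟩
  simp only [hbad]
  rw [if_pos ⟨hTS, hT⟩]
  exact Finset.mem_filter.2 ⟨Finset.mem_univ _, B, hB, hlt⟩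

/-- Number of halvings performed by the cascade up to level `k`. -/
noncomputable def halvings (κ : ℝ) (k : ℕ) : ℕ := ⌊κ * k⌋₊

/-- A random-like dyadic cascade: `m k q` is the density of the level `k` measure on the cell
`[q 2 ^ -k, (q + 1) 2 ^ -k)`, and at the levels where `halvings` jumps, a half of each cell,
selected by the sign `ε k q`, is discarded. -/
structure IsCascade (κ : ℝ) (m ε : ℕ → ℕ → ℝ) : Prop where
  zero : ∀ q, m 0 q = if q = 1 then 1 else 0
  succ : ∀ k q, m (k + 1) q = m k (q / 2) *
    (1 + ((halvings κ (k + 1) : ℝ) - halvings κ k) * (ε k (q / 2) * (-1) ^ q))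
  sign : ∀ k q, ε k q = 1 ∨ ε k q = -1
  good : ∀ k, SignsGood k (m k) (ε k)

lemma halvings_zero (κ : ℝ) : halvings κ 0 = 0 := by simp [halvings]

lemma halvings_succ {κ : ℝ} (h0 : 0 ≤ κ) (h1 : κ ≤ 1) (k : ℕ) :
    halvings κ (k + 1) = halvings κ k ∨ halvings κ (k + 1) = halvings κ k + 1 := by
  have hle : halvings κ k ≤ halvings κ (k + 1) := by
    apply Nat.floor_le_floor
    push_cast
    nlinarith
  have hlt : halvings κ (k + 1) ≤ halvings κ k + 1 := by
    unfold halvings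
    rw [← Nat.floor_add_one (by positivity)]
    apply Nat.floor_le_floor
    push_cast
    nlinarith
  omega

lemma abs_halvings_sub {κ : ℝ} (h0 : 0 ≤ κ) (h1 : κ ≤ 1) (k : ℕ) :
    |(halvings κ (k + 1) : ℝ) - halvings κ k| ≤ 1 := by
  rcases halvings_succ h0 h1 k with h | h <;> rw [h] <;> simp

lemma two_pow_halvings_le {κ : ℝ} (h0 : 0 ≤ κ) (k : ℕ) :
    (2 : ℝ) ^ halvings κ k ≤ 2 ^ (κ * k) := by
  rw [← Real.rpow_natCast]
  exact Real.rpow_le_rpow_of_exponent_le (by norm_num) (Nat.floor_le (by positivity))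

lemma le_two_pow_halvings (κ : ℝ) (k : ℕ) :
    (2 : ℝ) ^ (κ * k) ≤ 2 * 2 ^ halvings κ k := by
  rw [← pow_succ', ← Real.rpow_natCast]
  refine Real.rpow_le_rpow_of_exponent_le (by norm_num) ?_
  push_cast
  exact (Nat.lt_floor_add_one _).le

/-- Sign chosen for given weights. -/
lemma exists_isCascade {κ : ℝ} (h0 : 0 ≤ κ) (h1 : κ ≤ 1) : ∃ m ε, IsCascade κ m ε := by
  have hch : ∀ (k : ℕ) (m : ℕ → ℝ), ∃ ε : ℕ → ℝ, (∀ q, ε q = 1 ∨ ε q = -1) ∧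
      (((∀ q, 0 ≤ m q) ∧ ∀ q, m q ≠ 0 → q < 2 ^ (k + 1)) → SignsGood k m ε) := by
    intro k m
    by_cases h : (∀ q, 0 ≤ m q) ∧ ∀ q, m q ≠ 0 → q < 2 ^ (k + 1)
    · obtain ⟨ε, h2, h3⟩ := exists_signsGood k m h.1 h.2
      exact ⟨ε, h2, fun _ => h3⟩
    · exact ⟨fun _ => 1, fun _ => Or.inl rfl, fun h2 => absurd h2 h⟩
  choose ε hε hgood using hch
  let m : ℕ → ℕ → ℝ := fun k => Nat.rec (fun q => if q = 1 then 1 else 0)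
    (fun k mk q => mk (q / 2) *
      (1 + ((halvings κ (k + 1) : ℝ) - halvings κ k) * (ε k mk (q / 2) * (-1) ^ q))) k
  have hsucc : ∀ k q, m (k + 1) q = m k (q / 2) *
      (1 + ((halvings κ (k + 1) : ℝ) - halvings κ k) * (ε k (m k) (q / 2) * (-1) ^ q)) :=
    fun k q => rfl
  refine ⟨m, fun k => ε k (m k), fun q => rfl, hsucc, fun k q => hε k (m k) q, fun k => ?_⟩
  apply hgood
  induction k with
  | zero =>
    refine ⟨fun q => ?_, fun q hq => ?_⟩
    · change (0 : ℝ) ≤ if q = 1 then 1 else 0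
      split_ifs <;> norm_num
    · change (if q = 1 then (1 : ℝ) else 0) ≠ 0 at hq
      split_ifs at hq with h
      · rw [h]; norm_num
      · simp at hq
  | succ k ih =>
    refine ⟨fun q => ?_, fun q hq => ?_⟩
    · rw [hsucc]
      refine mul_nonneg (ih.1 _) ?_
      have h3 := abs_halvings_sub h0 h1 k
      have h4 : |ε k (m k) (q / 2) * (-1) ^ q| = 1 := by
        rw [abs_mul, abs_pow, abs_neg, abs_one, one_pow, mul_one]
        rcases hε k (m k) (q / 2) with h | h <;> rw [h] <;> simp
      have h5 := abs_mul ((halvings κ (k + 1) : ℝ) - halvings κ k) (ε k (m k) (q / 2) * (-1) ^ q)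
      rw [h4, mul_one] at h5
      have := neg_abs_le (((halvings κ (k + 1) : ℝ) - halvings κ k) *
        (ε k (m k) (q / 2) * (-1) ^ q))
      linarith
    · rw [hsucc] at hq
      have := ih.2 _ (left_ne_zero_of_mul hq)
      rw [pow_succ]
      omega

namespace IsCascade

variable {κ : ℝ} {m ε : ℕ → ℕ → ℝ}

lemma eq_zero_or (h : IsCascade κ m ε) (h0 : 0 ≤ κ) (h1 : κ ≤ 1) (k q : ℕ) :
    m k q = 0 ∨ m k q = 2 ^ halvings κ k := by
  induction k generalizing q with
  | zero => rw [h.zero, halvings_zero]; split_ifs <;> simp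
  | succ k ih =>
    rw [h.succ]
    rcases ih (q / 2) with h2 | h2
    · left; rw [h2, zero_mul]
    rcases halvings_succ h0 h1 k with h3 | h3
    · right; rw [h2, h3]; simp
    · rw [h2, h3, pow_succ]
      push_cast
      rcases h.sign k (q / 2) with h4 | h4 <;> rcases neg_one_pow_eq_or ℝ q with h5 | h5 <;>
        rw [h4, h5]
      · right; ring
      · left; ring
      · left; ring
      · right; ring

lemma nonneg (h : IsCascade κ m ε) (h0 : 0 ≤ κ) (h1 : κ ≤ 1) (k q : ℕ) : 0 ≤ m k q := by
  rcases h.eq_zero_or h0 h1 k q with h2 | h2 <;> rw [h2]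
  positivity

lemma le_two_pow (h : IsCascade κ m ε) (h0 : 0 ≤ κ) (h1 : κ ≤ 1) (k q : ℕ) :
    m k q ≤ 2 ^ halvings κ k := by
  rcases h.eq_zero_or h0 h1 k q with h2 | h2 <;> rw [h2]
  positivity

lemma le_rpow (h : IsCascade κ m ε) (h0 : 0 ≤ κ) (h1 : κ ≤ 1) (k q : ℕ) :
    m k q ≤ 2 ^ (κ * k) :=
  (h.le_two_pow h0 h1 k q).trans (two_pow_halvings_le h0 k)

lemma mem_of_ne_zero (h : IsCascade κ m ε) {k q : ℕ} (hq : m k q ≠ 0) :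
    2 ^ k ≤ q ∧ q < 2 ^ (k + 1) := by
  induction k generalizing q with
  | zero =>
    rw [h.zero] at hq
    split_ifs at hq with h2
    · rw [h2]; norm_num
    · simp at hq
  | succ k ih =>
    rw [h.succ] at hq
    have := ih (left_ne_zero_of_mul hq)
    rw [pow_succ] at *
    rw [pow_succ]
    omega

lemma div_two_ne_zero (h : IsCascade κ m ε) {k q : ℕ} (hq : m (k + 1) q ≠ 0) :
    m k (q / 2) ≠ 0 := by
  rw [h.succ] at hq
  exact left_ne_zero_of_mul hq

lemma children (h : IsCascade κ m ε) (k q : ℕ) :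
    m (k + 1) (2 * q) + m (k + 1) (2 * q + 1) = 2 * m k q := by
  rw [h.succ, h.succ]
  have h2 : 2 * q / 2 = q := by omega
  have h3 : (2 * q + 1) / 2 = q := by omega
  rw [h2, h3, pow_succ, pow_mul]
  ring

end IsCascade

lemma card_le_of_diam {s : Finset ℕ} {L : ℕ} (h : ∀ b ∈ s, ∀ b' ∈ s, b' < b + L) :
    s.card ≤ L := by
  rcases s.eq_empty_or_nonempty with rfl | hs
  · simp
  have : s ⊆ Finset.Ico (s.min' hs) (s.min' hs + L) := fun b hb =>
    Finset.mem_Ico.2 ⟨s.min'_le b hb, h _ (s.min'_mem hs) b hb⟩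
  simpa using Finset.card_le_card this

lemma cellIdx_eq_iff {j a c b q : ℕ} (hc : 0 < c) :
    cellIdx j a c b = q ↔ q * c ≤ 2 ^ j * (b - a) ∧ 2 ^ j * (b - a) < (q + 1) * c := by
  unfold cellIdx
  rw [Nat.div_eq_iff hc]
  constructor
  · rintro ⟨h1, h2⟩
    refine ⟨h1, ?_⟩
    have := Nat.succ_le_of_lt hc
    rw [add_mul]; omega
  · rintro ⟨h1, h2⟩
    refine ⟨h1, ?_⟩
    rw [add_mul] at h2; omega

lemma lt_of_cellIdx_pos {j a c b : ℕ} (h : 0 < cellIdx j a c b) : a < b := by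
  by_contra hlt
  have : b - a = 0 := by omega
  simp [cellIdx, this] at h

lemma card_fiber_le {N j a c q : ℕ} (hj : j ≤ N) (hc0 : 0 < c) (hc : c ≤ 2 ^ (N + 1))
    (hq : 0 < q) (s : Finset ℕ) :
    (s.filter fun b => cellIdx j a c b = q).card ≤ 2 * 2 ^ (N - j) := by
  refine card_le_of_diam fun b hb b' hb' => ?_
  have h1 := (Finset.mem_filter.1 hb).2
  have h2 := (Finset.mem_filter.1 hb').2
  have h3 := lt_of_cellIdx_pos (h1 ▸ hq)
  have h4 := lt_of_cellIdx_pos (h2 ▸ hq)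
  rw [cellIdx_eq_iff hc0] at h1 h2
  by_contra hlt
  have h5 : b + 2 * 2 ^ (N - j) ≤ b' := by omega
  have h6 : (b - a) + 2 * 2 ^ (N - j) ≤ b' - a := by omega
  have h7 : 2 ^ j * (b - a) + 2 ^ (N + 1) ≤ 2 ^ j * (b' - a) := by
    have := Nat.mul_le_mul_left (2 ^ j) h6
    have h8 : 2 ^ (N + 1) = 2 ^ j * (2 * 2 ^ (N - j)) := by
      rw [mul_left_comm, ← pow_add, Nat.add_sub_cancel' hj, pow_succ]; ring
    rw [h8]; linarith
  have := h1.1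
  have := h2.2
  rw [add_mul] at this
  omega

/-- Inverse distance of grid points, in units of the whole grid. -/
noncomputable def sep (N x y : ℕ) : ℝ := 2 ^ N / max |(x : ℝ) - y| 1

lemma one_le_sep {N x y : ℕ} (hx : x ≤ 2 ^ N) (hy : y ≤ 2 ^ N) : 1 ≤ sep N x y := by
  unfold sep
  rw [le_div_iff₀ (by positivity), one_mul]
  have h1 : (x : ℝ) ≤ 2 ^ N := by exact_mod_cast hx
  have h2 : (y : ℝ) ≤ 2 ^ N := by exact_mod_cast hy
  have h3 : (0 : ℝ) ≤ x := Nat.cast_nonneg _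
  have h4 : (0 : ℝ) ≤ y := Nat.cast_nonneg _
  refine max_le (abs_le.2 ⟨by linarith, by linarith⟩) (one_le_pow₀ (by norm_num))

lemma hull_real {M P a a' c c' b b' q q' : ℝ} (hPpos : 0 < P) (hPM : P ≤ M)
    (C1 : M ≤ c) (C2 : c ≤ 2 * M) (C1' : M ≤ c') (C2' : c' ≤ 2 * M) (hq0 : 0 ≤ q)
    (hQ : q + 1 ≤ 2 * P) (hbb : b ≤ b')
    (u1 : q * c ≤ P * (b - a)) (v1 : P * (b - a) < (q + 1) * c)
    (u2 : q * c' ≤ P * (b - a')) (v2 : P * (b - a') < (q + 1) * c')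
    (u3 : q' * c ≤ P * (b' - a)) (v3 : P * (b' - a) < (q' + 1) * c)
    (u4 : q' * c' ≤ P * (b' - a')) (v4 : P * (b' - a') < (q' + 1) * c')
    (hlarge : 8 * M ≤ |a - a'| * P) (hΔM : |a - a'| ≤ 8 * M) :
    (b' - b + 1) * (|a - a'| * P) ≤ 65 * M * M := by
  have hMpos : 0 < M := hPpos.trans_le hPM
  set Δ : ℝ := |a - a'| with hΔ
  set E : ℝ := |c - c'| with hE
  have hE0 : 0 ≤ E := abs_nonneg _
  have hqE : q * E ≤ 2 * P * E := mul_le_mul_of_nonneg_right (by linarith) hE0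
  have hkey : P * Δ ≤ 2 * P * E + 2 * M := by
    have g1 := mul_le_mul_of_nonneg_left (le_abs_self (c - c')) hq0
    have g2 := mul_le_mul_of_nonneg_left (neg_le_abs (c - c')) hq0
    rw [← hE] at g1 g2
    rcases abs_cases (a - a') with ⟨h, _⟩ | ⟨h, _⟩
    · rw [hΔ, h]; linarith
    · rw [hΔ, h]; linarith
  have hEΔ : 3 * Δ ≤ 8 * E := by
    have : 3 * (P * Δ) ≤ 8 * (P * E) := by linarith
    by_contra hlt
    have := mul_lt_mul_of_pos_left (not_le.1 hlt) hPpos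
    linarith
  have key : ∀ {x y z w : ℝ}, 0 < x → 0 < y → x ≤ 2 * M → y ≤ 2 * M →
      q * x ≤ P * (b - z) → P * (b - w) < (q + 1) * y →
      P * (b' - z) < (q' + 1) * x → q' * y ≤ P * (b' - w) →
        P * (b' - b) * (y - x) ≤ 8 * M * M := by
    intro x y z w hx hy hx2 hy2 k1 k2 k3 k4
    have e1 := mul_lt_mul_of_pos_right (by linarith : P * (b' - b) < (q' + 1 - q) * x) hy
    have e2 := mul_lt_mul_of_pos_right (by linarith : (q' - q - 1) * y < P * (b' - b)) hx
    have e3 := mul_le_mul hx2 hy2 hy.le (by linarith : (0 : ℝ) ≤ 2 * M)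
    linarith
  have hslope : P * (b' - b) * E ≤ 8 * M * M := by
    rcases abs_cases (c - c') with ⟨h, _⟩ | ⟨h, _⟩
    · rw [hE, h]
      exact key (by linarith) (by linarith) C2' C2 u2 v1 v4 u3
    · rw [hE, h, neg_sub]
      exact key (by linarith) (by linarith) C2 C2' u1 v2 v3 u4
  have hD : 0 ≤ b' - b := by linarith
  have h9 := mul_le_mul_of_nonneg_left hEΔ (mul_nonneg hPpos.le hD)
  have h10 : Δ * P ≤ 8 * M * M := mul_le_mul hΔM hPM hPpos.le (by linarith)
  linarith

/-- Points at which two affine maps see the same cell of level `j` are close together. -/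
lemma hull_length {N j a c a' c' b b' q q' : ℕ} (hj : j ≤ N)
    (hc : 2 ^ N ≤ c) (hcu : c ≤ 2 ^ (N + 1))
    (hc' : 2 ^ N ≤ c') (hcu' : c' ≤ 2 ^ (N + 1))
    (hb' : b' < 2 ^ (N + 3)) (hbb : b ≤ b')
    (hq : 2 ^ j ≤ q) (hqu : q < 2 ^ (j + 1)) (hq' : 2 ^ j ≤ q')
    (h1 : cellIdx j a c b = q) (h2 : cellIdx j a' c' b = q)
    (h3 : cellIdx j a c b' = q') (h4 : cellIdx j a' c' b' = q') :
    ((b' + 1 - b : ℕ) : ℝ) ≤ 65 * sep N a a' / 2 ^ j * 2 ^ N := by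
  have hpos : 0 < 2 ^ j := by positivity
  have hcpos : 0 < c := lt_of_lt_of_le (by positivity) hc
  have hcpos' : 0 < c' := lt_of_lt_of_le (by positivity) hc'
  have l1 := lt_of_cellIdx_pos (h1 ▸ lt_of_lt_of_le hpos hq)
  have l2 := lt_of_cellIdx_pos (h2 ▸ lt_of_lt_of_le hpos hq)
  have l3 := lt_of_cellIdx_pos (h3 ▸ lt_of_lt_of_le hpos hq')
  have l4 := lt_of_cellIdx_pos (h4 ▸ lt_of_lt_of_le hpos hq')
  rw [cellIdx_eq_iff hcpos] at h1 h3
  rw [cellIdx_eq_iff hcpos'] at h2 h4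
  -- real versions
  set P : ℝ := 2 ^ j with hP
  set M : ℝ := 2 ^ N with hM
  have hPpos : 0 < P := by positivity
  have hMpos : 0 < M := by positivity
  have hPM : P ≤ M := pow_le_pow_right₀ (by norm_num) hj
  have cast : ∀ {x y z w : ℕ}, x < y → (z * w ≤ 2 ^ j * (y - x) ∧ 2 ^ j * (y - x) < (z + 1) * w) →
      (z : ℝ) * w ≤ P * (y - x) ∧ P * ((y : ℝ) - x) < (z + 1) * w := by
    intro x y z w hxy h
    have e : ((y - x : ℕ) : ℝ) = y - x := by push_cast [hxy.le]; rfl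
    rw [← e]
    constructor
    · have := h.1; simp only [hP]; exact_mod_cast this
    · have := h.2; simp only [hP]; exact_mod_cast this
  obtain ⟨u1, v1⟩ := cast l1 h1
  obtain ⟨u2, v2⟩ := cast l2 h2
  obtain ⟨u3, v3⟩ := cast l3 h3
  obtain ⟨u4, v4⟩ := cast l4 h4
  have C1 : M ≤ c := by simp only [hM]; exact_mod_cast hc
  have C2 : (c : ℝ) ≤ 2 * M := by
    have : (c : ℝ) ≤ 2 ^ (N + 1) := by exact_mod_cast hcu
    rw [pow_succ] at this; linarith
  have C1' : M ≤ c' := by simp only [hM]; exact_mod_cast hc'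
  have C2' : (c' : ℝ) ≤ 2 * M := by
    have : (c' : ℝ) ≤ 2 ^ (N + 1) := by exact_mod_cast hcu'
    rw [pow_succ] at this; linarith
  have hB : (b' : ℝ) + 1 ≤ 8 * M := by
    have : ((b' + 1 : ℕ) : ℝ) ≤ 2 ^ (N + 3) := by exact_mod_cast hb'
    rw [pow_add] at this; push_cast at this; linarith
  have hQ : (q : ℝ) + 1 ≤ 2 * P := by
    have : ((q + 1 : ℕ) : ℝ) ≤ 2 ^ (j + 1) := by exact_mod_cast hqu
    rw [pow_succ] at this; push_cast at this; linarith
  have hbbR : (b : ℝ) ≤ b' := by exact_mod_cast hbb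
  have ecast : ((b' + 1 - b : ℕ) : ℝ) = b' - b + 1 := by
    rw [Nat.cast_sub (by omega)]; push_cast; ring
  rw [ecast]
  set Δ : ℝ := |(a : ℝ) - a'| with hΔ
  have hΔ0 : 0 ≤ Δ := abs_nonneg _
  have hsep : sep N a a' = M / max Δ 1 := rfl
  rw [hsep]
  have hmax : 0 < max Δ 1 := lt_of_lt_of_le one_pos (le_max_right _ _)
  have erw : 65 * (M / max Δ 1) / P * M = 65 * M * M / (max Δ 1 * P) := by
    field_simp
  rw [erw, le_div_iff₀ (by positivity)]
  have hb0 : (0 : ℝ) ≤ b := Nat.cast_nonneg _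
  rcases lt_or_ge (Δ * P) (8 * M) with hsmall | hlarge
  · -- close maps: trivial bound
    have : max Δ 1 * P ≤ 8 * M := by
      rcases max_cases Δ 1 with ⟨h, _⟩ | ⟨h, _⟩ <;> rw [h] <;> linarith
    have := mul_le_mul (by linarith : (b' : ℝ) - b + 1 ≤ 8 * M) this (by positivity) (by linarith)
    nlinarith [mul_pos hMpos hMpos]
  · have hΔ1 : 1 ≤ Δ := by
      by_contra h
      have := mul_lt_mul_of_pos_right (not_le.1 h) hPpos
      linarith
    rw [max_eq_left hΔ1]
    have ha : (a : ℝ) ≤ 8 * M := by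
      have : (a : ℝ) < b := by exact_mod_cast l1
      linarith
    have ha' : (a' : ℝ) ≤ 8 * M := by
      have : (a' : ℝ) < b := by exact_mod_cast l2
      linarith
    have hz : (0 : ℝ) ≤ a := Nat.cast_nonneg _
    have hz' : (0 : ℝ) ≤ a' := Nat.cast_nonneg _
    exact hull_real hPpos hPM C1 C2 C1' C2' (Nat.cast_nonneg _) hQ hbbR u1 v1 u2 v2 u3 v3 u4 v4
      hlarge (abs_le.2 ⟨by linarith, by linarith⟩)

/-- Weight measuring how clustered the points `a i`, `i ∈ S`, are. -/
noncomputable def sepWeight {n : ℕ} (N : ℕ) (a : Fin n → ℕ) (S : Finset (Fin n)) : ℝ :=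
  ∏ l ∈ S, (1 + ∑ i ∈ S with i < l, sep N (a i) (a l))

/-- Correlation of the weights `m` along the affine maps `b ↦ (b - a i) / c i`, `i ∈ S`. -/
def corr {n : ℕ} (m : ℕ → ℝ) (j : ℕ) (a c : Fin n → ℕ) (S : Finset (Fin n)) (b₁ b₂ : ℕ) : ℝ :=
  ∑ b ∈ Finset.Icc b₁ b₂, ∏ i ∈ S, m (cellIdx j (a i) (c i) b)

lemma sep_nonneg (N x y : ℕ) : 0 ≤ sep N x y := by unfold sep; positivity

lemma one_le_sepWeight {n : ℕ} (N : ℕ) (a : Fin n → ℕ) (S : Finset (Fin n)) :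
    1 ≤ sepWeight N a S :=
  Finset.one_le_prod fun _ _ => le_add_of_nonneg_right
    (Finset.sum_nonneg fun _ _ => sep_nonneg _ _ _)

lemma sepWeight_erase_mul_le {n : ℕ} (N : ℕ) (a : Fin n → ℕ) {S : Finset (Fin n)} {l : Fin n}
    (hl : l ∈ S) :
    ∑ i ∈ S with i < l, sep N (a i) (a l) * sepWeight N a (S.erase l) ≤ sepWeight N a S := by
  have h0 : 0 ≤ sepWeight N a (S.erase l) := zero_le_one.trans (one_le_sepWeight N a _)
  rw [← Finset.sum_mul]
  conv_rhs => rw [sepWeight, ← Finset.mul_prod_erase _ _ hl]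
  refine mul_le_mul (by linarith) ?_ h0
    (add_nonneg zero_le_one (Finset.sum_nonneg fun _ _ => sep_nonneg _ _ _))
  refine Finset.prod_le_prod (fun _ _ => add_nonneg zero_le_one
    (Finset.sum_nonneg fun _ _ => sep_nonneg _ _ _)) fun i _ => ?_
  refine add_le_add_right (Finset.sum_le_sum_of_subset_of_nonneg
    (Finset.filter_subset_filter _ (Finset.erase_subset _ _)) fun _ _ _ => sep_nonneg _ _ _) 1

namespace IsCascade

variable {κ : ℝ} {m ε : ℕ → ℕ → ℝ}

lemma corr_nonneg (h : IsCascade κ m ε) (h0 : 0 ≤ κ) (h1 : κ ≤ 1) {n : ℕ} (j : ℕ)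
    (a c : Fin n → ℕ) (S : Finset (Fin n)) (b₁ b₂ : ℕ) : 0 ≤ corr (m j) j a c S b₁ b₂ :=
  Finset.sum_nonneg fun _ _ => Finset.prod_nonneg fun _ _ => h.nonneg h0 h1 _ _

/-- The contribution of the points at which two of the maps see the same cell of level `j`. -/
lemma degenerate_le (h : IsCascade κ m ε) (h0 : 0 ≤ κ) (h1 : κ ≤ 1) {N j J n : ℕ}
    (hJ : J = j ∨ J = j + 1) (hj : j ≤ N) {a c : Fin n → ℕ}
    (hc : ∀ i, 2 ^ N ≤ c i) (hcu : ∀ i, c i ≤ 2 ^ (N + 1)) (S : Finset (Fin n)) {b₁ b₂ : ℕ}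
    (hb : b₂ < 2 ^ (N + 3)) {K : ℝ} (hK0 : 0 ≤ K)
    (hK : ∀ l ∈ S, ∀ i ∈ S, i < l → ∀ b₁ b₂ : ℕ, b₂ < 2 ^ (N + 3) →
      ((b₂ + 1 - b₁ : ℕ) : ℝ) ≤ 65 * sep N (a i) (a l) / 2 ^ j * 2 ^ N →
      2 ^ (κ * J) * corr (m J) J a c (S.erase l) b₁ b₂ ≤
        K * (sep N (a i) (a l) * sepWeight N a (S.erase l))) :
    ∑ b ∈ Finset.Icc b₁ b₂ \ transversal j a c S b₁ b₂, ∏ i ∈ S, m J (cellIdx J (a i) (c i) b) ≤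
      n * K * sepWeight N a S := by
  classical
  set W : ℕ → ℝ := fun b => ∏ i ∈ S, m J (cellIdx J (a i) (c i) b) with hW
  have hW0 : ∀ b, 0 ≤ W b := fun b => Finset.prod_nonneg fun _ _ => h.nonneg h0 h1 _ _
  have hcell : ∀ b, W b ≠ 0 → ∀ i ∈ S, 2 ^ j ≤ cellIdx j (a i) (c i) b ∧
      cellIdx j (a i) (c i) b < 2 ^ (j + 1) := by
    intro b hb i hi
    have hne : m J (cellIdx J (a i) (c i) b) ≠ 0 := fun h2 => hb (Finset.prod_eq_zero hi h2)
    rcases hJ with rfl | rfl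
    · exact h.mem_of_ne_zero hne
    · have := h.mem_of_ne_zero (h.div_two_ne_zero hne)
      rwa [cellIdx_succ_div_two] at this
  have hpair : ∀ l ∈ S, ∀ i ∈ S, i < l →
      ∑ b ∈ Finset.Icc b₁ b₂ with cellIdx j (a i) (c i) b = cellIdx j (a l) (c l) b, W b ≤
        K * (sep N (a i) (a l) * sepWeight N a (S.erase l)) := by
    intro l hl i hi hil
    set D := (Finset.Icc b₁ b₂).filter fun b =>
      cellIdx j (a i) (c i) b = cellIdx j (a l) (c l) b ∧ W b ≠ 0 with hD
    have e1 : ∑ b ∈ Finset.Icc b₁ b₂ with cellIdx j (a i) (c i) b = cellIdx j (a l) (c l) b, W b =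
        ∑ b ∈ D, W b := by
      rw [hD, ← Finset.filter_filter]
      exact (Finset.sum_filter_ne_zero _).symm
    rw [e1]
    rcases D.eq_empty_or_nonempty with hDe | hDn
    · rw [hDe, Finset.sum_empty]
      exact mul_nonneg hK0 (mul_nonneg (sep_nonneg _ _ _)
        (zero_le_one.trans (one_le_sepWeight N a _)))
    have hmin := Finset.mem_filter.1 (D.min'_mem hDn)
    have hmax := Finset.mem_filter.1 (D.max'_mem hDn)
    have hmaxlt : D.max' hDn < 2 ^ (N + 3) := (Finset.mem_Icc.1 hmax.1).2.trans_lt hb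
    have hlen := hull_length hj (hc i) (hcu i) (hc l) (hcu l) hmaxlt
      (D.min'_le _ (D.max'_mem hDn)) (hcell _ hmin.2.2 i hi).1 (hcell _ hmin.2.2 i hi).2
      (hcell _ hmax.2.2 i hi).1 rfl hmin.2.1.symm rfl hmax.2.1.symm
    refine le_trans ?_ (hK l hl i hi hil _ _ hmaxlt hlen)
    rw [corr, Finset.mul_sum]
    refine le_trans (Finset.sum_le_sum fun b _ => ?_)
      (Finset.sum_le_sum_of_subset_of_nonneg (s := D)
        (fun b hb => Finset.mem_Icc.2 ⟨D.min'_le b hb, D.le_max' b hb⟩) fun b _ _ =>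
        mul_nonneg (by positivity) (Finset.prod_nonneg fun _ _ => h.nonneg h0 h1 _ _))
    rw [hW]
    simp only
    rw [← Finset.mul_prod_erase _ _ hl]
    exact mul_le_mul_of_nonneg_right (h.le_rpow h0 h1 _ _)
      (Finset.prod_nonneg fun _ _ => h.nonneg h0 h1 _ _)
  have hcover : ∀ b ∈ Finset.Icc b₁ b₂ \ transversal j a c S b₁ b₂,
      W b ≤ ∑ l ∈ S, ∑ i ∈ S with i < l,
        if cellIdx j (a i) (c i) b = cellIdx j (a l) (c l) b then W b else 0 := by
    intro b hb
    obtain ⟨hbI, hbt⟩ := Finset.mem_sdiff.1 hb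
    have hnn : ∀ l ∈ S, 0 ≤ ∑ i ∈ S with i < l,
        if cellIdx j (a i) (c i) b = cellIdx j (a l) (c l) b then W b else 0 := fun l _ =>
      Finset.sum_nonneg fun i _ => by split_ifs <;> [exact hW0 b; exact le_rfl]
    have hex : ∃ l ∈ S, ∃ i ∈ S, i < l ∧
        cellIdx j (a i) (c i) b = cellIdx j (a l) (c l) b := by
      have : ¬ ∀ i ∈ S, ∀ l ∈ S,
          cellIdx j (a i) (c i) b = cellIdx j (a l) (c l) b → i = l := fun h2 =>
        hbt (Finset.mem_filter.2 ⟨hbI, h2⟩)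
      push Not at this
      obtain ⟨i, hi, l, hl, he, hne⟩ := this
      rcases lt_or_gt_of_ne hne with h2 | h2
      · exact ⟨l, hl, i, hi, h2, he⟩
      · exact ⟨i, hi, l, hl, h2, he.symm⟩
    obtain ⟨l, hl, i, hi, hil, he⟩ := hex
    refine le_trans ?_ (Finset.single_le_sum hnn hl)
    refine le_trans ?_ (Finset.single_le_sum (fun i _ => ?_)
      (Finset.mem_filter.2 ⟨hi, hil⟩))
    · rw [if_pos he]
    · split_ifs <;> [exact hW0 b; exact le_rfl]
  refine (Finset.sum_le_sum hcover).trans ?_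
  rw [Finset.sum_comm]
  have hl : ∀ l ∈ S, ∑ b ∈ Finset.Icc b₁ b₂ \ transversal j a c S b₁ b₂, ∑ i ∈ S with i < l,
        (if cellIdx j (a i) (c i) b = cellIdx j (a l) (c l) b then W b else 0) ≤
        K * sepWeight N a S := by
    intro l hl
    rw [Finset.sum_comm]
    refine le_trans ?_ (mul_le_mul_of_nonneg_left (sepWeight_erase_mul_le N a hl) hK0)
    rw [Finset.mul_sum]
    refine Finset.sum_le_sum fun i hi => ?_
    obtain ⟨hi, hil⟩ := Finset.mem_filter.1 hi
    refine le_trans ?_ (hpair l hl i hi hil)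
    rw [← Finset.sum_filter]
    exact Finset.sum_le_sum_of_subset_of_nonneg
      (Finset.filter_subset_filter _ Finset.sdiff_subset) fun b _ _ => hW0 b
  refine (Finset.sum_le_sum hl).trans ?_
  rw [Finset.sum_const, nsmul_eq_mul, mul_assoc]
  refine mul_le_mul_of_nonneg_right ?_ (mul_nonneg hK0 (zero_le_one.trans (one_le_sepWeight N a _)))
  have := Finset.card_le_univ S
  rw [Fintype.card_fin] at this
  exact_mod_cast this

/-- Square-root cancellation over the points at which the maps see different cells. -/
lemma transversal_le (h : IsCascade κ m ε) (h0 : 0 ≤ κ) (h1 : κ ≤ 1) {N j n : ℕ}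
    (hj : j ≤ N) {a c : Fin n → ℕ} (ha : ∀ i, a i ≤ 2 ^ N)
    (hc : ∀ i, 2 ^ N ≤ c i) (hcu : ∀ i, c i ≤ 2 ^ (N + 1)) {S T : Finset (Fin n)} (hTS : T ⊆ S)
    (hT : T.Nonempty) {b₁ b₂ : ℕ} (hb₁ : b₁ < 2 ^ (N + 3)) (hb₂ : b₂ < 2 ^ (N + 3)) :
    |∑ b ∈ transversal j a c S b₁ b₂, (∏ i ∈ S, m j (cellIdx j (a i) (c i) b)) *
      ∏ i ∈ T, (ε j (cellIdx j (a i) (c i) b) * (-1) ^ cellIdx (j + 1) (a i) (c i) b)| ≤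
    testSize n N * Real.sqrt ((2 * n * 2 ^ N * (2 ^ (κ * j * S.card) / 2 ^ j)) *
      (n * corr (m j) j a c S b₁ b₂)) := by
  classical
  have hpow : (2 : ℕ) ^ N < 2 ^ (N + 3) := Nat.pow_lt_pow_right (by norm_num) (by omega)
  have hpow2 : (2 : ℕ) ^ (N + 1) < 2 ^ (N + 3) := Nat.pow_lt_pow_right (by norm_num) (by omega)
  refine h.good j n N a c (fun i => (ha i).trans_lt hpow) (fun i => (hcu i).trans_lt hpow2)
    S T hTS hT b₁ b₂ hb₁ hb₂ _ fun q _ => ?_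
  have hRHS : (2 * n * 2 ^ N * (2 ^ (κ * j * S.card) / 2 ^ j) : ℝ) =
      (n * (2 * 2 ^ (N - j)) : ℕ) * 2 ^ (κ * j * S.card) := by
    have : (2 : ℝ) ^ (N - j) = 2 ^ N / 2 ^ j := by
      rw [pow_sub₀ _ (by norm_num) hj]; rfl
    push_cast
    rw [this]
    ring
  rw [hRHS]
  rcases Nat.eq_zero_or_pos q with hq | hq
  · refine le_trans (le_of_eq (Finset.sum_eq_zero fun b hb => ?_)) (by positivity)
    obtain ⟨i, hi, hiq⟩ := (Finset.mem_filter.1 hb).2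
    refine Finset.prod_eq_zero (hTS hi) ?_
    by_contra hne
    have := (h.mem_of_ne_zero hne).1
    rw [hiq, hq] at this
    exact (by positivity : 0 < 2 ^ j).not_ge this
  · have hcard : ((Finset.Icc b₁ b₂).filter fun b =>
        ∃ i ∈ T, cellIdx j (a i) (c i) b = q).card ≤ n * (2 * 2 ^ (N - j)) := by
      have hsub : ((Finset.Icc b₁ b₂).filter fun b => ∃ i ∈ T, cellIdx j (a i) (c i) b = q) ⊆
          T.biUnion fun i => (Finset.Icc b₁ b₂).filter fun b => cellIdx j (a i) (c i) b = q := by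
        intro b hb
        obtain ⟨hb1, i, hi, hiq⟩ := Finset.mem_filter.1 hb
        exact Finset.mem_biUnion.2 ⟨i, hi, Finset.mem_filter.2 ⟨hb1, hiq⟩⟩
      refine (Finset.card_le_card hsub).trans (Finset.card_biUnion_le.trans ?_)
      refine (Finset.sum_le_card_nsmul _ _ _ fun i _ => card_fiber_le hj
        (lt_of_lt_of_le (by positivity) (hc i)) (hcu i) hq _).trans ?_
      rw [smul_eq_mul]
      refine Nat.mul_le_mul_right _ ?_
      simpa using Finset.card_le_univ T
    have hW : ∀ b, ∏ i ∈ S, m j (cellIdx j (a i) (c i) b) ≤ 2 ^ (κ * j * S.card) := by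
      intro b
      refine (Finset.prod_le_prod (fun i _ => h.nonneg h0 h1 _ _)
        fun i _ => h.le_rpow h0 h1 _ _).trans ?_
      rw [Finset.prod_const, ← Real.rpow_natCast, ← Real.rpow_mul (by norm_num)]
    refine (Finset.sum_le_card_nsmul _ _ _ fun b _ => hW b).trans ?_
    rw [nsmul_eq_mul]
    refine mul_le_mul_of_nonneg_right ?_ (by positivity)
    exact_mod_cast hcard

/-- Passage from level `j` to level `j + 1`. -/
lemma corr_succ_le (h : IsCascade κ m ε) (h0 : 0 ≤ κ) (h1 : κ ≤ 1) {N j n : ℕ}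
    (hj : j ≤ N) {a c : Fin n → ℕ} (ha : ∀ i, a i ≤ 2 ^ N)
    (hc : ∀ i, 2 ^ N ≤ c i) (hcu : ∀ i, c i ≤ 2 ^ (N + 1)) (S : Finset (Fin n))
    {b₁ b₂ : ℕ} (hb₁ : b₁ < 2 ^ (N + 3)) (hb₂ : b₂ < 2 ^ (N + 3)) :
    corr (m (j + 1)) (j + 1) a c S b₁ b₂ ≤ corr (m j) j a c S b₁ b₂ +
      2 ^ n * (testSize n N * Real.sqrt ((2 * n * 2 ^ N * (2 ^ (κ * j * S.card) / 2 ^ j)) *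
      (n * corr (m j) j a c S b₁ b₂))) +
      ∑ b ∈ Finset.Icc b₁ b₂ \ transversal j a c S b₁ b₂,
        ∏ i ∈ S, m (j + 1) (cellIdx (j + 1) (a i) (c i) b) := by
  classical
  set J : ℝ := (halvings κ (j + 1) : ℝ) - halvings κ j with hJdef
  have hJ1 : |J| ≤ 1 := abs_halvings_sub h0 h1 j
  set R : ℝ := testSize n N * Real.sqrt ((2 * n * 2 ^ N * (2 ^ (κ * j * S.card) / 2 ^ j)) *
      (n * corr (m j) j a c S b₁ b₂)) with hR
  have hR0 : 0 ≤ R := by positivity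
  have hsub : transversal j a c S b₁ b₂ ⊆ Finset.Icc b₁ b₂ := Finset.filter_subset _ _
  have hsplit := Finset.sum_sdiff hsub (f := fun b =>
    ∏ i ∈ S, m (j + 1) (cellIdx (j + 1) (a i) (c i) b))
  rw [corr, ← hsplit, add_comm]
  refine add_le_add_left ?_ _
  set F : Finset (Fin n) → ℝ := fun T => ∑ b ∈ transversal j a c S b₁ b₂,
    (∏ i ∈ S, m j (cellIdx j (a i) (c i) b)) *
      ∏ i ∈ T, (ε j (cellIdx j (a i) (c i) b) * (-1) ^ cellIdx (j + 1) (a i) (c i) b) with hF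
  have hexp : ∑ b ∈ transversal j a c S b₁ b₂,
      ∏ i ∈ S, m (j + 1) (cellIdx (j + 1) (a i) (c i) b) =
      ∑ T ∈ S.powerset, J ^ T.card * F T := by
    simp only [hF, Finset.mul_sum]
    rw [Finset.sum_comm]
    refine Finset.sum_congr rfl fun b _ => ?_
    simp only [h.succ, cellIdx_succ_div_two]
    rw [Finset.prod_mul_distrib, Finset.prod_one_add, Finset.mul_sum]
    refine Finset.sum_congr rfl fun T _ => ?_
    rw [Finset.prod_mul_distrib, Finset.prod_const]
    ring
  rw [hexp, ← Finset.add_sum_erase _ _ (Finset.empty_mem_powerset S)]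
  refine add_le_add ?_ ?_
  · simp only [hF, Finset.card_empty, pow_zero, one_mul, Finset.prod_empty, mul_one]
    exact Finset.sum_le_sum_of_subset_of_nonneg hsub fun b _ _ =>
      Finset.prod_nonneg fun _ _ => h.nonneg h0 h1 _ _
  · have hT : ∀ T ∈ S.powerset.erase ∅, J ^ T.card * F T ≤ R := by
      intro T hT
      obtain ⟨hne, hTS⟩ := Finset.mem_erase.1 hT
      refine (le_abs_self _).trans ?_
      rw [abs_mul, abs_pow]
      refine (mul_le_of_le_one_left (abs_nonneg _) (pow_le_one₀ (abs_nonneg _) hJ1)).trans ?_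
      exact h.transversal_le h0 h1 hj ha hc hcu (Finset.mem_powerset.1 hTS)
        (Finset.nonempty_iff_ne_empty.2 hne) hb₁ hb₂
    refine (Finset.sum_le_card_nsmul _ _ _ hT).trans ?_
    rw [nsmul_eq_mul]
    refine mul_le_mul_of_nonneg_right ?_ hR0
    have h2 : (S.powerset.erase ∅).card ≤ 2 ^ n := by
      refine (Finset.card_le_card (Finset.erase_subset _ _)).trans ?_
      rw [Finset.card_powerset]
      refine Nat.pow_le_pow_right (by norm_num) ?_
      simpa using Finset.card_le_univ S
    exact_mod_cast h2

end IsCascade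

/-- Expected size of an `m`-fold correlation of the cascade on an interval of length `ℓ`, down to
scale `2 ^ -k`. -/
noncomputable def growth (κ : ℝ) (k m : ℕ) (ℓ : ℝ) : ℝ :=
  max (ℓ ^ (1 - m * κ)) (2 ^ (k * (m * κ - 1)))

lemma growth_pos {κ ℓ : ℝ} (k m : ℕ) : 0 < growth κ k m ℓ :=
  lt_max_of_lt_right (by positivity)

lemma two_pow_div_eq (κ : ℝ) (j m : ℕ) :
    (2 : ℝ) ^ (κ * j * m) / 2 ^ j = (2 ^ j) ^ (m * κ - 1) := by
  rw [← Real.rpow_natCast, ← Real.rpow_sub (by norm_num), ← Real.rpow_mul (by norm_num)]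
  ring_nf

lemma mul_two_pow_le_growth {κ ℓ : ℝ} (h0 : 0 ≤ κ) (hℓ : 0 < ℓ) {j : ℕ} (k m : ℕ)
    (hj : ℓ * 2 ^ j ≤ 1) : ℓ * 2 ^ (κ * j * m) ≤ growth κ k m ℓ := by
  refine le_trans ?_ (le_max_left _ _)
  have h2 : (2 : ℝ) ^ (κ * j * m) = (2 ^ j) ^ (m * κ) := by
    rw [← Real.rpow_natCast, ← Real.rpow_mul (by norm_num)]; ring_nf
  have h3 : ((2 : ℝ) ^ j) ≤ ℓ⁻¹ := by
    rwa [← one_div, le_div_iff₀ hℓ, mul_comm]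
  rw [h2, Real.rpow_sub hℓ, Real.rpow_one, div_eq_mul_inv, ← Real.inv_rpow hℓ.le]
  exact mul_le_mul_of_nonneg_left
    (Real.rpow_le_rpow (by positivity) h3 (by positivity)) hℓ.le

lemma one_le_growth {κ ℓ : ℝ} (k m : ℕ) (hℓ : 1 ≤ ℓ) : 1 ≤ growth κ k m ℓ := by
  rcases le_total (m * κ) 1 with h | h
  · exact le_max_of_le_left (Real.one_le_rpow hℓ (by linarith))
  · exact le_max_of_le_right (Real.one_le_rpow (by norm_num)
      (mul_nonneg (Nat.cast_nonneg _) (by linarith)))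

lemma two_pow_div_le_growth {κ ℓ : ℝ} (h0 : 0 ≤ κ) (hℓ : 0 < ℓ) {j k : ℕ} (m : ℕ)
    (hj : 1 ≤ ℓ * 2 ^ (j + 1)) (hjk : j ≤ k) :
    (2 : ℝ) ^ (κ * j * m) / 2 ^ j ≤ 2 * growth κ k m ℓ := by
  rw [two_pow_div_eq]
  have h2j : (0 : ℝ) < 2 ^ j := by positivity
  rcases le_total (m * κ) 1 with h | h
  · have h2 : (2 ^ j : ℝ) ^ (m * κ - 1) = ((2 ^ j)⁻¹) ^ (1 - m * κ) := by
      rw [Real.inv_rpow h2j.le, ← Real.rpow_neg h2j.le]; ring_nf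
    have h3 : ((2 : ℝ) ^ j)⁻¹ ≤ 2 * ℓ := by
      rw [inv_le_iff_one_le_mul₀ h2j]
      rw [pow_succ] at hj; linarith
    rw [h2]
    calc ((2 : ℝ) ^ j)⁻¹ ^ (1 - m * κ) ≤ (2 * ℓ) ^ (1 - m * κ) :=
          Real.rpow_le_rpow (by positivity) h3 (by linarith)
      _ = 2 ^ (1 - m * κ) * ℓ ^ (1 - m * κ) := Real.mul_rpow (by norm_num) hℓ.le
      _ ≤ 2 * growth κ k m ℓ := by
          refine mul_le_mul ?_ (le_max_left _ _) (by positivity) (by norm_num)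
          calc (2 : ℝ) ^ (1 - m * κ) ≤ 2 ^ (1 : ℝ) :=
                Real.rpow_le_rpow_of_exponent_le (by norm_num)
                  (by have : 0 ≤ m * κ := by positivity
                      linarith)
            _ = 2 := Real.rpow_one 2
  · have h3 : (2 ^ j : ℝ) ^ (m * κ - 1) ≤ growth κ k m ℓ := by
      refine le_trans ?_ (le_max_right _ _)
      rw [← Real.rpow_natCast, ← Real.rpow_mul (by norm_num)]
      refine Real.rpow_le_rpow_of_exponent_le (by norm_num) ?_
      have : (j : ℝ) ≤ k := by exact_mod_cast hjk
      exact mul_le_mul_of_nonneg_right this (by linarith)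
    have := growth_pos (κ := κ) (ℓ := ℓ) k m
    linarith

lemma growth_pred_le {κ ρ : ℝ} (h0 : 0 ≤ κ) (hρ : 1 ≤ ρ) {j J k : ℕ} (m : ℕ)
    (hJ : J = j ∨ J = j + 1) (hJk : J ≤ k) :
    2 ^ (κ * J) * growth κ k m (65 * ρ / 2 ^ j) ≤
      130 * ρ * max (2 ^ (κ * J * (m + 1 : ℕ)) / 2 ^ J) (2 ^ (k * ((m + 1 : ℕ) * κ - 1))) := by
  have h65 : 1 ≤ 65 * ρ := by linarith
  have hJpos : (0 : ℝ) < 2 ^ J := by positivity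
  have hjpos : (0 : ℝ) < 2 ^ j := by positivity
  have hpow : (2 : ℝ) ^ (κ * J) = (2 ^ J) ^ κ := by
    rw [← Real.rpow_natCast, ← Real.rpow_mul (by norm_num), mul_comm]
  rw [growth, mul_max_of_nonneg _ _ (by positivity)]
  refine max_le ?_ ?_
  · refine le_trans ?_ (mul_le_mul_of_nonneg_left (le_max_left _ _) (by positivity))
    rw [two_pow_div_eq, hpow]
    have key : (65 * ρ / 2 ^ j) ^ (1 - m * κ) ≤ 130 * ρ * (2 ^ J : ℝ) ^ (m * κ - 1) := by
      have hinv : (2 ^ J : ℝ) ^ (m * κ - 1) = ((2 ^ J)⁻¹) ^ (1 - m * κ) := by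
        rw [Real.inv_rpow hJpos.le, ← Real.rpow_neg hJpos.le]; ring_nf
      rw [div_eq_mul_inv, Real.mul_rpow (by linarith) (by positivity), hinv]
      rcases le_total (m * κ) 1 with h | h
      · have e1 : (65 * ρ) ^ (1 - m * κ) ≤ 65 * ρ := by
          have hmk : 0 ≤ m * κ := by positivity
          calc (65 * ρ) ^ (1 - m * κ) ≤ (65 * ρ) ^ (1 : ℝ) :=
                Real.rpow_le_rpow_of_exponent_le h65 (by linarith)
            _ = 65 * ρ := Real.rpow_one _
        have e2 : ((2 : ℝ) ^ j)⁻¹ ^ (1 - m * κ) ≤ 2 * ((2 : ℝ) ^ J)⁻¹ ^ (1 - m * κ) := by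
          have e3 : ((2 : ℝ) ^ j)⁻¹ ≤ 2 * ((2 : ℝ) ^ J)⁻¹ := by
            rcases hJ with rfl | rfl
            · have : 0 < ((2 : ℝ) ^ J)⁻¹ := by positivity
              linarith
            · rw [pow_succ, mul_inv]; linarith
          calc ((2 : ℝ) ^ j)⁻¹ ^ (1 - m * κ) ≤ (2 * ((2 : ℝ) ^ J)⁻¹) ^ (1 - m * κ) :=
                Real.rpow_le_rpow (by positivity) e3 (by linarith)
            _ = 2 ^ (1 - m * κ) * ((2 : ℝ) ^ J)⁻¹ ^ (1 - m * κ) :=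
                Real.mul_rpow (by norm_num) (by positivity)
            _ ≤ _ := by
                refine mul_le_mul_of_nonneg_right ?_ (by positivity)
                have hmk : 0 ≤ m * κ := by positivity
                calc (2 : ℝ) ^ (1 - m * κ) ≤ 2 ^ (1 : ℝ) :=
                      Real.rpow_le_rpow_of_exponent_le (by norm_num) (by linarith)
                  _ = 2 := Real.rpow_one 2
        calc _ ≤ (65 * ρ) * (2 * ((2 : ℝ) ^ J)⁻¹ ^ (1 - m * κ)) :=
              mul_le_mul e1 e2 (by positivity) (by linarith)
          _ = _ := by ring
      · have e1 : (65 * ρ) ^ (1 - m * κ) ≤ 130 * ρ :=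
          (Real.rpow_le_one_of_one_le_of_nonpos h65 (by linarith)).trans (by linarith)
        have e2 : ((2 : ℝ) ^ j)⁻¹ ^ (1 - m * κ) ≤ ((2 : ℝ) ^ J)⁻¹ ^ (1 - m * κ) := by
          refine Real.rpow_le_rpow_of_nonpos (by positivity) ?_ (by linarith)
          refine inv_anti₀ hjpos (pow_le_pow_right₀ (by norm_num) ?_)
          omega
        exact mul_le_mul e1 e2 (by positivity) (by linarith)
    calc (2 ^ J : ℝ) ^ κ * (65 * ρ / 2 ^ j) ^ (1 - m * κ) ≤
          (2 ^ J : ℝ) ^ κ * (130 * ρ * (2 ^ J : ℝ) ^ (m * κ - 1)) :=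
          mul_le_mul_of_nonneg_left key (by positivity)
      _ = 130 * ρ * ((2 ^ J : ℝ) ^ κ * (2 ^ J : ℝ) ^ (m * κ - 1)) := by ring
      _ = _ := by
          rw [← Real.rpow_add hJpos]; push_cast; ring_nf
  · refine le_trans ?_ (mul_le_mul_of_nonneg_left (le_max_right _ _) (by positivity))
    rw [← Real.rpow_add (by norm_num)]
    have hJkR : (J : ℝ) ≤ k := by exact_mod_cast hJk
    have : (2 : ℝ) ^ (κ * J + k * (m * κ - 1)) ≤ 2 ^ (k * ((m + 1 : ℕ) * κ - 1)) := by
      refine Real.rpow_le_rpow_of_exponent_le (by norm_num) ?_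
      push_cast
      nlinarith
    refine this.trans (le_mul_of_one_le_left (by positivity) (by linarith))

lemma growth_pred_le_growth {κ ρ ℓ : ℝ} (h0 : 0 ≤ κ) (hρ : 1 ≤ ρ) (hℓ : 0 < ℓ) {j J k : ℕ} (m : ℕ)
    (hJ : J = j ∨ J = j + 1) (hJk : J ≤ k) (hJℓ : 1 ≤ ℓ * 2 ^ (J + 1)) :
    2 ^ (κ * J) * growth κ k m (65 * ρ / 2 ^ j) ≤ 260 * ρ * growth κ k (m + 1) ℓ := by
  refine (growth_pred_le h0 hρ m hJ hJk).trans ?_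
  have h2 := two_pow_div_le_growth h0 hℓ (m + 1) hJℓ hJk
  have h3 : (2 : ℝ) ^ (k * ((m + 1 : ℕ) * κ - 1)) ≤ growth κ k (m + 1) ℓ := le_max_right _ _
  have h4 := growth_pos (κ := κ) (ℓ := ℓ) k (m + 1)
  have : max ((2 : ℝ) ^ (κ * J * (m + 1 : ℕ)) / 2 ^ J) (2 ^ (k * ((m + 1 : ℕ) * κ - 1))) ≤
      2 * growth κ k (m + 1) ℓ := max_le h2 (by linarith)
  calc _ ≤ 130 * ρ * (2 * growth κ k (m + 1) ℓ) := mul_le_mul_of_nonneg_left this (by positivity)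
    _ = _ := by ring

lemma testSize_le (n N : ℕ) : (testSize n N : ℝ) ≤ (9 * n + 13) * (N + 1) := by
  unfold testSize
  push_cast
  have : (0 : ℝ) ≤ n * N := by positivity
  have : (0 : ℝ) ≤ N := by positivity
  nlinarith

namespace IsCascade

variable {κ : ℝ} {m ε : ℕ → ℕ → ℝ}

lemma corr_le_card (h : IsCascade κ m ε) (h0 : 0 ≤ κ) (h1 : κ ≤ 1) {n : ℕ} (j : ℕ)
    (a c : Fin n → ℕ) (S : Finset (Fin n)) (b₁ b₂ : ℕ) :
    corr (m j) j a c S b₁ b₂ ≤ (b₂ + 1 - b₁ : ℕ) * 2 ^ (κ * j * S.card) := by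
  rw [corr]
  have hW : ∀ b, ∏ i ∈ S, m j (cellIdx j (a i) (c i) b) ≤ 2 ^ (κ * j * S.card) := by
    intro b
    refine (Finset.prod_le_prod (fun i _ => h.nonneg h0 h1 _ _)
      fun i _ => h.le_rpow h0 h1 _ _).trans ?_
    rw [Finset.prod_const, ← Real.rpow_natCast, ← Real.rpow_mul (by norm_num)]
  refine (Finset.sum_le_card_nsmul _ _ _ fun b _ => hW b).trans ?_
  rw [nsmul_eq_mul, Nat.card_Icc]

/-- Correlations of the cascade have the expected size, up to logarithms. -/
lemma corr_le (h0 : 0 ≤ κ) (h1 : κ ≤ 1) (n r : ℕ) :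
    ∃ (C : ℝ) (E : ℕ), 0 ≤ C ∧ ∀ m ε, IsCascade κ m ε → ∀ (N k : ℕ), k ≤ N → ∀ a c : Fin n → ℕ,
      (∀ i, a i ≤ 2 ^ N) → (∀ i, 2 ^ N ≤ c i) → (∀ i, c i ≤ 2 ^ (N + 1)) →
      ∀ S : Finset (Fin n), S.card = r → ∀ j ≤ k, ∀ b₁ b₂ : ℕ, b₁ < 2 ^ (N + 3) →
      b₂ < 2 ^ (N + 3) → ∀ ℓ : ℝ, 0 < ℓ → ((b₂ + 1 - b₁ : ℕ) : ℝ) ≤ ℓ * 2 ^ N →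
      corr (m j) j a c S b₁ b₂ ≤
        C * (N + 1) ^ E * (2 ^ N * growth κ k r ℓ * sepWeight N a S) := by
  induction r with
  | zero =>
    refine ⟨1, 0, zero_le_one, ?_⟩
    intro m ε h N k _ a c _ _ _ S hS j _ b₁ b₂ _ _ ℓ hℓ hlen
    refine (h.corr_le_card h0 h1 j a c S b₁ b₂).trans ?_
    rw [hS]
    have h2 : ℓ ≤ growth κ k 0 ℓ := by
      refine le_trans (le_of_eq ?_) (le_max_left _ _)
      simp
    have h3 := one_le_sepWeight N a S
    have h4 := growth_pos (κ := κ) (ℓ := ℓ) k 0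
    simp only [Nat.cast_zero, mul_zero, Real.rpow_zero, mul_one, pow_zero, one_mul]
    calc ((b₂ + 1 - b₁ : ℕ) : ℝ) ≤ ℓ * 2 ^ N := hlen
      _ ≤ growth κ k 0 ℓ * 2 ^ N := mul_le_mul_of_nonneg_right h2 (by positivity)
      _ = 2 ^ N * growth κ k 0 ℓ := mul_comm _ _
      _ ≤ _ := le_mul_of_one_le_right (by positivity) h3
  | succ r ih =>
    obtain ⟨C, E, hC, ih⟩ := ih
    set c₀ : ℝ := 1 + 260 * n * C + 2 ^ (n + 1) * n * (9 * n + 13) with hc₀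
    have hc₀1 : 1 ≤ c₀ := by
      have : 0 ≤ 260 * n * C + 2 ^ (n + 1) * n * (9 * n + 13) := by positivity
      linarith
    refine ⟨9 * c₀ ^ 2, 2 * E + 4, by positivity, ?_⟩
    intro m ε h N k hkN a c ha hc hcu S hS j hjk b₁ b₂ hb₁ hb₂ ℓ hℓ hlen
    set Y : ℝ := c₀ * (N + 1) ^ (E + 1) with hY
    set V : ℝ := 2 ^ N * growth κ k (r + 1) ℓ * sepWeight N a S with hV
    have hgpos := growth_pos (κ := κ) (ℓ := ℓ) k (r + 1)
    have hw1 := one_le_sepWeight N a S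
    have hV0 : 0 < V := by positivity
    have hN1 : (1 : ℝ) ≤ N + 1 := by
      have : (0 : ℝ) ≤ N := Nat.cast_nonneg _
      linarith
    have hpow1 : (1 : ℝ) ≤ (N + 1) ^ (E + 1) := one_le_pow₀ hN1
    have hY1 : 1 ≤ Y := by nlinarith
    have hYX : 2 ^ (n + 1) * n * (testSize n N : ℝ) ≤ Y := by
      calc 2 ^ (n + 1) * n * (testSize n N : ℝ) ≤
          2 ^ (n + 1) * n * ((9 * n + 13) * (N + 1)) :=
            mul_le_mul_of_nonneg_left (testSize_le n N) (by positivity)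
        _ = (2 ^ (n + 1) * n * (9 * n + 13)) * (N + 1) := by ring
        _ ≤ c₀ * (N + 1) ^ (E + 1) := by
            refine mul_le_mul ?_ (le_self_pow₀ hN1 (by omega)) (by positivity) (by positivity)
            have : 0 ≤ 260 * n * C := by positivity
            linarith
    have hYK : n * (260 * (C * (N + 1) ^ E)) ≤ Y ^ 2 := by
      refine le_trans ?_ (le_self_pow₀ hY1 (by norm_num))
      calc n * (260 * (C * (N + 1) ^ E)) = (260 * n * C) * (N + 1) ^ E := by ring
        _ ≤ c₀ * (N + 1) ^ (E + 1) := by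
            refine mul_le_mul ?_ (pow_le_pow_right₀ hN1 (by omega)) (by positivity) (by positivity)
            have : (0 : ℝ) ≤ 2 ^ (n + 1) * n * (9 * n + 13) := by positivity
            linarith
    have htriv : ∀ i, ℓ * 2 ^ i ≤ 1 → corr (m i) i a c S b₁ b₂ ≤ V := by
      intro i hi
      refine (h.corr_le_card h0 h1 i a c S b₁ b₂).trans ?_
      rw [hS]
      calc ((b₂ + 1 - b₁ : ℕ) : ℝ) * 2 ^ (κ * i * (r + 1 : ℕ)) ≤
            (ℓ * 2 ^ N) * 2 ^ (κ * i * (r + 1 : ℕ)) :=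
            mul_le_mul_of_nonneg_right hlen (by positivity)
        _ = 2 ^ N * (ℓ * 2 ^ (κ * i * (r + 1 : ℕ))) := by ring
        _ ≤ 2 ^ N * growth κ k (r + 1) ℓ :=
            mul_le_mul_of_nonneg_left (mul_two_pow_le_growth h0 hℓ k _ hi) (by positivity)
        _ ≤ V := le_mul_of_one_le_right (by positivity) hw1
    have hmain : ∀ i ≤ k, corr (m i) i a c S b₁ b₂ ≤ (3 + i * Y) ^ 2 * V := by
      intro i
      induction i with
      | zero =>
        intro _
        have h9 : (3 + ((0 : ℕ) : ℝ) * Y) ^ 2 * V = 9 * V := by push_cast; ring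
        rw [h9]
        rcases le_or_gt ℓ 1 with hl | hl
        · have := htriv 0 (by simpa using hl)
          linarith
        · have h3 := h.corr_le_card h0 h1 0 a c S b₁ b₂
          simp only [Nat.cast_zero, mul_zero, zero_mul, Real.rpow_zero, mul_one] at h3
          have h4 : ((b₂ + 1 - b₁ : ℕ) : ℝ) ≤ 8 * 2 ^ N := by
            have : b₂ + 1 - b₁ ≤ 8 * 2 ^ N := by rw [pow_add] at hb₂; omega
            exact_mod_cast this
          have h5 := one_le_growth (κ := κ) k (r + 1) hl.le
          have h6 : (2 : ℝ) ^ N ≤ V := by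
            rw [hV, mul_assoc]
            exact le_mul_of_one_le_right (by positivity) (one_le_mul_of_one_le_of_one_le h5 hw1)
          linarith
      | succ i ihi =>
        intro hik
        have hi := ihi (by omega)
        rcases le_or_gt (ℓ * 2 ^ (i + 1)) 1 with hl | hl
        · refine (htriv _ hl).trans (le_mul_of_one_le_left hV0.le ?_)
          have : 0 ≤ ((i + 1 : ℕ) : ℝ) * Y := by positivity
          nlinarith
        have hl2 : 1 ≤ ℓ * 2 ^ (i + 1 + 1) := by
          have : (0 : ℝ) < ℓ * 2 ^ (i + 1) := by positivity
          rw [pow_succ]; linarith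
        set u : ℝ := 3 + i * Y with hu
        have hu0 : 0 ≤ u := by positivity
        have hstep := h.corr_succ_le h0 h1 (by omega : i ≤ N) ha hc hcu S hb₁ hb₂
        have hdeg := h.degenerate_le h0 h1 (j := i) (J := i + 1) (Or.inr rfl) (by omega) hc hcu S hb₂
          (b₁ := b₁) (K := 260 * (C * (N + 1) ^ E) * (2 ^ N * growth κ k (r + 1) ℓ))
          (by positivity) (by
            intro l hl' q hq hql b₁' b₂' hb₂' hlen'
            have hρ := one_le_sep (ha q) (ha l)
            have hcardl : (S.erase l).card = r := by
              rw [Finset.card_erase_of_mem hl', hS]; rfl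
            rcases Nat.lt_or_ge b₁' (2 ^ (N + 3)) with hb1 | hb1
            · have h5 := ih m ε h N k hkN a c ha hc hcu (S.erase l) hcardl (i + 1) hik b₁' b₂' hb1
                hb₂' _ (by positivity) hlen'
              have h6 := growth_pred_le_growth h0 hρ hℓ (j := i) r (Or.inr rfl) hik hl2
              have hwl := zero_le_one.trans (one_le_sepWeight N a (S.erase l))
              calc _ ≤ 2 ^ (κ * (i + 1 : ℕ)) * (C * (N + 1) ^ E * (2 ^ N *
                    growth κ k r (65 * sep N (a q) (a l) / 2 ^ i) * sepWeight N a (S.erase l))) :=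
                    mul_le_mul_of_nonneg_left h5 (by positivity)
                _ = (2 ^ (κ * (i + 1 : ℕ)) * growth κ k r (65 * sep N (a q) (a l) / 2 ^ i)) *
                    (C * (N + 1) ^ E * (2 ^ N * sepWeight N a (S.erase l))) := by ring
                _ ≤ (260 * sep N (a q) (a l) * growth κ k (r + 1) ℓ) *
                    (C * (N + 1) ^ E * (2 ^ N * sepWeight N a (S.erase l))) :=
                    mul_le_mul_of_nonneg_right h6 (by positivity)
                _ = _ := by ring
            · rw [corr, Finset.Icc_eq_empty (by omega), Finset.sum_empty, mul_zero]
              have := one_le_sepWeight N a (S.erase l)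
              positivity)
        have htr : 2 ^ n * (testSize n N * Real.sqrt ((2 * n * 2 ^ N *
            (2 ^ (κ * i * S.card) / 2 ^ i)) * (n * corr (m i) i a c S b₁ b₂))) ≤ u * Y * V := by
          have hB : (2 * n * 2 ^ N * (2 ^ (κ * i * S.card) / 2 ^ i)) *
              (n * corr (m i) i a c S b₁ b₂) ≤ (2 * n * u * V) ^ 2 := by
            rw [hS]
            have h5 := two_pow_div_le_growth h0 hℓ (r + 1) hl.le (by omega : i ≤ k)
            have h6 : (2 : ℝ) ^ N * (2 ^ (κ * i * (r + 1 : ℕ)) / 2 ^ i) ≤ 2 * V := by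
              calc _ ≤ (2 : ℝ) ^ N * (2 * growth κ k (r + 1) ℓ) :=
                    mul_le_mul_of_nonneg_left h5 (by positivity)
                _ = 2 * (2 ^ N * growth κ k (r + 1) ℓ) := by ring
                _ ≤ 2 * V := by
                    refine mul_le_mul_of_nonneg_left ?_ (by norm_num)
                    exact le_mul_of_one_le_right (by positivity) hw1
            calc _ = 2 * n ^ 2 * ((2 : ℝ) ^ N * (2 ^ (κ * i * (r + 1 : ℕ)) / 2 ^ i)) *
                  corr (m i) i a c S b₁ b₂ := by ring
              _ ≤ 2 * n ^ 2 * (2 * V) * (u ^ 2 * V) :=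
                  mul_le_mul (mul_le_mul_of_nonneg_left h6 (by positivity)) hi
                    (h.corr_nonneg h0 h1 _ _ _ _ _ _) (by positivity)
              _ = _ := by ring
          have hs : Real.sqrt ((2 * n * 2 ^ N * (2 ^ (κ * i * S.card) / 2 ^ i)) *
              (n * corr (m i) i a c S b₁ b₂)) ≤ 2 * n * u * V := by
            rw [← Real.sqrt_sq (by positivity : 0 ≤ 2 * n * u * V)]
            exact Real.sqrt_le_sqrt hB
          calc _ ≤ 2 ^ n * (testSize n N * (2 * n * u * V)) := by gcongr
            _ = (2 ^ (n + 1) * n * (testSize n N : ℝ)) * (u * V) := by ring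
            _ ≤ Y * (u * V) := mul_le_mul_of_nonneg_right hYX (by positivity)
            _ = _ := by ring
        have hdeg2 : n * (260 * (C * (N + 1) ^ E) * (2 ^ N * growth κ k (r + 1) ℓ)) *
            sepWeight N a S ≤ Y ^ 2 * V := by
          calc _ = n * (260 * (C * (N + 1) ^ E)) * V := by rw [hV]; ring
            _ ≤ _ := mul_le_mul_of_nonneg_right hYK hV0.le
        have hfin : (3 + ((i + 1 : ℕ) : ℝ) * Y) ^ 2 * V =
            u ^ 2 * V + 2 * (u * Y * V) + Y ^ 2 * V := by rw [hu]; push_cast; ring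
        rw [hfin]
        have : 0 ≤ u * Y * V := by positivity
        linarith
    refine (hmain j hjk).trans (mul_le_mul_of_nonneg_right ?_ hV0.le)
    have hjN : (j : ℝ) ≤ N := by exact_mod_cast hjk.trans hkN
    have h7 : 3 + j * Y ≤ 3 * ((N + 1) * Y) := by nlinarith
    calc (3 + j * Y) ^ 2 ≤ (3 * ((N + 1) * Y)) ^ 2 := pow_le_pow_left₀ (by positivity) h7 2
      _ = 9 * c₀ ^ 2 * (N + 1) ^ (2 * E + 4) := by rw [hY]; ring

end IsCascade

/-- Difference of consecutive densities of a cascade. -/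
def increment (m : ℕ → ℕ → ℝ) (k q : ℕ) : ℝ := m (k + 1) q - m k (q / 2)

/-- Size of the `n`-fold correlation of the increments of a cascade at level `k`. -/
noncomputable def gain (κ : ℝ) (n k : ℕ) : ℝ :=
  Real.sqrt (2 ^ (k * (n * κ - 1)) * max 1 (2 ^ (k * (n * κ - 1))))

lemma le_gain (κ : ℝ) (n k : ℕ) : (2 : ℝ) ^ (k * (n * κ - 1)) ≤ gain κ n k := by
  refine Real.le_sqrt_of_sq_le ?_
  rw [sq]
  exact mul_le_mul_of_nonneg_left (le_max_right _ _) (by positivity)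

namespace IsCascade

variable {κ : ℝ} {m ε : ℕ → ℕ → ℝ}

lemma increment_eq (h : IsCascade κ m ε) (k q : ℕ) :
    increment m k q = ((halvings κ (k + 1) : ℝ) - halvings κ k) *
      (m k (q / 2) * (ε k (q / 2) * (-1) ^ q)) := by
  rw [increment, h.succ]; ring

lemma abs_increment_le (h : IsCascade κ m ε) (h0 : 0 ≤ κ) (h1 : κ ≤ 1) (k q : ℕ) :
    |increment m k q| ≤ m k (q / 2) := by
  rw [h.increment_eq, abs_mul, abs_mul, abs_mul, abs_pow, abs_neg, abs_one, one_pow, mul_one,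
    abs_of_nonneg (h.nonneg h0 h1 _ _)]
  have h4 : |ε k (q / 2)| = 1 := by
    rcases h.sign k (q / 2) with h | h <;> rw [h] <;> simp
  rw [h4, mul_one]
  exact mul_le_of_le_one_left (h.nonneg h0 h1 _ _) (abs_halvings_sub h0 h1 k)

/-- Cancellation in correlations of the increments of a cascade. -/
lemma abs_sum_prod_increment_le (h0 : 0 ≤ κ) (h1 : κ ≤ 1) (n : ℕ) :
    ∃ (C : ℝ) (E : ℕ), 0 ≤ C ∧ ∀ m ε, IsCascade κ m ε → ∀ (N k : ℕ), k ≤ N →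
      ∀ a c : Fin (n + 1) → ℕ,
      (∀ i, a i ≤ 2 ^ N) → (∀ i, 2 ^ N ≤ c i) → (∀ i, c i ≤ 2 ^ (N + 1)) →
      |∑ b ∈ Finset.range (2 ^ (N + 3)),
        ∏ i, increment m k (cellIdx (k + 1) (a i) (c i) b)| ≤
        C * (N + 1) ^ E * (2 ^ N * gain κ (n + 1) k * sepWeight N a Finset.univ) := by
  obtain ⟨C₁, E₁, hC₁, hcorr⟩ := corr_le h0 h1 (n + 1) (n + 1)
  obtain ⟨C₀, E₀, hC₀, hcorr'⟩ := corr_le h0 h1 (n + 1) n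
  refine ⟨(9 * (n + 1 : ℕ) + 13) * (4 * (n + 1 : ℕ)) * (1 + C₁) + (n + 1 : ℕ) * (130 * C₀),
    E₁ + E₀ + 1, by positivity, ?_⟩
  intro m ε h N k hkN a c ha hc hcu
  have hN1 : (1 : ℝ) ≤ N + 1 := by
    have : (0 : ℝ) ≤ N := Nat.cast_nonneg _
    linarith
  set Q : ℝ := 2 ^ (k * ((n + 1 : ℕ) * κ - 1)) with hQ
  have hQ0 : 0 < Q := by positivity
  have hQ' : (2 : ℝ) ^ (κ * k * (n + 1 : ℕ)) / 2 ^ k = Q := by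
    rw [two_pow_div_eq, hQ, ← Real.rpow_natCast, ← Real.rpow_mul (by norm_num)]
  set G : ℝ := gain κ (n + 1) k with hG
  have hQG : Q ≤ G := le_gain _ _ _
  have hG0 : 0 < G := hQ0.trans_le hQG
  set S : Finset (Fin (n + 1)) := Finset.univ with hS
  have hScard : S.card = n + 1 := by simp [hS]
  set w : ℝ := sepWeight N a S with hw
  have hw1 : 1 ≤ w := one_le_sepWeight N a S
  have hw0 : 0 < w := by linarith
  set b₂ : ℕ := 2 ^ (N + 3) - 1 with hb₂
  have hpos : 0 < 2 ^ (N + 3) := by positivity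
  have hrange : Finset.range (2 ^ (N + 3)) = Finset.Icc 0 b₂ := by
    ext x
    rw [Finset.mem_range, Finset.mem_Icc]
    omega
  have hb₂lt : b₂ < 2 ^ (N + 3) := by omega
  have hsub : transversal k a c S 0 b₂ ⊆ Finset.Icc 0 b₂ := Finset.filter_subset _ _
  rw [hrange, ← Finset.sum_sdiff hsub]
  refine (abs_add_le _ _).trans ?_
  have hdeg : |∑ b ∈ Finset.Icc 0 b₂ \ transversal k a c S 0 b₂,
      ∏ i, increment m k (cellIdx (k + 1) (a i) (c i) b)| ≤
      (n + 1 : ℕ) * (130 * C₀ * (N + 1) ^ E₀ * (2 ^ N * Q)) * w := by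
    refine (Finset.abs_sum_le_sum_abs _ _).trans ?_
    refine le_trans (Finset.sum_le_sum fun b _ => ?_)
      (h.degenerate_le h0 h1 (j := k) (J := k) (Or.inl rfl) hkN hc hcu S hb₂lt (b₁ := 0)
        (K := 130 * C₀ * (N + 1) ^ E₀ * (2 ^ N * Q)) (by positivity) ?_)
    · rw [Finset.abs_prod]
      refine Finset.prod_le_prod (fun _ _ => abs_nonneg _) fun i _ => ?_
      have := h.abs_increment_le h0 h1 k (cellIdx (k + 1) (a i) (c i) b)
      rwa [cellIdx_succ_div_two] at this
    · intro l hl q hq hql b₁' b₂' hb₂' hlen'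
      have hρ := one_le_sep (ha q) (ha l)
      have hcardl : (S.erase l).card = n := by
        rw [Finset.card_erase_of_mem hl, hScard]; rfl
      rcases Nat.lt_or_ge b₁' (2 ^ (N + 3)) with hb1 | hb1
      · have h5 := hcorr' m ε h N k hkN a c ha hc hcu (S.erase l) hcardl k le_rfl b₁' b₂' hb1
          hb₂' _ (by positivity) hlen'
        have h6 := growth_pred_le h0 hρ (j := k) n (Or.inl rfl) (le_refl k)
        rw [hQ', max_self] at h6
        have hwl := zero_le_one.trans (one_le_sepWeight N a (S.erase l))
        calc _ ≤ 2 ^ (κ * k) * (C₀ * (N + 1) ^ E₀ * (2 ^ N *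
              growth κ k n (65 * sep N (a q) (a l) / 2 ^ k) * sepWeight N a (S.erase l))) :=
              mul_le_mul_of_nonneg_left h5 (by positivity)
          _ = (2 ^ (κ * k) * growth κ k n (65 * sep N (a q) (a l) / 2 ^ k)) *
              (C₀ * (N + 1) ^ E₀ * (2 ^ N * sepWeight N a (S.erase l))) := by ring
          _ ≤ (130 * sep N (a q) (a l) * Q) *
              (C₀ * (N + 1) ^ E₀ * (2 ^ N * sepWeight N a (S.erase l))) :=
              mul_le_mul_of_nonneg_right h6 (by positivity)
          _ = _ := by ring
      · rw [corr, Finset.Icc_eq_empty (by omega), Finset.sum_empty, mul_zero]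
        have := one_le_sepWeight N a (S.erase l)
        positivity
  have htr : |∑ b ∈ transversal k a c S 0 b₂,
      ∏ i, increment m k (cellIdx (k + 1) (a i) (c i) b)| ≤
      ((9 * (n + 1 : ℕ) + 13) * (N + 1)) *
        (4 * (n + 1 : ℕ) * ((1 + C₁) * (N + 1) ^ E₁) * (2 ^ N * G * w)) := by
    set J : ℝ := (halvings κ (k + 1) : ℝ) - halvings κ k with hJdef
    have hJ1 : |J| ≤ 1 := abs_halvings_sub h0 h1 k
    have hexp : ∑ b ∈ transversal k a c S 0 b₂,
        ∏ i, increment m k (cellIdx (k + 1) (a i) (c i) b) =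
        J ^ (n + 1) * ∑ b ∈ transversal k a c S 0 b₂,
          (∏ i ∈ S, m k (cellIdx k (a i) (c i) b)) *
          ∏ i ∈ S, (ε k (cellIdx k (a i) (c i) b) * (-1) ^ cellIdx (k + 1) (a i) (c i) b) := by
      rw [Finset.mul_sum]
      refine Finset.sum_congr rfl fun b _ => ?_
      simp only [h.increment_eq, cellIdx_succ_div_two]
      rw [Finset.prod_mul_distrib, Finset.prod_mul_distrib, Finset.prod_const, hScard]
    rw [hexp, abs_mul, abs_pow]
    refine (mul_le_of_le_one_left (abs_nonneg _) (pow_le_one₀ (abs_nonneg _) hJ1)).trans ?_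
    refine (h.transversal_le h0 h1 hkN ha hc hcu (subset_refl S) Finset.univ_nonempty
      hpos hb₂lt).trans ?_
    have hK := hcorr m ε h N k hkN a c ha hc hcu S hScard k le_rfl 0 b₂ hpos hb₂lt 8 (by norm_num)
      (by
        have : b₂ + 1 - 0 = 8 * 2 ^ N := by rw [hb₂]; rw [pow_add] at *; omega
        rw [this]; push_cast; rfl)
    have hg8 : growth κ k (n + 1) 8 ≤ 8 * max 1 Q := by
      refine max_le ?_ ?_
      · have h8 : (8 : ℝ) ^ (1 - (n + 1 : ℕ) * κ) ≤ 8 := by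
          have : (0 : ℝ) ≤ (n + 1 : ℕ) * κ := by positivity
          calc (8 : ℝ) ^ (1 - (n + 1 : ℕ) * κ) ≤ 8 ^ (1 : ℝ) :=
                Real.rpow_le_rpow_of_exponent_le (by norm_num) (by linarith)
            _ = 8 := Real.rpow_one _
        have := le_max_left 1 Q
        linarith
      · have := le_max_right 1 Q
        linarith
    have hK2 : corr (m k) k a c S 0 b₂ ≤ ((1 + C₁) * (N + 1) ^ E₁) ^ 2 *
        (8 * 2 ^ N * max 1 Q * w ^ 2) := by
      refine hK.trans ?_
      have h1C : C₁ * (N + 1) ^ E₁ ≤ ((1 + C₁) * (N + 1) ^ E₁) ^ 2 := by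
        have hp : (1 : ℝ) ≤ (N + 1) ^ E₁ := one_le_pow₀ hN1
        refine le_trans ?_ (le_self_pow₀ (one_le_mul_of_one_le_of_one_le (by linarith) hp)
          (by norm_num))
        exact mul_le_mul_of_nonneg_right (by linarith) (by linarith)
      refine mul_le_mul h1C ?_ (by have := growth_pos (κ := κ) (ℓ := 8) k (n + 1); positivity)
        (by positivity)
      calc 2 ^ N * growth κ k (n + 1) 8 * w ≤ 2 ^ N * (8 * max 1 Q) * w ^ 2 := by
            refine mul_le_mul (mul_le_mul_of_nonneg_left hg8 (by positivity))
              (le_self_pow₀ hw1 (by norm_num)) hw0.le (by positivity)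
        _ = _ := by ring
    refine mul_le_mul (testSize_le (n + 1) N) ?_ (Real.sqrt_nonneg _) (by positivity)
    rw [hScard, hQ']
    refine Real.sqrt_le_iff.2 ⟨by positivity, ?_⟩
    have hG2 : G ^ 2 = Q * max 1 Q := Real.sq_sqrt (by positivity)
    calc 2 * ((n + 1 : ℕ) : ℝ) * 2 ^ N * Q * ((n + 1 : ℕ) * corr (m k) k a c S 0 b₂) ≤
          2 * ((n + 1 : ℕ) : ℝ) * 2 ^ N * Q * ((n + 1 : ℕ) * (((1 + C₁) * (N + 1) ^ E₁) ^ 2 *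
        (8 * 2 ^ N * max 1 Q * w ^ 2))) := by gcongr
      _ = 16 * ((n + 1 : ℕ) : ℝ) ^ 2 * ((1 + C₁) * (N + 1) ^ E₁) ^ 2 * (2 ^ N) ^ 2 *
          (Q * max 1 Q) * w ^ 2 := by ring
      _ = _ := by rw [← hG2]; ring
  refine (add_le_add hdeg htr).trans ?_
  have hV : 0 < 2 ^ N * G * w := by positivity
  have e1 : ((n + 1 : ℕ) : ℝ) * (130 * C₀ * (N + 1) ^ E₀ * (2 ^ N * Q)) * w ≤
      ((n + 1 : ℕ) * (130 * C₀)) * (N + 1) ^ (E₁ + E₀ + 1) * (2 ^ N * G * w) := by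
    calc _ = ((n + 1 : ℕ) * (130 * C₀)) * (N + 1) ^ E₀ * (2 ^ N * Q * w) := by ring
      _ ≤ _ := by
        gcongr
        omega
  have e2 : ((9 * ((n + 1 : ℕ) : ℝ) + 13) * (N + 1)) *
        (4 * (n + 1 : ℕ) * ((1 + C₁) * (N + 1) ^ E₁) * (2 ^ N * G * w)) ≤
      ((9 * (n + 1 : ℕ) + 13) * (4 * (n + 1 : ℕ)) * (1 + C₁)) * (N + 1) ^ (E₁ + E₀ + 1) *
        (2 ^ N * G * w) := by
    calc _ = ((9 * ((n + 1 : ℕ) : ℝ) + 13) * (4 * (n + 1 : ℕ)) * (1 + C₁)) * (N + 1) ^ (E₁ + 1) *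
        (2 ^ N * G * w) := by ring
      _ ≤ _ := by
        gcongr
        omega
  calc _ ≤ _ := add_le_add e1 e2
    _ = _ := by ring

end IsCascade

lemma sepWeight_snoc {n : ℕ} (N : ℕ) (a : Fin n → ℕ) (x : ℕ) :
    sepWeight N (Fin.snoc a x : Fin (n + 1) → ℕ) Finset.univ =
      sepWeight N a Finset.univ * (1 + ∑ i, sep N (a i) x) := by
  unfold sepWeight
  rw [Fin.prod_univ_castSucc]
  congr 1
  · refine Finset.prod_congr rfl fun l _ => ?_
    congr 1
    rw [Finset.sum_filter, Finset.sum_filter, Fin.sum_univ_castSucc]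
    have : ¬ Fin.last n < l.castSucc := not_lt.2 (Fin.le_last _)
    simp [this]
  · congr 1
    rw [Finset.sum_filter, Fin.sum_univ_castSucc]
    simp [Fin.castSucc_lt_last]

lemma sum_sep_le (N y : ℕ) :
    ∑ x ∈ Finset.range (2 ^ N), sep N y x ≤ 2 ^ N * (3 * (N + 1)) := by
  have hharm : ∀ n : ℕ, ∑ i ∈ Finset.range (2 ^ n), (1 / max (i : ℝ) 1) ≤ 1 + n := by
    intro n
    induction n with
    | zero => simp
    | succ n ih =>
      have hsplit : 2 ^ (n + 1) = 2 ^ n + 2 ^ n := by rw [pow_succ]; ring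
      rw [hsplit, Finset.sum_range_add]
      have h2 : ∑ i ∈ Finset.range (2 ^ n), (1 / max ((2 ^ n + i : ℕ) : ℝ) 1) ≤ 1 := by
        refine (Finset.sum_le_card_nsmul _ _ (1 / 2 ^ n) fun i _ => ?_).trans ?_
        · refine one_div_le_one_div_of_le (by positivity) (le_max_of_le_left ?_)
          push_cast
          have : (0 : ℝ) ≤ i := Nat.cast_nonneg _
          linarith
        · rw [Finset.card_range, nsmul_eq_mul]
          push_cast
          rw [mul_one_div_cancel (by positivity)]
      push_cast at h2 ⊢
      linarith
  have hN := hharm N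
  unfold sep
  simp only [div_eq_mul_one_div ((2 : ℝ) ^ N)]
  rw [← Finset.mul_sum]
  refine mul_le_mul_of_nonneg_left ?_ (by positivity)
  -- each distance is attained at most twice
  have hle : ∀ x ∈ Finset.range (2 ^ N), 1 / max |(y : ℝ) - x| 1 ≤
      (if x ≤ y then 1 / max ((y - x : ℕ) : ℝ) 1 else 0) +
      (if y < x then 1 / max ((x - y : ℕ) : ℝ) 1 else 0) := by
    intro x _
    rcases le_or_gt x y with h | h
    · rw [if_pos h, if_neg (not_lt.2 h), add_zero, Nat.cast_sub h]
      exact one_div_le_one_div_of_le (by positivity) (max_le_max_right _ (le_abs_self _))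
    · rw [if_neg (not_le.2 h), if_pos h, zero_add, Nat.cast_sub h.le]
      refine one_div_le_one_div_of_le (by positivity) (max_le_max_right _ ?_)
      rw [abs_sub_comm]
      exact le_abs_self _
  refine (Finset.sum_le_sum hle).trans ?_
  rw [Finset.sum_add_distrib, ← Finset.sum_filter, ← Finset.sum_filter]
  have hr : ∑ x ∈ Finset.range (2 ^ N) with y < x, 1 / max ((x - y : ℕ) : ℝ) 1 ≤
      ∑ i ∈ Finset.range (2 ^ N), (1 / max (i : ℝ) 1) := by
    rw [← Finset.sum_image (f := fun i : ℕ => 1 / max (i : ℝ) 1) (g := fun x => x - y)]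
    · refine Finset.sum_le_sum_of_subset_of_nonneg ?_ fun _ _ _ => by positivity
      intro i hi
      obtain ⟨x, hx, rfl⟩ := Finset.mem_image.1 hi
      have := Finset.mem_range.1 (Finset.mem_filter.1 hx).1
      exact Finset.mem_range.2 (by omega)
    · intro x hx z hz hxz
      have h1 := (Finset.mem_filter.1 hx).2
      have h2 := (Finset.mem_filter.1 hz).2
      simp only at hxz
      omega
  have hl : ∑ x ∈ Finset.range (2 ^ N) with x ≤ y, 1 / max ((y - x : ℕ) : ℝ) 1 ≤
      1 + ∑ i ∈ Finset.range (2 ^ N), (1 / max (i : ℝ) 1) := by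
    rcases lt_or_ge y (2 ^ N) with hy | hy
    · rw [← Finset.sum_image (f := fun i : ℕ => 1 / max (i : ℝ) 1) (g := fun x => y - x)]
      · refine le_add_of_nonneg_of_le zero_le_one
          (Finset.sum_le_sum_of_subset_of_nonneg ?_ fun _ _ _ => by positivity)
        intro i hi
        obtain ⟨x, hx, rfl⟩ := Finset.mem_image.1 hi
        exact Finset.mem_range.2 (by omega)
      · intro x hx z hz hxz
        have h1 := (Finset.mem_filter.1 hx).2
        have h2 := (Finset.mem_filter.1 hz).2
        simp only at hxz
        omega
    · refine le_add_of_nonneg_of_le zero_le_one ?_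
      refine (Finset.sum_le_sum_of_subset_of_nonneg (Finset.filter_subset _ _)
        fun _ _ _ => by positivity).trans ?_
      rw [← Finset.sum_range_reflect (fun i : ℕ => 1 / max (i : ℝ) 1)]
      refine Finset.sum_le_sum fun x hx => ?_
      have hx := Finset.mem_range.1 hx
      refine one_div_le_one_div_of_le (by positivity) (max_le_max_right _ ?_)
      have : 2 ^ N - 1 - x ≤ y - x := by omega
      exact_mod_cast this
  have : (0 : ℝ) ≤ N := Nat.cast_nonneg _
  linarith

lemma sum_sepWeight_le (N : ℕ) {Ω : Finset ℕ} (hΩ : Ω ⊆ Finset.range (2 ^ N)) (n : ℕ) :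
    ∑ a : Fin (n + 1) → Ω, sepWeight N (fun i => (a i : ℕ)) Finset.univ ≤
      ((1 + 3 * n) * (N + 1) * 2 ^ N) ^ n * Ω.card := by
  have hsum : ∀ n : ℕ, ∑ a : Fin (n + 1) → Ω, sepWeight N (fun i => (a i : ℕ)) Finset.univ =
      ∑ a : Fin n → Ω, sepWeight N (fun i => (a i : ℕ)) Finset.univ *
        ∑ x : Ω, (1 + ∑ i, sep N (a i) x) := by
    intro n
    rw [← (Fin.snocEquiv fun _ => Ω).sum_comp, Fintype.sum_prod_type_right]
    refine Finset.sum_congr rfl fun a _ => ?_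
    rw [Finset.mul_sum]
    refine Finset.sum_congr rfl fun x _ => ?_
    rw [← sepWeight_snoc]
    congr 1
    funext i
    simp only [Fin.snocEquiv, Equiv.coe_fn_mk]
    refine Fin.lastCases ?_ (fun i => ?_) i
    · simp
    · simp
  have hN1 : (1 : ℝ) ≤ N + 1 := by
    have : (0 : ℝ) ≤ N := Nat.cast_nonneg _
    linarith
  induction n with
  | zero =>
    rw [hsum]
    simp [sepWeight]
  | succ n ih =>
    rw [hsum]
    have hx : ∀ a : Fin (n + 1) → Ω, ∑ x : Ω, (1 + ∑ i, sep N (a i) x) ≤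
        (1 + 3 * (n + 1 : ℕ)) * (N + 1) * 2 ^ N := by
      intro a
      rw [Finset.sum_coe_sort Ω (fun x => 1 + ∑ i, sep N (a i) x)]
      refine (Finset.sum_le_sum_of_subset_of_nonneg hΩ fun x _ _ =>
        add_nonneg zero_le_one (Finset.sum_nonneg fun _ _ => sep_nonneg _ _ _)).trans ?_
      rw [Finset.sum_add_distrib, Finset.sum_comm, Finset.sum_const, Finset.card_range,
        nsmul_eq_mul]
      have h2 := Finset.sum_le_card_nsmul Finset.univ
        (fun i => ∑ x ∈ Finset.range (2 ^ N), sep N (a i) x) _ fun i _ => sum_sep_le N (a i)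
      rw [Finset.card_univ, Fintype.card_fin, nsmul_eq_mul] at h2
      push_cast at h2 ⊢
      have h3 : (2 : ℝ) ^ N ≤ (N + 1) * 2 ^ N := le_mul_of_one_le_left (by positivity) hN1
      linarith
    calc _ ≤ ∑ a : Fin (n + 1) → Ω, sepWeight N (fun i => (a i : ℕ)) Finset.univ *
          ((1 + 3 * (n + 1 : ℕ)) * (N + 1) * 2 ^ N) :=
          Finset.sum_le_sum fun a _ => mul_le_mul_of_nonneg_left (hx a)
            (zero_le_one.trans (one_le_sepWeight _ _ _))
      _ = (∑ a : Fin (n + 1) → Ω, sepWeight N (fun i => (a i : ℕ)) Finset.univ) *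
          ((1 + 3 * (n + 1 : ℕ)) * (N + 1) * 2 ^ N) := (Finset.sum_mul _ _ _).symm
      _ ≤ (((1 + 3 * n) * (N + 1) * 2 ^ N) ^ n * Ω.card) *
          ((1 + 3 * (n + 1 : ℕ)) * (N + 1) * 2 ^ N) :=
          mul_le_mul_of_nonneg_right ih (by positivity)
      _ ≤ (((1 + 3 * (n + 1 : ℕ)) * (N + 1) * 2 ^ N) ^ n * Ω.card) *
          ((1 + 3 * (n + 1 : ℕ)) * (N + 1) * 2 ^ N) := by
          gcongr
          omega
      _ = _ := by ring

/-- Superposition of increments, rescaled by `c a` and translated to `a`, for `a ∈ Ω`. -/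
def superposition (m : ℕ → ℕ → ℝ) (k : ℕ) (Ω : Finset ℕ) (η : ℕ → ℝ) (c : ℕ → ℕ) (b : ℕ) : ℝ :=
  ∑ a ∈ Ω, η a * increment m k (cellIdx (k + 1) a (c a) b)

lemma sum_superposition_pow_le {κ : ℝ} (h0 : 0 ≤ κ) (h1 : κ ≤ 1) (n : ℕ) :
    ∃ (C : ℝ) (E : ℕ), 0 ≤ C ∧ ∀ m ε, IsCascade κ m ε → ∀ (N k : ℕ), k ≤ N →
      ∀ Ω ⊆ Finset.range (2 ^ N), ∀ (η : ℕ → ℝ) (c : ℕ → ℕ), (∀ a, |η a| ≤ 1) →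
      (∀ a, 2 ^ N ≤ c a) → (∀ a, c a ≤ 2 ^ (N + 1)) →
      ∑ b ∈ Finset.range (2 ^ (N + 3)), superposition m k Ω η c b ^ (n + 1) ≤
        C * (N + 1) ^ E * ((2 ^ N) ^ (n + 1) * gain κ (n + 1) k * Ω.card) := by
  obtain ⟨C, E, hC, hmain⟩ := IsCascade.abs_sum_prod_increment_le h0 h1 n
  refine ⟨C * (1 + 3 * n) ^ n, E + n, by positivity, ?_⟩
  intro m ε h N k hkN Ω hΩ η c hη hc hcu
  have hexp : ∑ b ∈ Finset.range (2 ^ (N + 3)), superposition m k Ω η c b ^ (n + 1) =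
      ∑ a : Fin (n + 1) → Ω, (∏ i, η (a i)) * ∑ b ∈ Finset.range (2 ^ (N + 3)),
        ∏ i, increment m k (cellIdx (k + 1) (a i) (c (a i)) b) := by
    simp only [Finset.mul_sum]
    rw [Finset.sum_comm]
    refine Finset.sum_congr rfl fun b _ => ?_
    rw [superposition, ← Finset.sum_coe_sort Ω]
    rw [Fintype.sum_pow]
    refine Finset.sum_congr rfl fun a _ => ?_
    rw [Finset.prod_mul_distrib]
  rw [hexp]
  have hG0 : 0 ≤ gain κ (n + 1) k := Real.sqrt_nonneg _
  calc _ ≤ ∑ a : Fin (n + 1) → Ω, C * (N + 1) ^ E *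
        (2 ^ N * gain κ (n + 1) k * sepWeight N (fun i => (a i : ℕ)) Finset.univ) := by
        refine Finset.sum_le_sum fun a _ => (le_abs_self _).trans ?_
        rw [abs_mul, Finset.abs_prod]
        refine (mul_le_of_le_one_left (abs_nonneg _)
          (Finset.prod_le_one (fun _ _ => abs_nonneg _) fun i _ => hη _)).trans ?_
        exact hmain m ε h N k hkN (fun i => (a i : ℕ)) (fun i => c (a i))
          (fun i => (Finset.mem_range.1 (hΩ (a i).2)).le) (fun i => hc _) (fun i => hcu _)
    _ = C * (N + 1) ^ E * (2 ^ N * gain κ (n + 1) k) *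
        ∑ a : Fin (n + 1) → Ω, sepWeight N (fun i => (a i : ℕ)) Finset.univ := by
        rw [Finset.mul_sum]
        exact Finset.sum_congr rfl fun a _ => by ring
    _ ≤ C * (N + 1) ^ E * (2 ^ N * gain κ (n + 1) k) *
        (((1 + 3 * n) * (N + 1) * 2 ^ N) ^ n * Ω.card) :=
        mul_le_mul_of_nonneg_left (sum_sepWeight_le N hΩ n) (by positivity)
    _ = _ := by rw [mul_pow, mul_pow]; ring

/-- Interpolation between two even moments. -/
lemma sum_rpow_le_of_moments (s : Finset ℕ) (T : ℕ → ℝ) {d : ℕ} (hd : Even d) {t A B : ℝ}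
    (ht0 : 0 < t) (ht1 : t < 1) (hd0 : 0 < d)
    (hA : ∑ b ∈ s, T b ^ d ≤ A) (hB : ∑ b ∈ s, T b ^ (d + 2) ≤ B) :
    ∑ b ∈ s, |T b| ^ (d + 2 * t : ℝ) ≤ A ^ (1 - t) * B ^ t := by
  have hconj : (1 - t)⁻¹.HolderConjugate t⁻¹ := by
    rw [Real.holderConjugate_iff]
    refine ⟨(one_lt_inv₀ (by linarith)).2 (by linarith), ?_⟩
    rw [inv_inv, inv_inv]; ring
  have hd' : (0 : ℝ) < d := by exact_mod_cast hd0
  have hd2 : Even (d + 2) := by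
    obtain ⟨r, hr⟩ := hd
    exact ⟨r + 1, by omega⟩
  have key := Real.inner_le_Lp_mul_Lq_of_nonneg s hconj
    (f := fun b => (|T b| ^ d) ^ (1 - t)) (g := fun b => (|T b| ^ (d + 2)) ^ t)
    (fun _ _ => by positivity) (fun _ _ => by positivity)
  have e1 : ∀ b, (|T b| ^ d) ^ (1 - t) * (|T b| ^ (d + 2)) ^ t = |T b| ^ (d + 2 * t : ℝ) := by
    intro b
    rw [← Real.rpow_natCast, ← Real.rpow_natCast, ← Real.rpow_mul (abs_nonneg _),
      ← Real.rpow_mul (abs_nonneg _)]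
    rcases eq_or_lt_of_le (abs_nonneg (T b)) with hz | hz
    · rw [← hz, Real.zero_rpow, Real.zero_rpow, Real.zero_rpow, zero_mul]
      · positivity
      · push_cast; positivity
      · have : 0 < 1 - t := by linarith
        positivity
    · rw [← Real.rpow_add hz]
      congr 1
      push_cast
      ring
  have e2 : ∀ b, ((|T b| ^ d) ^ (1 - t)) ^ (1 - t)⁻¹ = T b ^ d := by
    intro b
    rw [← Real.rpow_mul (by positivity), mul_inv_cancel₀ (by linarith), Real.rpow_one,
      hd.pow_abs]
  have e3 : ∀ b, ((|T b| ^ (d + 2)) ^ t) ^ t⁻¹ = T b ^ (d + 2) := by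
    intro b
    rw [← Real.rpow_mul (by positivity), mul_inv_cancel₀ (by linarith), Real.rpow_one,
      hd2.pow_abs]
  simp only [e1, e2, e3, one_div, inv_inv] at key
  refine key.trans ?_
  have p1 : 0 ≤ ∑ b ∈ s, T b ^ d := Finset.sum_nonneg fun b _ => hd.pow_nonneg _
  have p2 : 0 ≤ ∑ b ∈ s, T b ^ (d + 2) := Finset.sum_nonneg fun b _ => hd2.pow_nonneg _
  exact mul_le_mul (Real.rpow_le_rpow p1 hA (by linarith)) (Real.rpow_le_rpow p2 hB ht0.le)
    (by positivity) (Real.rpow_nonneg (p1.trans hA) _)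

lemma gain_of_lt {κ : ℝ} {n k : ℕ} (h : (n : ℝ) * κ ≤ 1) :
    gain κ n k = 2 ^ (-(k * ((1 - n * κ) / 2)) : ℝ) := by
  unfold gain
  have h2 : (2 : ℝ) ^ ((k : ℝ) * (n * κ - 1)) ≤ 1 :=
    Real.rpow_le_one_of_one_le_of_nonpos (by norm_num)
      (mul_nonpos_of_nonneg_of_nonpos (Nat.cast_nonneg _) (by linarith))
  rw [max_eq_left h2, mul_one, Real.sqrt_eq_rpow, ← Real.rpow_mul (by norm_num)]
  congr 1
  ring

lemma gain_of_le {κ : ℝ} {n k : ℕ} (h : 1 ≤ (n : ℝ) * κ) :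
    gain κ n k = 2 ^ (k * (n * κ - 1) : ℝ) := by
  unfold gain
  have h2 : (1 : ℝ) ≤ 2 ^ ((k : ℝ) * (n * κ - 1)) :=
    Real.one_le_rpow (by norm_num) (mul_nonneg (Nat.cast_nonneg _) (by linarith))
  rw [max_eq_right h2, Real.sqrt_mul_self (by positivity)]

/-- The `ℓ ^ (d + 2 t)` norms of superpositions decay exponentially in the level. -/
lemma sum_superposition_rpow_le {κ : ℝ} (h0 : 0 ≤ κ) (h1 : κ ≤ 1) {d : ℕ} (hd : Even d)
    (hd0 : 0 < d) (hdκ : (d : ℝ) * κ ≤ 1) (hdκ2 : 1 ≤ ((d : ℝ) + 2) * κ) {t : ℝ} (ht0 : 0 < t)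
    (ht1 : t < 1) :
    ∃ (C : ℝ) (E : ℕ), 0 ≤ C ∧ ∀ m ε, IsCascade κ m ε → ∀ (N k : ℕ), k ≤ N →
      ∀ Ω ⊆ Finset.range (2 ^ N), ∀ (η : ℕ → ℝ) (c : ℕ → ℕ), (∀ a, |η a| ≤ 1) →
      (∀ a, 2 ^ N ≤ c a) → (∀ a, c a ≤ 2 ^ (N + 1)) →
      ∑ b ∈ Finset.range (2 ^ (N + 3)), |superposition m k Ω η c b| ^ (d + 2 * t : ℝ) ≤
        C * (N + 1) ^ E * (((2 : ℝ) ^ N) ^ (d + 2 * t : ℝ) *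
          2 ^ (-(k * ((1 - d * κ) / 2 * (1 - t) - (((d : ℝ) + 2) * κ - 1) * t)) : ℝ) *
            Ω.card) := by
  obtain ⟨d', rfl⟩ : ∃ d', d = d' + 1 := ⟨d - 1, by omega⟩
  obtain ⟨C₁, E₁, hC₁, hA⟩ := sum_superposition_pow_le h0 h1 d'
  obtain ⟨C₂, E₂, hC₂, hB⟩ := sum_superposition_pow_le h0 h1 (d' + 2)
  refine ⟨C₁ + C₂, E₁ + E₂, by positivity, ?_⟩
  intro m ε h N k hkN Ω hΩ η c hη hc hcu
  have hA := hA m ε h N k hkN Ω hΩ η c hη hc hcu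
  have hB := hB m ε h N k hkN Ω hΩ η c hη hc hcu
  have hN1 : (1 : ℝ) ≤ N + 1 := by
    have : (0 : ℝ) ≤ N := Nat.cast_nonneg _
    linarith
  set D : ℝ := (C₁ + C₂) * (N + 1) ^ (E₁ + E₂)
  have hD : 0 ≤ D := by positivity
  have hD1 : C₁ * ((N : ℝ) + 1) ^ E₁ ≤ D :=
    mul_le_mul (by linarith) (pow_le_pow_right₀ hN1 (by omega)) (by positivity) (by positivity)
  have hD2 : C₂ * ((N : ℝ) + 1) ^ E₂ ≤ D :=
    mul_le_mul (by linarith) (pow_le_pow_right₀ hN1 (by omega)) (by positivity) (by positivity)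
  clear_value D
  rw [show d' + 2 + 1 = d' + 1 + 2 by ring] at hB
  have hG0 : ∀ n, 0 ≤ gain κ n k := fun n => Real.sqrt_nonneg _
  have key := sum_rpow_le_of_moments _ _ hd ht0 ht1 hd0
    (hA.trans (mul_le_mul_of_nonneg_right hD1
      (mul_nonneg (mul_nonneg (by positivity) (hG0 _)) (Nat.cast_nonneg _))))
    (hB.trans (mul_le_mul_of_nonneg_right hD2
      (mul_nonneg (mul_nonneg (by positivity) (hG0 _)) (Nat.cast_nonneg _))))
  refine key.trans (le_of_eq ?_)
  rw [gain_of_lt hdκ, gain_of_le (by push_cast at hdκ2 ⊢; linarith)]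
  have hsplit : ∀ x : ℝ, 0 ≤ x → x ^ (1 - t) * x ^ t = x := by
    intro x hx
    rw [← Real.rpow_add' hx (by norm_num), sub_add_cancel, Real.rpow_one]
  have hc0 : (0 : ℝ) ≤ Ω.card := Nat.cast_nonneg _
  have e3 : (((2 : ℝ) ^ N) ^ (d' + 1)) ^ (1 - t) * (((2 : ℝ) ^ N) ^ (d' + 1 + 2)) ^ t =
      ((2 : ℝ) ^ N) ^ (((d' + 1 : ℕ) : ℝ) + 2 * t) := by
    rw [← Real.rpow_natCast _ (d' + 1), ← Real.rpow_natCast _ (d' + 1 + 2),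
      ← Real.rpow_mul (by positivity), ← Real.rpow_mul (by positivity),
      ← Real.rpow_add (by positivity)]
    congr 1
    push_cast
    ring
  have e4 : ((2 : ℝ) ^ (-(k * ((1 - ((d' + 1 : ℕ) : ℝ) * κ) / 2)) : ℝ)) ^ (1 - t) *
      ((2 : ℝ) ^ (k * (((d' + 1 + 2 : ℕ) : ℝ) * κ - 1) : ℝ)) ^ t =
      2 ^ (-(k * ((1 - ((d' + 1 : ℕ) : ℝ) * κ) / 2 * (1 - t) -
        (((d' + 1 : ℕ) : ℝ) + 2) * κ * t + t)) : ℝ) := by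
    rw [← Real.rpow_mul (by norm_num), ← Real.rpow_mul (by norm_num),
      ← Real.rpow_add (by norm_num)]
    congr 1
    push_cast
    ring
  rw [Real.mul_rpow hD (by positivity), Real.mul_rpow (by positivity) hc0,
    Real.mul_rpow (by positivity) (by positivity), Real.mul_rpow hD (by positivity),
    Real.mul_rpow (by positivity) hc0, Real.mul_rpow (by positivity) (by positivity)]
  have e5 : (-(k * ((1 - ((d' + 1 : ℕ) : ℝ) * κ) / 2 * (1 - t) -
      ((((d' + 1 : ℕ) : ℝ) + 2) * κ - 1) * t)) : ℝ) =
      -(k * ((1 - ((d' + 1 : ℕ) : ℝ) * κ) / 2 * (1 - t) -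
        (((d' + 1 : ℕ) : ℝ) + 2) * κ * t + t)) := by ring
  rw [e5, ← e3, ← e4]
  have e1 := hsplit D hD
  have e2 := hsplit _ hc0
  conv_rhs => rw [← e1, ← e2]
  ring

/-- Points within distance `δ` of the places where a step function on `[1, 2)` with steps of
length `2 ^ -J`, dilated by `r` and translated to `x`, may jump. -/
def jumpSet (J : ℕ) (δ x r : ℝ) : Set ℝ :=
  {z | ∃ l : ℕ, 2 ^ J ≤ l ∧ l ≤ 2 ^ (J + 1) ∧ |z - (x + r * l / 2 ^ J)| ≤ δ}

lemma jumpSet_eq (J : ℕ) (δ x r : ℝ) :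
    jumpSet J δ x r = ⋃ l ∈ Finset.Icc (2 ^ J) (2 ^ (J + 1)),
      Icc (x + r * (l : ℕ) / 2 ^ J - δ) (x + r * (l : ℕ) / 2 ^ J + δ) := by
  ext z
  simp only [jumpSet, mem_ofPred_eq, mem_iUnion, Finset.mem_Icc, mem_Icc, exists_prop, abs_le,
    and_assoc]
  refine exists_congr fun l => and_congr_right fun _ => and_congr_right fun _ => ?_
  constructor <;> rintro ⟨h1, h2⟩ <;> constructor <;> linarith

lemma measurableSet_jumpSet (J : ℕ) (δ x r : ℝ) : MeasurableSet (jumpSet J δ x r) := by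
  rw [jumpSet_eq]
  exact Finset.measurableSet_biUnion _ fun _ _ => measurableSet_Icc

lemma volume_jumpSet_le (J : ℕ) {δ : ℝ} (hδ : 0 ≤ δ) (x r : ℝ) :
    volume (jumpSet J δ x r) ≤ ENNReal.ofReal (2 ^ (J + 2) * δ) := by
  rw [jumpSet_eq]
  refine (measure_biUnion_finset_le _ _).trans ?_
  have : ∀ l ∈ Finset.Icc (2 ^ J) (2 ^ (J + 1)),
      volume (Icc (x + r * (l : ℕ) / 2 ^ J - δ) (x + r * (l : ℕ) / 2 ^ J + δ)) =
        ENNReal.ofReal (2 * δ) := by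
    intro l _
    rw [Real.volume_Icc]
    congr 1
    ring
  rw [Finset.sum_congr rfl this, Finset.sum_const, ← ENNReal.ofReal_nsmul, Nat.card_Icc,
    nsmul_eq_mul]
  refine ENNReal.ofReal_le_ofReal ?_
  have h1 : 2 ^ (J + 1) + 1 - 2 ^ J ≤ 2 ^ (J + 1) := by
    have := Nat.one_le_two_pow (n := J)
    omega
  have h2 : ((2 ^ (J + 1) + 1 - 2 ^ J : ℕ) : ℝ) ≤ 2 ^ (J + 1) := by exact_mod_cast h1
  calc _ ≤ (2 : ℝ) ^ (J + 1) * (2 * δ) := mul_le_mul_of_nonneg_right h2 (by linarith)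
    _ = _ := by ring

section step

variable {g : ℕ → ℝ} {J : ℕ}

lemma step_eq_of_forall_le_iff (hg : ∀ q, g q ≠ 0 → 2 ^ J ≤ q ∧ q < 2 ^ (J + 1)) {q q' : ℕ}
    (h : ∀ l, 2 ^ J ≤ l → l ≤ 2 ^ (J + 1) → (l ≤ q ↔ l ≤ q')) : g q = g q' := by
  by_cases hq : g q = 0
  · by_cases hq' : g q' = 0
    · rw [hq, hq']
    · obtain ⟨h1, h2⟩ := hg _ hq'
      have h3 := (h q' h1 h2.le).2 le_rfl
      have h4 := h (q' + 1) (by omega) (by omega)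
      have : q = q' := by omega
      rw [this]
  · obtain ⟨h1, h2⟩ := hg _ hq
    have h3 := (h q h1 h2.le).1 le_rfl
    have h4 := h (q + 1) (by omega) (by omega)
    have : q = q' := by omega
    rw [this]

lemma le_floor_rescale_iff {x z r : ℝ} (hr : 0 < r) {l : ℕ} (hl : 1 ≤ l) :
    l ≤ ⌊2 ^ J * (z - x) / r⌋₊ ↔ x + r * l / 2 ^ J ≤ z := by
  rw [Nat.le_floor_iff' (by omega), le_div_iff₀ hr, ← sub_nonneg, ← sub_nonneg (b := x + _)]
  have h2 : (0 : ℝ) < 2 ^ J := by positivity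
  have : (2 : ℝ) ^ J * (z - x) - l * r = 2 ^ J * (z - (x + r * l / 2 ^ J)) := by
    field_simp
    ring
  rw [this, mul_nonneg_iff_of_pos_left h2]

lemma le_cellIdx_iff {a b c : ℕ} (hc : 0 < c) {l : ℕ} (hl : 1 ≤ l) :
    l ≤ cellIdx J a c b ↔ (a : ℝ) + c * l / 2 ^ J ≤ b := by
  have h2 : (0 : ℝ) < 2 ^ J := by positivity
  have hc' : (0 : ℝ) < c := by exact_mod_cast hc
  have hl' : (0 : ℝ) < l := by exact_mod_cast hl
  unfold cellIdx
  rw [Nat.le_div_iff_mul_le hc]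
  rcases le_or_gt a b with hab | hab
  · have : (l * c ≤ 2 ^ J * (b - a) : Prop) ↔ ((l : ℝ) * c ≤ 2 ^ J * (b - a)) := by
      rw [← Nat.cast_sub hab]
      exact_mod_cast Iff.rfl
    rw [this, ← sub_nonneg, ← sub_nonneg (b := (a : ℝ) + _)]
    have : (2 : ℝ) ^ J * (b - a) - l * c = 2 ^ J * (b - (a + c * l / 2 ^ J)) := by
      field_simp
      ring
    rw [this, mul_nonneg_iff_of_pos_left h2]
  · have hab' : (b : ℝ) < a := by exact_mod_cast hab
    have h3 : 0 < l * c := by positivity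
    have h4 : 0 < (c : ℝ) * l / 2 ^ J := by positivity
    rw [Nat.sub_eq_zero_of_le hab.le, mul_zero]
    constructor
    · intro h; omega
    · intro h; linarith

lemma step_eq_of_abs_sub_le (hg : ∀ q, g q ≠ 0 → 2 ^ J ≤ q ∧ q < 2 ^ (J + 1)) {x z z' r δ : ℝ}
    (hr : 0 < r) (hz : z ∉ jumpSet J δ x r) (h : |z - z'| ≤ δ) :
    g ⌊2 ^ J * (z - x) / r⌋₊ = g ⌊2 ^ J * (z' - x) / r⌋₊ := by
  refine step_eq_of_forall_le_iff hg fun l h1 h2 => ?_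
  have hl : 1 ≤ l := Nat.one_le_two_pow.trans h1
  rw [le_floor_rescale_iff hr hl, le_floor_rescale_iff hr hl]
  have hz2 : δ < |z - (x + r * l / 2 ^ J)| := by
    by_contra hcon
    exact hz ⟨l, h1, h2, not_lt.1 hcon⟩
  obtain ⟨h3, h4⟩ := abs_le.1 h
  rcases lt_abs.1 hz2 with h5 | h5 <;> constructor <;> intro h6 <;> linarith

lemma step_eq_cellIdx (hg : ∀ q, g q ≠ 0 → 2 ^ J ≤ q ∧ q < 2 ^ (J + 1)) {x z r : ℝ}
    {a b c N : ℕ} (hr : 0 < r) (hc : 0 < c) (hz : z ∉ jumpSet J (4 / 2 ^ N) x r)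
    (ha : (a : ℝ) ≤ 2 ^ N * x) (ha' : 2 ^ N * x < a + 1)
    (hc1 : (c : ℝ) ≤ 2 ^ N * r) (hc2 : 2 ^ N * r < c + 1)
    (hb : (b : ℝ) ≤ 2 ^ N * z) (hb' : 2 ^ N * z < b + 1) :
    g ⌊2 ^ J * (z - x) / r⌋₊ = g (cellIdx J a c b) := by
  refine step_eq_of_forall_le_iff hg fun l h1 h2 => ?_
  have hl : 1 ≤ l := Nat.one_le_two_pow.trans h1
  rw [le_floor_rescale_iff hr hl, le_cellIdx_iff hc hl]
  have hz2 : 4 / 2 ^ N < |z - (x + r * l / 2 ^ J)| := by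
    by_contra hcon
    exact hz ⟨l, h1, h2, not_lt.1 hcon⟩
  have hN : (0 : ℝ) < 2 ^ N := by positivity
  have hJ : (0 : ℝ) < 2 ^ J := by positivity
  set L : ℝ := l / 2 ^ J
  have hL0 : 0 ≤ L := by positivity
  have hL2 : L ≤ 2 := by
    rw [div_le_iff₀ hJ, ← pow_succ']
    exact_mod_cast h2
  rw [mul_div_assoc] at hz2 ⊢
  rw [mul_div_assoc]
  have e1 : 2 ^ N * (4 / 2 ^ N : ℝ) = 4 := by field_simp
  have p1 : (c : ℝ) * L ≤ 2 ^ N * r * L := mul_le_mul_of_nonneg_right hc1 hL0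
  have p2 : 2 ^ N * r * L ≤ (c + 1) * L := mul_le_mul_of_nonneg_right hc2.le hL0
  rcases lt_abs.1 hz2 with h5 | h5
  · have h6 := mul_lt_mul_of_pos_left h5 hN
    rw [e1] at h6
    have h7 : 2 ^ N * (z - (x + r * L)) = 2 ^ N * z - 2 ^ N * x - 2 ^ N * r * L := by ring
    have h8 : 0 < z - (x + r * L) := lt_trans (by positivity) h5
    constructor <;> intro _ <;> linarith
  · have h6 := mul_lt_mul_of_pos_left h5 hN
    rw [e1] at h6
    have h7 : 2 ^ N * -(z - (x + r * L)) = -(2 ^ N * z - 2 ^ N * x - 2 ^ N * r * L) := by ring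
    have h8 : 0 < -(z - (x + r * L)) := lt_trans (by positivity) h5
    constructor <;> intro _ <;> linarith

lemma measurable_step (g : ℕ → ℝ) (J : ℕ) (x r : ℝ) :
    Measurable fun z : ℝ => g ⌊2 ^ J * (z - x) / r⌋₊ :=
  (measurable_of_countable g).comp (Nat.measurable_floor.comp (by fun_prop))

end step

lemma abs_integral_mul_le_of_integral_le {μ : Measure ℝ} {p q : ℝ} (hpq : p.HolderConjugate q)
    {h w : ℝ → ℝ} (hh : MemLp h (ENNReal.ofReal p) μ) (hw : MemLp w (ENNReal.ofReal q) μ)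
    {W : ℝ} (hW : ∫ z, |w z| ^ q ∂μ ≤ W) :
    |∫ z, h z * w z ∂μ| ≤ (∫ z, |h z| ^ p ∂μ) ^ (1 / p) * W ^ (1 / q) := by
  have h1 := integral_mul_norm_le_Lp_mul_Lq hpq hh hw
  have h2 : |∫ z, h z * w z ∂μ| ≤ ∫ z, ‖h z‖ * ‖w z‖ ∂μ := by
    simp only [← norm_mul]
    exact norm_integral_le_integral_norm (fun z => h z * w z)
  refine h2.trans (h1.trans ?_)
  simp only [Real.norm_eq_abs]
  have hq := hpq.symm.pos
  have h3 : 0 ≤ ∫ z, |w z| ^ q ∂μ := integral_nonneg fun z => by positivity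
  exact mul_le_mul_of_nonneg_left (Real.rpow_le_rpow h3 hW (by positivity))
    (Real.rpow_nonneg (integral_nonneg fun z => by positivity) _)

lemma abs_integral_mul_le_of_support {μ : Measure ℝ} [IsFiniteMeasure μ] {p q : ℝ}
    (hpq : p.HolderConjugate q)
    {h w : ℝ → ℝ} (hh : MemLp h (ENNReal.ofReal p) μ) (hw : Measurable w)
    {B V : ℝ} (hB : ∀ z, |w z| ≤ B) {S : Set ℝ} (hSm : MeasurableSet S) (hS : ∀ z ∉ S, w z = 0)
    (hV : 0 ≤ V) (hSV : μ S ≤ ENNReal.ofReal V) :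
    |∫ z, h z * w z ∂μ| ≤ (∫ z, |h z| ^ p ∂μ) ^ (1 / p) * (B * V ^ (1 / q)) := by
  have hq := hpq.symm.pos
  have hB0 : 0 ≤ B := (abs_nonneg _).trans (hB 0)
  have hwL : MemLp w (ENNReal.ofReal q) μ :=
    MemLp.of_bound hw.aestronglyMeasurable B (Filter.Eventually.of_forall hB)
  have h1 : ∫ z, |w z| ^ q ∂μ ≤ B ^ q * V := by
    calc ∫ z, |w z| ^ q ∂μ ≤ ∫ z, S.indicator (fun _ => B ^ q) z ∂μ := by
          refine integral_mono_of_nonneg (Filter.Eventually.of_forall fun z => by positivity)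
            ((integrable_const _).indicator hSm) (Filter.Eventually.of_forall fun z => ?_)
          by_cases hz : z ∈ S
          · simp only [indicator_of_mem hz]
            exact Real.rpow_le_rpow (abs_nonneg _) (hB z) hq.le
          · simp only [indicator_of_notMem hz, hS z hz, abs_zero, Real.zero_rpow hq.ne']
            exact le_rfl
      _ = μ.real S * B ^ q := by
          rw [integral_indicator_const _ hSm, smul_eq_mul]
      _ ≤ V * B ^ q := by
          refine mul_le_mul_of_nonneg_right ?_ (by positivity)
          exact ENNReal.toReal_le_of_le_ofReal hV hSV
      _ = _ := mul_comm _ _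
  have h2 := abs_integral_mul_le_of_integral_le hpq hh hwL h1
  rw [Real.mul_rpow (by positivity) hV, ← Real.rpow_mul hB0, mul_one_div_cancel hq.ne',
    Real.rpow_one] at h2
  exact h2

lemma integral_Ico_mul_step (N : ℕ) {h : ℝ → ℝ} (hh : IntegrableOn h (Ico 0 8)) (G : ℕ → ℝ) :
    ∫ z in Ico (0 : ℝ) 8, h z * G ⌊2 ^ N * z⌋₊ = ∑ b ∈ Finset.range (2 ^ (N + 3)),
      (∫ z in Ico ((b : ℕ) / 2 ^ N : ℝ) (((b : ℕ) + 1) / 2 ^ N), h z) * G b := by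
  have hN : (0 : ℝ) < 2 ^ N := by positivity
  have hmem : ∀ b : ℕ, ∀ z ∈ Ico ((b : ℝ) / 2 ^ N) ((b + 1) / 2 ^ N), ⌊2 ^ N * z⌋₊ = b := by
    intro b z hz
    have hz0 : 0 ≤ z := le_trans (by positivity) hz.1
    rw [Nat.floor_eq_iff (by positivity)]
    have h1 := (div_le_iff₀ hN).1 hz.1
    have h2 := (lt_div_iff₀ hN).1 hz.2
    exact ⟨by linarith, by linarith⟩
  have hunion : Ico (0 : ℝ) 8 = ⋃ b ∈ Finset.range (2 ^ (N + 3)),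
      Ico ((b : ℕ) / 2 ^ N : ℝ) (((b : ℕ) + 1) / 2 ^ N) := by
    ext z
    simp only [mem_iUnion, Finset.mem_range, exists_prop]
    constructor
    · intro hz
      have hz0 : 0 ≤ 2 ^ N * z := mul_nonneg hN.le hz.1
      refine ⟨⌊2 ^ N * z⌋₊, ?_, ?_, ?_⟩
      · rw [Nat.floor_lt hz0]
        push_cast
        rw [pow_add]
        have := mul_lt_mul_of_pos_left hz.2 hN
        linarith
      · rw [div_le_iff₀ hN]
        have := Nat.floor_le hz0
        linarith
      · rw [lt_div_iff₀ hN]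
        have := Nat.lt_floor_add_one (2 ^ N * z)
        linarith
    · rintro ⟨b, hb, hz1, hz2⟩
      refine ⟨le_trans (by positivity) hz1, hz2.trans_le ?_⟩
      rw [div_le_iff₀ hN]
      have : ((b + 1 : ℕ) : ℝ) ≤ (2 ^ (N + 3) : ℕ) := by exact_mod_cast hb
      push_cast at this
      rw [pow_add] at this
      linarith
  have hcell : ∀ b ∈ Finset.range (2 ^ (N + 3)), IntegrableOn h
      (Ico ((b : ℕ) / 2 ^ N : ℝ) (((b : ℕ) + 1) / 2 ^ N)) := by
    intro b hb
    refine hh.mono_set ?_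
    rw [hunion]
    exact subset_biUnion_of_mem (u := fun b : ℕ => Ico (b / 2 ^ N : ℝ) ((b + 1) / 2 ^ N)) hb
  rw [hunion, integral_biUnion_finset]
  · refine Finset.sum_congr rfl fun b _ => ?_
    rw [← integral_mul_const]
    exact setIntegral_congr_fun measurableSet_Ico (fun z hz => by simp only [hmem b z hz])
  · exact fun b _ => measurableSet_Ico
  · intro b _ b' _ hbb'
    rw [Function.onFun, Set.disjoint_left]
    intro z h1 h2
    exact hbb' ((hmem b z h1).symm.trans (hmem b' z h2))
  · intro b hb
    refine IntegrableOn.congr_fun (f := fun z => h z * G b) ?_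
      (fun z hz => by simp only [hmem b z hz]) measurableSet_Ico
    exact (hcell b hb).mul_const _

lemma integral_Ico_step (N : ℕ) (G : ℕ → ℝ) :
    ∫ z in Ico (0 : ℝ) 8, G ⌊2 ^ N * z⌋₊ = (∑ b ∈ Finset.range (2 ^ (N + 3)), G b) / 2 ^ N := by
  have h1 := integral_Ico_mul_step N (h := fun _ => 1) (integrableOn_const (by simp)) G
  simp only [one_mul] at h1
  rw [h1, Finset.sum_div]
  refine Finset.sum_congr rfl fun b _ => ?_
  rw [setIntegral_const, Real.volume_real_Ico, smul_eq_mul, max_eq_left]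
  · ring
  · rw [sub_nonneg]
    gcongr
    linarith

lemma le_rpow_of_mul_le {p q : ℝ} (hpq : p.HolderConjugate q) {M lam K : ℝ} (hM : 0 ≤ M)
    (hlam : 0 < lam) (hK : 0 ≤ K) (h : M * lam ≤ K * M ^ (1 / q)) : M ≤ (K / lam) ^ p := by
  rcases eq_or_lt_of_le hM with h0 | h0
  · rw [← h0]; positivity
  have hp := hpq.pos
  have h1 : M ^ (1 / p) * M ^ (1 / q) = M := by
    rw [← Real.rpow_add h0, one_div, one_div, hpq.inv_add_inv_eq_one, Real.rpow_one]
  have h2 : 0 < M ^ (1 / q) := by positivity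
  have h3 : M ^ (1 / p) ≤ K / lam := by
    rw [le_div_iff₀ hlam]
    refine le_of_mul_le_mul_right ?_ h2
    calc M ^ (1 / p) * lam * M ^ (1 / q) = M * lam := by rw [mul_right_comm, h1]
      _ ≤ _ := h
  calc M = (M ^ (1 / p)) ^ p := by
        rw [← Real.rpow_mul hM, one_div_mul_cancel hp.ne', Real.rpow_one]
    _ ≤ _ := Real.rpow_le_rpow (by positivity) h3 hp.le

/-- Integral of `h` against the step function with values `g`, with steps of length `2 ^ -J`,
dilated by `r` and translated to `x`. -/
noncomputable def stepIntegral (g : ℕ → ℝ) (J : ℕ) (h : ℝ → ℝ) (x r : ℝ) : ℝ :=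
  ∫ z in Ico (0 : ℝ) 8, h z * g ⌊2 ^ J * (z - x) / r⌋₊

lemma IsCascade.mem_of_increment_ne_zero {κ : ℝ} {m ε : ℕ → ℕ → ℝ} (h : IsCascade κ m ε)
    (h0 : 0 ≤ κ) (h1 : κ ≤ 1) {k q : ℕ} (hq : increment m k q ≠ 0) :
    2 ^ (k + 1) ≤ q ∧ q < 2 ^ (k + 1 + 1) := by
  have h2 : m k (q / 2) ≠ 0 := by
    intro h3
    have := h.abs_increment_le h0 h1 k q
    rw [h3] at this
    exact hq (abs_nonpos_iff.1 this)
  have := h.mem_of_ne_zero h2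
  rw [pow_succ] at *
  rw [pow_succ, pow_succ]
  omega

lemma IsCascade.abs_increment_le_two_pow {κ : ℝ} {m ε : ℕ → ℕ → ℝ} (h : IsCascade κ m ε)
    (h0 : 0 ≤ κ) (h1 : κ ≤ 1) (k q : ℕ) : |increment m k q| ≤ 2 ^ k := by
  refine (h.abs_increment_le h0 h1 k q).trans ((h.le_rpow h0 h1 k _).trans ?_)
  rw [← Real.rpow_natCast]
  refine Real.rpow_le_rpow_of_exponent_le (by norm_num) ?_
  exact mul_le_of_le_one_left (Nat.cast_nonneg _) h1

lemma volume_stepIntegral_increment_le_of_large {κ : ℝ} (h0 : 0 ≤ κ) (h1 : κ ≤ 1) {p q : ℝ}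
    (hpq : p.HolderConjugate q) {m ε : ℕ → ℕ → ℝ} (hm : IsCascade κ m ε) {N k : ℕ} {D : ℝ}
    (hD : 0 ≤ D)
    (hW : ∀ Ω ⊆ Finset.range (2 ^ N), ∀ (η : ℕ → ℝ) (c : ℕ → ℕ), (∀ a, |η a| ≤ 1) →
      (∀ a, 2 ^ N ≤ c a) → (∀ a, c a ≤ 2 ^ (N + 1)) →
      ∑ b ∈ Finset.range (2 ^ (N + 3)), |superposition m k Ω η c b| ^ q ≤
        ((2 : ℝ) ^ N) ^ q * D * Ω.card)
    {h : ℝ → ℝ} (hh : MemLp h (ENNReal.ofReal p) (volume.restrict (Ico 0 8)))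
    {lam : ℝ} (hlam : 0 < lam)
    (hlarge : 2 * ((∫ z in Ico 0 8, |h z| ^ p) ^ (1 / p) *
      (2 ^ (k + 1) * (2 ^ (k + 5) / 2 ^ N) ^ (1 / q))) ≤ lam) :
    volume {x ∈ Ico (0 : ℝ) 1 | ∃ r ∈ Icc (1 : ℝ) 2,
      lam < |stepIntegral (increment m k) (k + 1) h x r|} ≤
      ENNReal.ofReal ((2 * (∫ z in Ico 0 8, |h z| ^ p) ^ (1 / p) * D ^ (1 / q) / lam) ^ p) := by
  classical
  set E : Set ℝ := {x ∈ Ico (0 : ℝ) 1 | ∃ r ∈ Icc (1 : ℝ) 2,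
      lam < |stepIntegral (increment m k) (k + 1) h x r|} with hE
  set H : ℝ := (∫ z in Ico 0 8, |h z| ^ p) ^ (1 / p) with hH
  have hH0 : 0 ≤ H := Real.rpow_nonneg (integral_nonneg fun z => by positivity) _
  have hp := hpq.pos
  have hq := hpq.symm.pos
  have hN : (0 : ℝ) < 2 ^ N := by positivity
  let Ω : Finset ℕ := {a ∈ Finset.range (2 ^ N) |
    ∃ x ∈ E, (a : ℝ) ≤ 2 ^ N * x ∧ 2 ^ N * x < a + 1}
  have hex : ∀ a : ℕ, ∃ x r : ℝ, r ∈ Icc (1 : ℝ) 2 ∧ (a ∈ Ω → ((a : ℝ) ≤ 2 ^ N * x ∧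
      2 ^ N * x < a + 1 ∧ lam < |stepIntegral (increment m k) (k + 1) h x r|)) := by
    intro a
    by_cases ha : a ∈ Ω
    · obtain ⟨x, ⟨_, r, hr, hr2⟩, hx2⟩ := (Finset.mem_filter.1 ha).2
      exact ⟨x, r, hr, fun _ => ⟨hx2.1, hx2.2, hr2⟩⟩
    · exact ⟨0, 1, ⟨le_rfl, by norm_num⟩, fun h => absurd h ha⟩
  choose X R hR hXR using hex
  have hEcover : E ⊆ ⋃ a ∈ Ω, Ico ((a : ℕ) / 2 ^ N : ℝ) (((a : ℕ) + 1) / 2 ^ N) := by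
    intro x hx
    have hx0 : 0 ≤ 2 ^ N * x := mul_nonneg hN.le hx.1.1
    have f1 := Nat.floor_le hx0
    have f2 := Nat.lt_floor_add_one (2 ^ N * x)
    simp only [mem_iUnion, exists_prop]
    refine ⟨⌊2 ^ N * x⌋₊, Finset.mem_filter.2 ⟨Finset.mem_range.2 ?_, x, hx, f1, f2⟩, ?_, ?_⟩
    · rw [Nat.floor_lt hx0]
      push_cast
      have := mul_lt_mul_of_pos_left hx.1.2 hN
      linarith
    · rw [div_le_iff₀ hN]; linarith
    · rw [lt_div_iff₀ hN]; linarith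
  have hEvol : volume E ≤ ENNReal.ofReal (Ω.card / 2 ^ N) := by
    refine (measure_mono hEcover).trans ((measure_biUnion_finset_le _ _).trans ?_)
    have : ∀ a ∈ Ω, volume (Ico ((a : ℕ) / 2 ^ N : ℝ) (((a : ℕ) + 1) / 2 ^ N)) =
        ENNReal.ofReal (1 / 2 ^ N) := by
      intro a _
      rw [Real.volume_Ico]
      congr 1
      ring
    rw [Finset.sum_congr rfl this, Finset.sum_const, ← ENNReal.ofReal_nsmul, nsmul_eq_mul,
      mul_one_div]
  let c : ℕ → ℕ := fun a => ⌊2 ^ N * R a⌋₊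
  have hR0 : ∀ a, 0 ≤ 2 ^ N * R a := fun a => mul_nonneg hN.le (zero_le_one.trans (hR a).1)
  have hc1 : ∀ a, 2 ^ N ≤ c a := by
    intro a
    refine Nat.le_floor ?_
    push_cast
    exact le_mul_of_one_le_right hN.le (hR a).1
  have hc2 : ∀ a, c a ≤ 2 ^ (N + 1) := by
    intro a
    refine Nat.floor_le_of_le ?_
    push_cast
    rw [pow_succ]
    exact mul_le_mul_of_nonneg_left (hR a).2 hN.le
  let I : ℕ → ℝ := fun a => stepIntegral (increment m k) (k + 1) h (X a) (R a)
  let η : ℕ → ℝ := fun a => if 0 ≤ I a then 1 else -1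
  have hη : ∀ a, |η a| ≤ 1 := by
    intro a
    simp only [η]
    split_ifs <;> simp
  have hηI : ∀ a, η a * I a = |I a| := by
    intro a
    simp only [η]
    split_ifs with h2
    · rw [abs_of_nonneg h2, one_mul]
    · rw [abs_of_neg (not_le.1 h2)]; ring
  let w : ℕ → ℝ → ℝ := fun a z => increment m k ⌊2 ^ (k + 1) * (z - X a) / R a⌋₊
  let w' : ℕ → ℝ → ℝ := fun a z => increment m k (cellIdx (k + 1) a (c a) ⌊2 ^ N * z⌋₊)
  have hwm : ∀ a, Measurable (w a) := fun a => measurable_step _ _ _ _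
  have hw'm : ∀ a, Measurable (w' a) := fun a =>
    (measurable_of_countable fun b => increment m k (cellIdx (k + 1) a (c a) b)).comp
      (Nat.measurable_floor.comp (by fun_prop))
  have hinc := hm.abs_increment_le_two_pow h0 h1 k
  have hLp : ∀ (f : ℝ → ℝ) (B : ℝ), Measurable f → (∀ z, |f z| ≤ B) →
      MemLp f (ENNReal.ofReal q) (volume.restrict (Ico (0 : ℝ) 8)) := fun f B hf hB =>
    MemLp.of_bound hf.aestronglyMeasurable B (Filter.Eventually.of_forall hB)
  have : ENNReal.HolderConjugate (ENNReal.ofReal p) (ENNReal.ofReal q) := hpq.ennrealOfReal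
  have hint : ∀ (f : ℝ → ℝ) (B : ℝ), Measurable f → (∀ z, |f z| ≤ B) →
      Integrable (fun z => h z * f z) (volume.restrict (Ico (0 : ℝ) 8)) := fun f B hf hB =>
    hh.integrable_mul (hLp f B hf hB)
  have hsum : ∀ a ∈ Ω, lam / 2 ≤ η a * ∫ z in Ico (0 : ℝ) 8, h z * w' a z := by
    intro a ha
    obtain ⟨x1, x2, x3⟩ := hXR a ha
    have herr : |∫ z in Ico (0 : ℝ) 8, h z * (w a z - w' a z)| ≤
        H * (2 ^ (k + 1) * (2 ^ (k + 5) / 2 ^ N) ^ (1 / q)) := by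
      refine abs_integral_mul_le_of_support hpq hh ((hwm a).sub (hw'm a)) ?_
        ((measurableSet_jumpSet (k + 1) (4 / 2 ^ N) (X a) (R a)).union
          (measurableSet_Iio (a := (0 : ℝ)))) ?_ (by positivity) ?_
      · intro z
        refine (abs_sub _ _).trans ?_
        rw [pow_succ, mul_two]
        exact add_le_add (hinc _) (hinc _)
      · intro z hz
        rw [mem_union, not_or] at hz
        have hz0 : 0 ≤ 2 ^ N * z := mul_nonneg hN.le (not_lt.1 hz.2)
        rw [Pi.sub_apply, sub_eq_zero]
        exact step_eq_cellIdx (fun q hq => hm.mem_of_increment_ne_zero h0 h1 hq)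
          (zero_lt_one.trans_le (hR a).1) ((Nat.two_pow_pos N).trans_le (hc1 a)) hz.1 x1 x2
          (Nat.floor_le (hR0 a)) (Nat.lt_floor_add_one _) (Nat.floor_le hz0)
          (Nat.lt_floor_add_one _)
      · refine (measure_union_le _ _).trans ?_
        have e1 : volume.restrict (Ico (0 : ℝ) 8) (Iio (0 : ℝ)) = 0 := by
          rw [Measure.restrict_apply measurableSet_Iio]
          convert measure_empty (μ := (volume : Measure ℝ))
          ext z
          simp only [mem_inter_iff, mem_Iio, mem_Ico, mem_empty_iff_false, iff_false]
          intro hz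
          linarith
        rw [e1, add_zero]
        refine (Measure.restrict_apply_le _ _).trans ?_
        refine (volume_jumpSet_le _ (by positivity) _ _).trans (le_of_eq ?_)
        congr 1
        ring
    have hsplit : ∫ z in Ico (0 : ℝ) 8, h z * (w a z - w' a z) =
        I a - ∫ z in Ico (0 : ℝ) 8, h z * w' a z := by
      simp only [mul_sub]
      exact integral_sub (hint _ _ (hwm a) fun z => hinc _) (hint _ _ (hw'm a) fun z => hinc _)
    have h3 : η a * ∫ z in Ico (0 : ℝ) 8, h z * w' a z =
        |I a| - η a * ∫ z in Ico (0 : ℝ) 8, h z * (w a z - w' a z) := by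
      rw [hsplit, ← hηI]; ring
    have h4 : η a * ∫ z in Ico (0 : ℝ) 8, h z * (w a z - w' a z) ≤ lam / 2 := by
      refine (le_abs_self _).trans ?_
      rw [abs_mul]
      refine (mul_le_of_le_one_left (abs_nonneg _) (hη a)).trans ?_
      linarith
    have h5 : lam < |I a| := x3
    rw [h3]
    linarith
  let S : ℕ → ℝ := superposition m k Ω η c
  have hSsum : ∑ a ∈ Ω, η a * ∫ z in Ico (0 : ℝ) 8, h z * w' a z =
      ∫ z in Ico (0 : ℝ) 8, h z * S ⌊2 ^ N * z⌋₊ := by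
    have : ∀ z, h z * S ⌊2 ^ N * z⌋₊ = ∑ a ∈ Ω, η a * (h z * w' a z) := by
      intro z
      simp only [S, superposition, Finset.mul_sum]
      exact Finset.sum_congr rfl fun a _ => by simp only [w']; ring
    simp only [this]
    rw [integral_finsetSum _ fun a _ => (hint _ _ (hw'm a) fun z => hinc _).const_mul (η a)]
    exact Finset.sum_congr rfl fun a _ => (integral_const_mul _ _).symm
  have hSm : Measurable fun z : ℝ => S ⌊2 ^ N * z⌋₊ :=
    (measurable_of_countable S).comp (Nat.measurable_floor.comp (by fun_prop))
  have hSb : ∀ b, |S b| ≤ Ω.card * 2 ^ k := by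
    intro b
    refine (Finset.abs_sum_le_sum_abs _ _).trans ?_
    rw [← nsmul_eq_mul]
    refine Finset.sum_le_card_nsmul _ _ _ fun a _ => ?_
    rw [abs_mul]
    exact (mul_le_of_le_one_left (abs_nonneg _) (hη a)).trans (hinc _)
  have hSq : ∫ z in Ico (0 : ℝ) 8, |S ⌊2 ^ N * z⌋₊| ^ q ≤
      ((2 : ℝ) ^ N) ^ q * D * (Ω.card / 2 ^ N) := by
    rw [integral_Ico_step N fun b => |S b| ^ q, ← mul_div_assoc]
    gcongr
    exact hW Ω (Finset.filter_subset _ _) η c hη hc1 hc2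
  have hmain := abs_integral_mul_le_of_integral_le hpq hh
    (hLp _ _ hSm fun z => hSb _) hSq
  have hlow : (Ω.card : ℝ) * (lam / 2) ≤ ∑ a ∈ Ω, η a * ∫ z in Ico (0 : ℝ) 8, h z * w' a z := by
    rw [← nsmul_eq_mul]
    exact Finset.card_nsmul_le_sum _ _ _ hsum
  set M : ℝ := Ω.card / 2 ^ N with hM
  have hM0 : 0 ≤ M := by positivity
  have hfin : M * lam ≤ (2 * H * D ^ (1 / q)) * M ^ (1 / q) := by
    rw [Real.mul_rpow (by positivity) hM0, Real.mul_rpow (by positivity) hD,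
      ← Real.rpow_mul hN.le, mul_one_div_cancel hq.ne', Real.rpow_one] at hmain
    rw [hSsum] at hlow
    have h6 := hlow.trans ((le_abs_self _).trans hmain)
    have h7 : (Ω.card : ℝ) = 2 ^ N * M := by rw [hM]; field_simp
    rw [h7] at h6
    refine le_of_mul_le_mul_left ?_ hN
    calc 2 ^ N * (M * lam) = 2 * (2 ^ N * M * (lam / 2)) := by ring
      _ ≤ 2 * (H * (2 ^ N * D ^ (1 / q) * M ^ (1 / q))) := by linarith
      _ = _ := by ring
  exact hEvol.trans (ENNReal.ofReal_le_ofReal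
    (le_rpow_of_mul_le hpq hM0 hlam (by positivity) hfin))

lemma exists_poly_le_rpow (M E : ℕ) {δ : ℝ} (hδ : 0 < δ) :
    ∃ C : ℝ, 0 ≤ C ∧ ∀ k : ℕ, ((M * k : ℕ) + 1 : ℝ) ^ E ≤ C * 2 ^ (δ * k) := by
  have hr0 : (0 : ℝ) < 2 ^ (-δ) := by positivity
  have hr : |(2 : ℝ) ^ (-δ)| < 1 := by
    rw [abs_of_pos hr0]
    exact Real.rpow_lt_one_of_one_lt_of_neg (by norm_num) (by linarith)
  obtain ⟨B, hB⟩ := (tendsto_pow_const_mul_const_pow_of_abs_lt_one E hr).bddAbove_range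
  have hB : ∀ k : ℕ, (k : ℝ) ^ E * ((2 : ℝ) ^ (-δ)) ^ k ≤ B := fun k => hB ⟨k, rfl⟩
  have hB0 : 0 ≤ B := le_trans (by positivity) (hB 0)
  refine ⟨(M + 1) ^ E * (B * 2 ^ δ), by positivity, fun k => ?_⟩
  have h1 := hB (k + 1)
  have h2 : ((2 : ℝ) ^ (-δ)) ^ (k + 1) * (2 ^ δ * 2 ^ (δ * k)) = 1 := by
    rw [← Real.rpow_natCast, ← Real.rpow_mul (by norm_num), ← Real.rpow_add (by norm_num),
      ← Real.rpow_add (by norm_num)]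
    convert Real.rpow_zero 2 using 2
    push_cast
    ring
  calc ((M * k : ℕ) + 1 : ℝ) ^ E ≤ ((M + 1) * (k + 1 : ℕ)) ^ E := by
        gcongr
        push_cast
        have : (0 : ℝ) ≤ M := Nat.cast_nonneg _
        have : (0 : ℝ) ≤ k := Nat.cast_nonneg _
        linarith
    _ = (M + 1) ^ E * ((((k + 1 : ℕ) : ℝ) ^ E * ((2 : ℝ) ^ (-δ)) ^ (k + 1)) *
        (2 ^ δ * 2 ^ (δ * k))) := by
        rw [mul_assoc _ (_ ^ (k + 1)), h2, mul_one, mul_pow]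
    _ ≤ (M + 1) ^ E * (B * (2 ^ δ * 2 ^ (δ * k))) := by gcongr
    _ = _ := by ring

lemma volume_le_of_subset_Ico {E : Set ℝ} (hE : E ⊆ Ico 0 1) {X p : ℝ} (hp : 0 ≤ p)
    (hX : 1 ≤ X) : volume E ≤ ENNReal.ofReal (X ^ p) := by
  refine (measure_mono hE).trans ?_
  rw [Real.volume_Ico]
  exact ENNReal.ofReal_le_ofReal (by rw [sub_zero]; exact Real.one_le_rpow hX hp)

/-- Weak type inequality with exponential decay for the maximal operator with dilations in
`[1, 2]` associated with a single increment of the cascade. -/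
lemma volume_stepIntegral_increment_le {κ : ℝ} (h0 : 0 ≤ κ) (h1 : κ ≤ 1) {d : ℕ} (hd : Even d)
    (hd0 : 0 < d) (hdκ : (d : ℝ) * κ ≤ 1) (hdκ2 : 1 ≤ ((d : ℝ) + 2) * κ) {t : ℝ} (ht0 : 0 < t)
    (ht1 : t < 1) (hδ : 0 < (1 - d * κ) / 2 * (1 - t) - (((d : ℝ) + 2) * κ - 1) * t)
    {p : ℝ} (hpq : p.HolderConjugate (d + 2 * t)) :
    ∃ C c : ℝ, 0 < C ∧ 0 < c ∧ ∀ m ε, IsCascade κ m ε → ∀ (k : ℕ) (h : ℝ → ℝ),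
      MemLp h (ENNReal.ofReal p) (volume.restrict (Ico 0 8)) → ∀ lam : ℝ, 0 < lam →
      volume {x ∈ Ico (0 : ℝ) 1 | ∃ r ∈ Icc (1 : ℝ) 2,
        lam < |stepIntegral (increment m k) (k + 1) h x r|} ≤
      ENNReal.ofReal
        ((C * 2 ^ (-(c * k)) * (∫ z in Ico 0 8, |h z| ^ p) ^ (1 / p) / lam) ^ p) := by
  obtain ⟨C₁, E, hC₁, hsup⟩ := sum_superposition_rpow_le h0 h1 hd hd0 hdκ hdκ2 ht0 ht1
  set δ : ℝ := (1 - d * κ) / 2 * (1 - t) - (((d : ℝ) + 2) * κ - 1) * t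
  set q : ℝ := d + 2 * t
  have hq1 : 1 < q := hpq.symm.lt
  have hq0 : 0 < q := by linarith
  set M : ℕ := ⌈3 * q⌉₊
  have hM : 3 * q ≤ M := Nat.le_ceil _
  have hM1 : 1 ≤ M := by
    have : (1 : ℝ) ≤ M := by linarith
    exact_mod_cast this
  obtain ⟨C₂, hC₂, hpoly⟩ := exists_poly_le_rpow M E (half_pos hδ)
  set c : ℝ := min 1 (δ / 2 / q)
  have hc : 0 < c := lt_min one_pos (by positivity)
  set C : ℝ := 128 + 2 * (C₁ * C₂) ^ (1 / q)
  have hC128 : 128 ≤ C := by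
    have : 0 ≤ 2 * (C₁ * C₂) ^ (1 / q) := by positivity
    linarith
  refine ⟨C, c, by linarith, hc, ?_⟩
  intro m ε hm k h hh lam hlam
  set H : ℝ := (∫ z in Ico 0 8, |h z| ^ p) ^ (1 / p) with hH
  have hH0 : 0 ≤ H := Real.rpow_nonneg (integral_nonneg fun z => by positivity) _
  have hk0 : (0 : ℝ) ≤ k := Nat.cast_nonneg _
  have hp := hpq.pos
  have herr : (2 : ℝ) ^ (k + 1) * (2 ^ (k + 5) / 2 ^ (M * k)) ^ (1 / q) ≤
      64 * 2 ^ (-(1 * k : ℝ)) := by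
    have e1 : ((2 : ℝ) ^ (k + 5) / 2 ^ (M * k)) ^ (1 / q) =
        2 ^ ((k + 5 - M * k) * (1 / q) : ℝ) := by
      rw [Real.rpow_mul (by norm_num), Real.rpow_sub (by norm_num)]
      congr 2
      · rw [← Real.rpow_natCast]; push_cast; rfl
      · rw [← Real.rpow_natCast]; push_cast; rfl
    have e2 : (k + 5 - M * k) * (1 / q) ≤ 5 - 2 * k := by
      rw [mul_one_div, div_le_iff₀ hq0]
      have p1 : 3 * q * k ≤ M * k := mul_le_mul_of_nonneg_right hM hk0
      have p2 : k * 1 ≤ k * q := mul_le_mul_of_nonneg_left hq1.le hk0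
      linarith
    rw [e1, ← Real.rpow_natCast 2 (k + 1), ← Real.rpow_add (by norm_num),
      show (64 : ℝ) = 2 ^ (6 : ℝ) by norm_num, ← Real.rpow_add (by norm_num)]
    refine Real.rpow_le_rpow_of_exponent_le (by norm_num) ?_
    push_cast
    linarith
  have hdec1 : (2 : ℝ) ^ (-(1 * k : ℝ)) ≤ 2 ^ (-(c * k)) := by
    refine Real.rpow_le_rpow_of_exponent_le (by norm_num) ?_
    have := mul_le_mul_of_nonneg_right (min_le_left 1 (δ / 2 / q)) hk0
    linarith
  by_cases hlarge : 128 * 2 ^ (-(c * k)) * H ≤ lam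
  · set D : ℝ := C₁ * ((M * k : ℕ) + 1) ^ E * 2 ^ (-(k * δ))
    have hD0 : 0 ≤ D := by positivity
    have hW : ∀ Ω ⊆ Finset.range (2 ^ (M * k)), ∀ (η : ℕ → ℝ) (c : ℕ → ℕ), (∀ a, |η a| ≤ 1) →
        (∀ a, 2 ^ (M * k) ≤ c a) → (∀ a, c a ≤ 2 ^ (M * k + 1)) →
        ∑ b ∈ Finset.range (2 ^ (M * k + 3)), |superposition m k Ω η c b| ^ q ≤
          ((2 : ℝ) ^ (M * k)) ^ q * D * Ω.card := by
      intro Ω hΩ η c hη hc1 hc2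
      refine (hsup m ε hm (M * k) k (Nat.le_mul_of_pos_left _ hM1) Ω hΩ η c hη hc1 hc2).trans
        (le_of_eq ?_)
      simp only [D]
      ring
    have hl2 : 2 * (H * (2 ^ (k + 1) * (2 ^ (k + 5) / 2 ^ (M * k)) ^ (1 / q))) ≤ lam := by
      refine le_trans ?_ hlarge
      have := mul_le_mul_of_nonneg_left
        (herr.trans (mul_le_mul_of_nonneg_left hdec1 (by norm_num))) hH0
      linarith
    refine (volume_stepIntegral_increment_le_of_large h0 h1 hpq hm hD0 hW hh hlam hl2).trans
      (ENNReal.ofReal_le_ofReal (Real.rpow_le_rpow (by positivity) ?_ hp.le))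
    refine div_le_div_of_nonneg_right ?_ hlam.le
    have hDle : D ≤ C₁ * C₂ * 2 ^ (-(δ / 2 * k)) := by
      have e3 : (2 : ℝ) ^ (δ / 2 * k) * 2 ^ (-(k * δ)) = 2 ^ (-(δ / 2 * k)) := by
        rw [← Real.rpow_add (by norm_num)]
        congr 1
        ring
      calc D ≤ C₁ * (C₂ * 2 ^ (δ / 2 * k)) * 2 ^ (-(k * δ)) := by
            simp only [D]
            gcongr
            exact hpoly k
        _ = C₁ * C₂ * (2 ^ (δ / 2 * k) * 2 ^ (-(k * δ))) := by ring
        _ = _ := by rw [e3]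
    have hDq : D ^ (1 / q) ≤ (C₁ * C₂) ^ (1 / q) * 2 ^ (-(c * k)) := by
      calc D ^ (1 / q) ≤ (C₁ * C₂ * 2 ^ (-(δ / 2 * k))) ^ (1 / q) :=
            Real.rpow_le_rpow hD0 hDle (by positivity)
        _ = (C₁ * C₂) ^ (1 / q) * 2 ^ (-(δ / 2 * k) * (1 / q)) := by
            rw [Real.mul_rpow (by positivity) (by positivity), ← Real.rpow_mul (by norm_num)]
        _ ≤ _ := by
            refine mul_le_mul_of_nonneg_left ?_ (by positivity)
            refine Real.rpow_le_rpow_of_exponent_le (by norm_num) ?_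
            have e4 := mul_le_mul_of_nonneg_right (min_le_right 1 (δ / 2 / q)) hk0
            have e5 : -(δ / 2 * k) * (1 / q) = -(δ / 2 / q * k) := by ring
            rw [e5]
            linarith
    have e6 : 0 ≤ 2 ^ (-(c * k)) * H := by positivity
    calc 2 * H * D ^ (1 / q) ≤ 2 * H * ((C₁ * C₂) ^ (1 / q) * 2 ^ (-(c * k))) := by gcongr
      _ = (2 * (C₁ * C₂) ^ (1 / q)) * (2 ^ (-(c * k)) * H) := by ring
      _ ≤ C * (2 ^ (-(c * k)) * H) := by
          refine mul_le_mul_of_nonneg_right ?_ e6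
          simp only [C]
          linarith
      _ = _ := by ring
  · refine volume_le_of_subset_Ico (fun x hx => hx.1) hp.le ?_
    rw [one_le_div hlam]
    have e6 : 0 ≤ 2 ^ (-(c * k)) * H := by positivity
    have := mul_le_mul_of_nonneg_right hC128 e6
    linarith [not_le.1 hlarge]

/-- Weak type `(p, p)` inequality with exponential decay for the increments of `m`. -/
def IncrementBound (m : ℕ → ℕ → ℝ) (p C c : ℝ) : Prop :=
  ∀ (k : ℕ) (h : ℝ → ℝ), MemLp h (ENNReal.ofReal p) (volume.restrict (Ico 0 8)) →
    ∀ lam : ℝ, 0 < lam → volume {x ∈ Ico (0 : ℝ) 1 | ∃ r ∈ Icc (1 : ℝ) 2,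
        lam < |stepIntegral (increment m k) (k + 1) h x r|} ≤
      ENNReal.ofReal ((C * 2 ^ (-(c * k)) * (∫ z in Ico 0 8, |h z| ^ p) ^ (1 / p) / lam) ^ p)

lemma floor_rescale_div_two (k : ℕ) (a r : ℝ) :
    ⌊2 ^ (k + 1) * a / r⌋₊ / 2 = ⌊2 ^ k * a / r⌋₊ := by
  have := Nat.floor_div_natCast (2 ^ (k + 1) * a / r) 2
  rw [← this]
  congr 1
  rw [pow_succ]
  push_cast
  ring

lemma abs_sum_le_of_geometric {a : ℕ → ℝ} {L ρ : ℝ} (hL : 0 ≤ L) (hρ : 0 ≤ ρ) {n : ℕ}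
    (h : ∀ k < n, |a k| ≤ L * ((1 - ρ) * ρ ^ k)) : |∑ k ∈ Finset.range n, a k| ≤ L := by
  refine (Finset.abs_sum_le_sum_abs _ _).trans ((Finset.sum_le_sum fun k hk =>
    h k (Finset.mem_range.1 hk)).trans ?_)
  rw [← Finset.mul_sum, ← Finset.mul_sum, mul_neg_geom_sum]
  have : 0 ≤ ρ ^ n := by positivity
  exact mul_le_of_le_one_right hL (by linarith)

lemma integrable_mul_step {p q : ℝ} (hpq : p.HolderConjugate q) {h : ℝ → ℝ}
    (hh : MemLp h (ENNReal.ofReal p) (volume.restrict (Ico 0 8))) {g : ℕ → ℝ} {B : ℝ}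
    (hg : ∀ q, |g q| ≤ B) (J : ℕ) (x r : ℝ) :
    Integrable (fun z => h z * g ⌊2 ^ J * (z - x) / r⌋₊) (volume.restrict (Ico 0 8)) := by
  have : ENNReal.HolderConjugate (ENNReal.ofReal p) (ENNReal.ofReal q) := hpq.ennrealOfReal
  refine hh.integrable_mul (q := ENNReal.ofReal q) ?_
  exact MemLp.of_bound (measurable_step g J x r).aestronglyMeasurable B
    (Filter.Eventually.of_forall fun z => hg _)

namespace IsCascade

variable {κ : ℝ} {m ε : ℕ → ℕ → ℝ}

lemma abs_le_two_pow (hm : IsCascade κ m ε) (h0 : 0 ≤ κ) (h1 : κ ≤ 1) (k q : ℕ) :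
    |m k q| ≤ 2 ^ k := by
  rw [abs_of_nonneg (hm.nonneg h0 h1 k q)]
  refine (hm.le_rpow h0 h1 k q).trans ?_
  rw [← Real.rpow_natCast]
  refine Real.rpow_le_rpow_of_exponent_le (by norm_num) ?_
  exact mul_le_of_le_one_left (Nat.cast_nonneg _) h1

lemma stepIntegral_succ (hm : IsCascade κ m ε) (h0 : 0 ≤ κ) (h1 : κ ≤ 1) {p q : ℝ}
    (hpq : p.HolderConjugate q) {h : ℝ → ℝ}
    (hh : MemLp h (ENNReal.ofReal p) (volume.restrict (Ico 0 8))) (K : ℕ) (x r : ℝ) :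
    stepIntegral (m (K + 1)) (K + 1) h x r =
      stepIntegral (m K) K h x r + stepIntegral (increment m K) (K + 1) h x r := by
  unfold stepIntegral
  rw [← integral_add (integrable_mul_step hpq hh (hm.abs_le_two_pow h0 h1 K) _ _ _)
    (integrable_mul_step hpq hh (hm.abs_increment_le_two_pow h0 h1 K) _ _ _)]
  refine integral_congr_ae (Filter.Eventually.of_forall fun z => ?_)
  simp only [increment, floor_rescale_div_two]
  ring

lemma stepIntegral_add (hm : IsCascade κ m ε) (h0 : 0 ≤ κ) (h1 : κ ≤ 1) {p q : ℝ}
    (hpq : p.HolderConjugate q) {h : ℝ → ℝ}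
    (hh : MemLp h (ENNReal.ofReal p) (volume.restrict (Ico 0 8))) (k n : ℕ) (x r : ℝ) :
    stepIntegral (m (k + n)) (k + n) h x r = stepIntegral (m k) k h x r +
      ∑ j ∈ Finset.range n, stepIntegral (increment m (k + j)) (k + j + 1) h x r := by
  induction n with
  | zero => simp
  | succ n ih =>
    rw [Finset.sum_range_succ, ← add_assoc (stepIntegral _ _ _ _ _), ← ih]
    exact hm.stepIntegral_succ h0 h1 hpq hh (k + n) x r

lemma abs_stepIntegral_le_of_mean_zero (hm : IsCascade κ m ε) (h0 : 0 ≤ κ) (h1 : κ ≤ 1)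
    {p q : ℝ} (hpq : p.HolderConjugate q) {h : ℝ → ℝ}
    (hh : MemLp h (ENNReal.ofReal p) (volume.restrict (Ico 0 8))) {i : ℕ}
    (hmean : ∀ b : ℕ, ∫ z in Ico (b / 2 ^ i : ℝ) ((b + 1) / 2 ^ i), h z = 0) (k : ℕ) (x : ℝ)
    {r : ℝ} (hr : 0 < r) :
    |stepIntegral (m k) k h x r| ≤ (∫ z in Ico 0 8, |h z| ^ p) ^ (1 / p) *
      (2 ^ k * (2 ^ (k + 2) / 2 ^ i) ^ (1 / q)) := by
  have hi : (0 : ℝ) < 2 ^ i := by positivity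
  let w : ℝ → ℝ := fun z => m k ⌊2 ^ k * (z - x) / r⌋₊
  let G : ℕ → ℝ := fun b => w (b / 2 ^ i)
  have hwm : Measurable w := measurable_step _ _ _ _
  have hGm : Measurable fun z : ℝ => G ⌊2 ^ i * z⌋₊ :=
    (measurable_of_countable G).comp (Nat.measurable_floor.comp (by fun_prop))
  have hwb := hm.le_two_pow h0 h1 k
  have hb := hm.abs_le_two_pow h0 h1 k
  have hn := hm.nonneg h0 h1 k
  have : ENNReal.HolderConjugate (ENNReal.ofReal p) (ENNReal.ofReal q) := hpq.ennrealOfReal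
  have hhI : IntegrableOn h (Ico 0 8) :=
    hh.integrable (by
      rw [← ENNReal.ofReal_one]
      exact ENNReal.ofReal_le_ofReal hpq.lt.le)
  have hGint : Integrable (fun z => h z * G ⌊2 ^ i * z⌋₊) (volume.restrict (Ico 0 8)) :=
    hh.integrable_mul (q := ENNReal.ofReal q) (MemLp.of_bound hGm.aestronglyMeasurable (2 ^ k)
      (Filter.Eventually.of_forall fun z => hb _))
  have hG0 : ∫ z in Ico (0 : ℝ) 8, h z * G ⌊2 ^ i * z⌋₊ = 0 := by
    rw [integral_Ico_mul_step i hhI]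
    exact Finset.sum_eq_zero fun b _ => by rw [hmean, zero_mul]
  have heq : stepIntegral (m k) k h x r =
      ∫ z in Ico (0 : ℝ) 8, h z * (w z - G ⌊2 ^ i * z⌋₊) := by
    simp only [mul_sub]
    rw [integral_sub (integrable_mul_step hpq hh hb _ _ _) hGint, hG0, sub_zero]
    rfl
  rw [heq]
  refine abs_integral_mul_le_of_support hpq hh (hwm.sub hGm) ?_
    ((measurableSet_jumpSet k (1 / 2 ^ i) x r).union (measurableSet_Iio (a := (0 : ℝ)))) ?_
    (by positivity) ?_
  · intro z
    have p1 := hn ⌊2 ^ k * (z - x) / r⌋₊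
    have p2 := abs_le.1 (hb ⌊2 ^ k * (z - x) / r⌋₊)
    have p3 := hn ⌊2 ^ k * ((⌊2 ^ i * z⌋₊ : ℝ) / 2 ^ i - x) / r⌋₊
    have p4 := abs_le.1 (hb ⌊2 ^ k * ((⌊2 ^ i * z⌋₊ : ℝ) / 2 ^ i - x) / r⌋₊)
    simp only [Pi.sub_apply, w, G]
    rw [abs_le]
    constructor <;> linarith
  · intro z hz
    rw [mem_union, not_or] at hz
    have hz0 : 0 ≤ 2 ^ i * z := mul_nonneg hi.le (not_lt.1 hz.2)
    rw [Pi.sub_apply, sub_eq_zero]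
    refine step_eq_of_abs_sub_le (fun q hq => hm.mem_of_ne_zero hq) hr hz.1 ?_
    have f1 := Nat.floor_le hz0
    have f2 := Nat.lt_floor_add_one (2 ^ i * z)
    have : z - ⌊2 ^ i * z⌋₊ / 2 ^ i = (2 ^ i * z - ⌊2 ^ i * z⌋₊) / 2 ^ i := by field_simp
    rw [this, abs_of_nonneg (div_nonneg (by linarith) hi.le)]
    gcongr
    linarith
  · refine (measure_union_le _ _).trans ?_
    have e1 : volume.restrict (Ico (0 : ℝ) 8) (Iio (0 : ℝ)) = 0 := by
      rw [Measure.restrict_apply measurableSet_Iio]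
      convert measure_empty (μ := (volume : Measure ℝ))
      ext z
      simp only [mem_inter_iff, mem_Iio, mem_Ico, mem_empty_iff_false, iff_false]
      intro hz
      linarith
    rw [e1, add_zero]
    refine (Measure.restrict_apply_le _ _).trans ?_
    refine (volume_jumpSet_le _ (by positivity) _ _).trans (le_of_eq ?_)
    rw [mul_one_div]

/-- Weak type inequality for functions of mean zero on all dyadic intervals of length
`2 ^ -i`, with a bound decaying in `i`, uniformly in the level of the cascade. -/
lemma volume_stepIntegral_le_of_mean_zero (hm : IsCascade κ m ε) (h0 : 0 ≤ κ) (h1 : κ ≤ 1)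
    {p q : ℝ} (hpq : p.HolderConjugate q) {C c : ℝ} (hC : 0 < C) (hc : 0 < c)
    (hinc : IncrementBound m p C c) :
    ∃ C' c' : ℝ, 0 < C' ∧ 0 < c' ∧ ∀ (K i : ℕ) (h : ℝ → ℝ),
      MemLp h (ENNReal.ofReal p) (volume.restrict (Ico 0 8)) →
      (∀ b : ℕ, ∫ z in Ico (b / 2 ^ i : ℝ) ((b + 1) / 2 ^ i), h z = 0) →
      ∀ lam : ℝ, 0 < lam → volume {x ∈ Ico (0 : ℝ) 1 | ∃ r ∈ Icc (1 : ℝ) 2,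
          lam < |stepIntegral (m K) K h x r|} ≤
        ENNReal.ofReal
          ((C' * 2 ^ (-(c' * i)) * (∫ z in Ico 0 8, |h z| ^ p) ^ (1 / p) / lam) ^ p) := by
  have hq1 : 1 < q := hpq.symm.lt
  have hq0 : 0 < q := by linarith
  have hp := hpq.pos
  set ρ : ℝ := 2 ^ (-(c / 2)) with hρ
  have hρ0 : 0 < ρ := by positivity
  have hρ1 : ρ < 1 := Real.rpow_lt_one_of_one_lt_of_neg (by norm_num) (by linarith)
  have hρp : ρ ^ p < 1 := Real.rpow_lt_one hρ0.le hρ1 hp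
  set M : ℕ := ⌈3 * q⌉₊
  have hM : 3 * q ≤ M := Nat.le_ceil _
  have hM0 : 0 < M := by
    have : (0 : ℝ) < M := by linarith
    exact_mod_cast this
  have hM0' : (0 : ℝ) < M := by exact_mod_cast hM0
  set c' : ℝ := min 1 c
  have hc' : 0 < c' := lt_min one_pos hc
  have hc'1 : c' ≤ 1 := min_le_left _ _
  set A : ℝ := 2 * C / (1 - ρ) * (1 / (1 - ρ ^ p)) ^ (1 / p) with hA
  have hA0 : 0 < A := by
    have : 0 < 1 - ρ := by linarith
    have : 0 < 1 - ρ ^ p := by linarith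
    positivity
  refine ⟨(8 + A) * 2, c' / M, by positivity, by positivity, ?_⟩
  intro K i h hh hmean lam hlam
  set H : ℝ := (∫ z in Ico 0 8, |h z| ^ p) ^ (1 / p) with hH
  have hH0 : 0 ≤ H := Real.rpow_nonneg (integral_nonneg fun z => by positivity) _
  set m₀ : ℕ := i / M
  have hm₀i : M * m₀ ≤ i := Nat.mul_div_le i M
  have him₀ : i < M * (m₀ + 1) := by
    have := Nat.lt_mul_div_succ i hM0
    simpa [m₀] using this
  have hdec : (2 : ℝ) ^ (-(c' * m₀)) ≤ 2 * 2 ^ (-(c' / M * i)) := by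
    have e1 : (2 : ℝ) * 2 ^ (-(c' / M * i)) = 2 ^ (1 + -(c' / M * i)) := by
      rw [Real.rpow_add (by norm_num), Real.rpow_one]
    rw [e1]
    refine Real.rpow_le_rpow_of_exponent_le (by norm_num) ?_
    have e2 : (i : ℝ) ≤ M * (m₀ + 1) := by exact_mod_cast him₀.le
    have e3 : c' / M * i ≤ c' / M * (M * (m₀ + 1)) :=
      mul_le_mul_of_nonneg_left e2 (by positivity)
    have e4 : c' / M * (M * (m₀ + 1)) = c' * m₀ + c' := by field_simp
    linarith
  have hm00 : (0 : ℝ) ≤ m₀ := Nat.cast_nonneg _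
  have hfirst : ∀ k ≤ m₀, ∀ x r, 0 < r →
      |stepIntegral (m k) k h x r| ≤ 4 * 2 ^ (-(c' * m₀)) * H := by
    intro k hk x r hr
    refine (hm.abs_stepIntegral_le_of_mean_zero h0 h1 hpq hh hmean k x hr).trans ?_
    rw [mul_comm]
    refine mul_le_mul_of_nonneg_right ?_ hH0
    have hk' : (k : ℝ) ≤ m₀ := by exact_mod_cast hk
    have hk0 : (0 : ℝ) ≤ k := Nat.cast_nonneg _
    have hi' : (M : ℝ) * m₀ ≤ i := by exact_mod_cast hm₀i
    have e1 : ((2 : ℝ) ^ (k + 2) / 2 ^ i) ^ (1 / q) = 2 ^ ((k + 2 - i) * (1 / q) : ℝ) := by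
      rw [Real.rpow_mul (by norm_num), Real.rpow_sub (by norm_num)]
      congr 2
      · rw [← Real.rpow_natCast]; push_cast; rfl
      · rw [← Real.rpow_natCast]
    have e2 : (k + 2 - i) * (1 / q) ≤ 2 - 2 * (m₀ : ℝ) := by
      rw [mul_one_div, div_le_iff₀ hq0]
      have p1 : 3 * q * m₀ ≤ M * m₀ := mul_le_mul_of_nonneg_right hM hm00
      have p2 : m₀ * 1 ≤ m₀ * q := mul_le_mul_of_nonneg_left hq1.le hm00
      linarith
    rw [e1, ← Real.rpow_natCast 2 k, ← Real.rpow_add (by norm_num),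
      show (4 : ℝ) = 2 ^ (2 : ℝ) by norm_num, ← Real.rpow_add (by norm_num)]
    refine Real.rpow_le_rpow_of_exponent_le (by norm_num) ?_
    have := mul_le_mul_of_nonneg_right hc'1 hm00
    linarith
  set Z : ℝ := 2 ^ (-(c' * m₀)) * H with hZ
  have hZ0 : 0 ≤ Z := by positivity
  have hgoal : (8 + A) * Z ≤ (8 + A) * 2 * 2 ^ (-(c' / M * i)) * H := by
    have := mul_le_mul_of_nonneg_left (mul_le_mul_of_nonneg_right hdec hH0)
      (show 0 ≤ 8 + A by positivity)
    rw [hZ]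
    linarith
  by_cases hlarge : 8 * Z ≤ lam
  swap
  · refine volume_le_of_subset_Ico (fun x hx => hx.1) hp.le ?_
    rw [one_le_div hlam]
    have e6 : 0 ≤ A * Z := by positivity
    linarith [not_le.1 hlarge]
  have hfirst' : ∀ k ≤ m₀, ∀ x r, 0 < r → |stepIntegral (m k) k h x r| ≤ lam / 2 := by
    intro k hk x r hr
    have e3 := hfirst k hk x r hr
    rw [mul_assoc, ← hZ] at e3
    linarith
  rcases le_or_gt K m₀ with hK | hK
  · have : {x ∈ Ico (0 : ℝ) 1 | ∃ r ∈ Icc (1 : ℝ) 2, lam < |stepIntegral (m K) K h x r|} = ∅ := by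
      ext x
      simp only [mem_empty_iff_false, iff_false]
      rintro ⟨_, r, hr, hr2⟩
      have := hfirst' K hK x r (zero_lt_one.trans_le hr.1)
      linarith
    rw [this, measure_empty]
    exact zero_le
  obtain ⟨n, rfl⟩ := Nat.exists_eq_add_of_le hK.le
  let L : ℕ → ℝ := fun j => lam / 2 * ((1 - ρ) * ρ ^ j)
  have hL : ∀ j, 0 < L j := fun j => by
    have : 0 < 1 - ρ := by linarith
    positivity
  have hsub : {x ∈ Ico (0 : ℝ) 1 | ∃ r ∈ Icc (1 : ℝ) 2,
      lam < |stepIntegral (m (m₀ + n)) (m₀ + n) h x r|} ⊆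
      ⋃ j ∈ Finset.range n, {x ∈ Ico (0 : ℝ) 1 | ∃ r ∈ Icc (1 : ℝ) 2,
        L j < |stepIntegral (increment m (m₀ + j)) (m₀ + j + 1) h x r|} := by
    rintro x ⟨hx, r, hr, hr2⟩
    simp only [mem_iUnion, exists_prop, Finset.mem_range]
    by_contra hcon
    have hle : ∀ j < n, |stepIntegral (increment m (m₀ + j)) (m₀ + j + 1) h x r| ≤ L j := by
      intro j hj
      by_contra h5
      exact hcon ⟨j, hj, hx, r, hr, not_le.1 h5⟩
    have h6 := abs_sum_le_of_geometric (half_pos hlam).le hρ0.le hle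
    have h7 := hfirst' m₀ le_rfl x r (zero_lt_one.trans_le hr.1)
    rw [hm.stepIntegral_add h0 h1 hpq hh] at hr2
    have := abs_add_le (stepIntegral (m m₀) m₀ h x r)
      (∑ j ∈ Finset.range n, stepIntegral (increment m (m₀ + j)) (m₀ + j + 1) h x r)
    linarith
  have hterm : ∀ j : ℕ, (C * 2 ^ (-(c * (m₀ + j : ℕ))) * H / L j) ^ p ≤
      (2 * C / (1 - ρ) * Z / lam) ^ p * (ρ ^ p) ^ j := by
    intro j
    have h1ρ : 0 < 1 - ρ := by linarith
    have e1 : (2 : ℝ) ^ (-(c * (m₀ + j : ℕ))) = 2 ^ (-(c * m₀)) * (ρ ^ j * ρ ^ j) := by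
      rw [hρ, ← Real.rpow_natCast, ← Real.rpow_mul (by norm_num), ← Real.rpow_add (by norm_num),
        ← Real.rpow_add (by norm_num)]
      congr 1
      push_cast
      ring
    have e2 : (2 : ℝ) ^ (-(c * m₀)) ≤ 2 ^ (-(c' * m₀)) := by
      refine Real.rpow_le_rpow_of_exponent_le (by norm_num) ?_
      have := mul_le_mul_of_nonneg_right (min_le_right 1 c) hm00
      linarith
    have e3 : (ρ ^ p) ^ j = (ρ ^ j) ^ p := by
      rw [← Real.rpow_natCast, ← Real.rpow_natCast, ← Real.rpow_mul hρ0.le,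
        ← Real.rpow_mul hρ0.le, mul_comm]
    rw [e3, ← Real.mul_rpow (by positivity) (by positivity)]
    refine Real.rpow_le_rpow (div_nonneg (by positivity) (hL j).le) ?_ hp.le
    rw [div_le_iff₀ (hL j), e1]
    have hρj : 0 < ρ ^ j := by positivity
    calc C * (2 ^ (-(c * m₀)) * (ρ ^ j * ρ ^ j)) * H ≤
          C * (2 ^ (-(c' * m₀)) * (ρ ^ j * ρ ^ j)) * H := by gcongr
      _ = 2 * C / (1 - ρ) * Z / lam * ρ ^ j * L j := by
          simp only [L, hZ]
          field_simp
  have hgeom : ∑ j ∈ Finset.range n, (ρ ^ p) ^ j ≤ 1 / (1 - ρ ^ p) := by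
    rw [le_div_iff₀ (by linarith), mul_comm, mul_neg_geom_sum]
    have : 0 ≤ (ρ ^ p) ^ n := by positivity
    linarith
  calc volume {x ∈ Ico (0 : ℝ) 1 | ∃ r ∈ Icc (1 : ℝ) 2,
        lam < |stepIntegral (m (m₀ + n)) (m₀ + n) h x r|}
      ≤ ∑ j ∈ Finset.range n, volume {x ∈ Ico (0 : ℝ) 1 | ∃ r ∈ Icc (1 : ℝ) 2,
        L j < |stepIntegral (increment m (m₀ + j)) (m₀ + j + 1) h x r|} :=
        (measure_mono hsub).trans (measure_biUnion_finset_le _ _)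
    _ ≤ ∑ j ∈ Finset.range n,
        ENNReal.ofReal ((C * 2 ^ (-(c * (m₀ + j : ℕ))) * H / L j) ^ p) :=
        Finset.sum_le_sum fun j _ => hinc (m₀ + j) h hh (L j) (hL j)
    _ ≤ ∑ j ∈ Finset.range n,
        ENNReal.ofReal ((2 * C / (1 - ρ) * Z / lam) ^ p * (ρ ^ p) ^ j) :=
        Finset.sum_le_sum fun j _ => ENNReal.ofReal_le_ofReal (hterm j)
    _ = ENNReal.ofReal ((2 * C / (1 - ρ) * Z / lam) ^ p *
          ∑ j ∈ Finset.range n, (ρ ^ p) ^ j) := by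
        have h1ρ : 0 < 1 - ρ := by linarith
        rw [Finset.mul_sum, ENNReal.ofReal_sum_of_nonneg fun j _ => by positivity]
    _ ≤ _ := by
        refine ENNReal.ofReal_le_ofReal ?_
        have h1ρ : 0 < 1 - ρ := by linarith
        have h1ρp : 0 < 1 - ρ ^ p := by linarith
        calc (2 * C / (1 - ρ) * Z / lam) ^ p * ∑ j ∈ Finset.range n, (ρ ^ p) ^ j
            ≤ (2 * C / (1 - ρ) * Z / lam) ^ p * (1 / (1 - ρ ^ p)) := by gcongr
          _ = (2 * C / (1 - ρ) * Z / lam) ^ p * ((1 / (1 - ρ ^ p)) ^ (1 / p)) ^ p := by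
              rw [← Real.rpow_mul (x := 1 / (1 - ρ ^ p)) (by positivity), one_div_mul_cancel hp.ne',
                Real.rpow_one]
          _ = (A * Z / lam) ^ p := by
              rw [← Real.mul_rpow (by positivity) (by positivity), hA]
              congr 1
              ring
          _ ≤ _ := by
              refine Real.rpow_le_rpow (by positivity) ?_ hp.le
              refine div_le_div_of_nonneg_right ?_ hlam.le
              linarith

end IsCascade

section scaling

lemma lintegral_comp_mul_left_real (F : ℝ → ENNReal) {a : ℝ} (ha : 0 < a) :
    ∫⁻ x, F (a * x) = ENNReal.ofReal a⁻¹ * ∫⁻ x, F x := by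
  have e := lintegral_map_equiv (μ := volume) F (MeasurableEquiv.mulLeft₀ a ha.ne')
  simp only [MeasurableEquiv.coe_mulLeft₀] at e
  rw [← e, Real.map_volume_mul_left ha.ne', lintegral_smul_measure, abs_of_pos (inv_pos.2 ha),
    smul_eq_mul]

lemma tsum_lintegral_Ico_add_le {F : ℝ → ENNReal} (hF : Measurable F) (N : ℕ) :
    ∑' n : ℤ, ∫⁻ z in Ico (0 : ℝ) N, F (z + n) ≤ N * ∫⁻ z, F z := by
  have h1 : ∀ n : ℤ, ∫⁻ z in Ico (0 : ℝ) N, F (z + n) =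
      ∫⁻ z, (Ico (0 : ℝ) N).indicator 1 (z - n) * F z := by
    intro n
    rw [← lintegral_indicator measurableSet_Ico,
      ← lintegral_sub_right_eq_self (fun z => (Ico (0 : ℝ) N).indicator
        (fun z => F (z + n)) z) (n : ℝ)]
    refine lintegral_congr fun z => ?_
    by_cases hz : z - n ∈ Ico (0 : ℝ) N
    · simp [indicator_of_mem hz]
    · simp [indicator_of_notMem hz]
  simp_rw [h1]
  rw [← lintegral_tsum]
  swap
  · intro n
    refine Measurable.aemeasurable ?_
    refine Measurable.mul ?_ hF
    exact (measurable_one.indicator measurableSet_Ico).comp (by fun_prop)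
  rw [← lintegral_const_mul _ hF]
  refine lintegral_mono fun z => ?_
  simp only
  rw [ENNReal.tsum_mul_right]
  refine mul_le_mul_left ?_ _
  rw [tsum_eq_sum (s := Finset.Ioc (⌊z⌋ - N) ⌊z⌋)]
  · refine (Finset.sum_le_card_nsmul _ _ 1 fun n _ => ?_).trans ?_
    · exact indicator_le_self' (by simp) _
    · simp
  · intro n hn
    refine indicator_of_notMem (fun hz => hn ?_) _
    rw [Finset.mem_Ioc]
    have h2 : (⌊z⌋ : ℝ) ≤ z := Int.floor_le z
    constructor
    · have : (⌊z⌋ : ℝ) - N < n := by linarith [hz.2]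
      exact_mod_cast this
    · exact Int.le_floor.2 (by linarith [hz.1])

end scaling

namespace IsCascade

variable {κ : ℝ} {m ε : ℕ → ℕ → ℝ}

lemma step_eq_zero (hm : IsCascade κ m ε) (K : ℕ) {u : ℝ} (hu : u ∉ Ico (1 : ℝ) 2) :
    m K ⌊2 ^ K * u⌋₊ = 0 := by
  by_contra hne
  have h2 : (0 : ℝ) < 2 ^ K := by positivity
  obtain ⟨h3, h4⟩ := hm.mem_of_ne_zero hne
  refine hu ⟨?_, ?_⟩
  · have := (Nat.le_floor_iff' (by positivity)).1 h3
    push_cast at this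
    exact le_of_mul_le_mul_left (by linarith) h2
  · have := Nat.lt_of_floor_lt h4
    push_cast at this
    rw [pow_succ] at this
    exact lt_of_mul_lt_mul_left this h2.le

lemma stepIntegral_eq (hm : IsCascade κ m ε) (K : ℕ) (h : ℝ → ℝ) {x r : ℝ}
    (hx : x ∈ Ico (0 : ℝ) 1) (hr : r ∈ Icc (1 : ℝ) 2) :
    stepIntegral (m K) K h x r = r * ∫ u, h (x + r * u) * m K ⌊2 ^ K * u⌋₊ := by
  have hr0 : 0 < r := zero_lt_one.trans_le hr.1
  let G : ℝ → ℝ := fun z => h z * m K ⌊2 ^ K * ((z - x) / r)⌋₊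
  have e1 : stepIntegral (m K) K h x r = ∫ z, G z := by
    unfold stepIntegral
    rw [setIntegral_eq_integral_of_forall_compl_eq_zero]
    · simp only [G, mul_div_assoc]
    · intro z hz
      rw [mul_div_assoc, hm.step_eq_zero K, mul_zero]
      intro hu
      refine hz ⟨?_, ?_⟩
      · have := (le_div_iff₀ hr0).1 hu.1
        linarith [hx.1]
      · have := (div_lt_iff₀ hr0).1 hu.2
        linarith [hx.2, hr.2]
  have e2 : ∀ u, h (x + r * u) * m K ⌊2 ^ K * u⌋₊ = G (x + r * u) := by
    intro u
    simp only [G]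
    congr 4
    field_simp
    ring
  simp_rw [e2]
  rw [Measure.integral_comp_mul_left (fun v => G (x + v)) r, integral_add_left_eq_self G x, e1,
    abs_of_pos (inv_pos.2 hr0), smul_eq_mul, mul_inv_cancel_left₀ hr0.ne']

/-- Weak type inequality for averages over dilations in `[R, 2R]` of functions having mean zero
on the cells of a grid of mesh `R / 2 ^ i`. -/
lemma volume_average_le_of_mean_zero (hm : IsCascade κ m ε) (h0 : 0 ≤ κ) (h1 : κ ≤ 1)
    {p q : ℝ} (hpq : p.HolderConjugate q) {C c : ℝ} (hC : 0 < C) (hc : 0 < c)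
    (hinc : IncrementBound m p C c) :
    ∃ C' c' : ℝ, 0 < C' ∧ 0 < c' ∧ ∀ (K i : ℕ) (R : ℝ), 0 < R → ∀ b : ℝ → ℝ, Measurable b →
      MemLp b (ENNReal.ofReal p) →
      (∀ q : ℤ, ∫ z in Ico (q * (R / 2 ^ i) : ℝ) ((q + 1) * (R / 2 ^ i)), b z = 0) →
      ∀ lam : ℝ, 0 < lam → volume {x : ℝ | ∃ r ∈ Icc R (2 * R),
          lam < |∫ u, b (x + r * u) * m K ⌊2 ^ K * u⌋₊|} ≤
        ENNReal.ofReal ((C' * 2 ^ (-(c' * i)) / lam) ^ p) * ∫⁻ z, ‖b z‖ₑ ^ p := by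
  obtain ⟨C₁, c₁, hC₁, hc₁, hmain⟩ := hm.volume_stepIntegral_le_of_mean_zero h0 h1 hpq hC hc hinc
  have hp := hpq.pos
  refine ⟨8 ^ (1 / p) * C₁, c₁, by positivity, hc₁, ?_⟩
  intro K i R hR b hb hbp hmean lam hlam
  let h : ℤ → ℝ → ℝ := fun n z => b (R * (z + n))
  have hhm : ∀ n, Measurable (h n) := fun n => hb.comp (by fun_prop)
  let F : ℝ → ENNReal := fun z => ‖b (R * z)‖ₑ ^ p
  have hF : Measurable F := (hb.comp (by fun_prop : Measurable fun z : ℝ => R * z)).enorm.pow_const p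
  have hp0 : ENNReal.ofReal p ≠ 0 := by simpa using hp
  have hFint : ∫⁻ z, F z = ENNReal.ofReal R⁻¹ * ∫⁻ z, ‖b z‖ₑ ^ p :=
    lintegral_comp_mul_left_real (fun z => ‖b z‖ₑ ^ p) hR
  have hbfin : ∫⁻ z, ‖b z‖ₑ ^ p ≠ ⊤ := by
    have := lintegral_rpow_enorm_lt_top_of_eLpNorm_lt_top hp0 ENNReal.ofReal_ne_top hbp.2
    rw [ENNReal.toReal_ofReal hp.le] at this
    exact this.ne
  have hFfin : ∫⁻ z, F z ≠ ⊤ := by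
    rw [hFint]
    exact ENNReal.mul_ne_top ENNReal.ofReal_ne_top hbfin
  have hloc : ∀ n : ℤ, ∫⁻ z in Ico (0 : ℝ) 8, ‖h n z‖ₑ ^ p ≠ ⊤ := by
    intro n
    refine ((setLIntegral_le_lintegral _ _).trans_lt ?_).ne
    have : ∫⁻ z, ‖h n z‖ₑ ^ p = ∫⁻ z, F z := lintegral_add_right_eq_self F (n : ℝ)
    rw [this]
    exact hFfin.lt_top
  have hmem : ∀ n, MemLp (h n) (ENNReal.ofReal p) (volume.restrict (Ico 0 8)) := by
    intro n
    refine ⟨(hhm n).aestronglyMeasurable, ?_⟩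
    rw [eLpNorm_lt_top_iff_lintegral_rpow_enorm_lt_top hp0 ENNReal.ofReal_ne_top,
      ENNReal.toReal_ofReal hp.le]
    exact (hloc n).lt_top
  have hzero : ∀ (n : ℤ) (β : ℕ), ∫ z in Ico (β / 2 ^ i : ℝ) ((β + 1) / 2 ^ i), h n z = 0 := by
    intro n β
    have h2i : (0 : ℝ) < 2 ^ i := by positivity
    have hle : (β / 2 ^ i : ℝ) ≤ (β + 1) / 2 ^ i := by gcongr; linarith
    have e1 := hmean (β + n * 2 ^ i)
    rw [integral_Ico_eq_integral_Ioc, ← intervalIntegral.integral_of_le (by gcongr; linarith)] at e1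
    rw [integral_Ico_eq_integral_Ioc, ← intervalIntegral.integral_of_le hle]
    have e2 : ∀ z, h n z = b (R * z + R * n) := fun z => by simp only [h, mul_add]
    simp_rw [e2]
    rw [intervalIntegral.integral_comp_mul_add b hR.ne']
    have e3 : R * (β / 2 ^ i) + R * n = ((β + n * 2 ^ i : ℤ) : ℝ) * (R / 2 ^ i) := by
      push_cast; field_simp
    have e4 : R * ((β + 1) / 2 ^ i) + R * n = (((β + n * 2 ^ i : ℤ) : ℝ) + 1) * (R / 2 ^ i) := by
      push_cast; field_simp; ring
    rw [e3, e4, e1, smul_zero]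
  let E : ℤ → Set ℝ := fun n => {x ∈ Ico (0 : ℝ) 1 | ∃ r ∈ Icc (1 : ℝ) 2,
      lam < |stepIntegral (m K) K (h n) x r|}
  set D : ℝ := C₁ * 2 ^ (-(c₁ * i)) / lam with hD
  have hD0 : 0 ≤ D := by positivity
  have hE : ∀ n, volume (E n) ≤ ENNReal.ofReal (D ^ p) * ∫⁻ z in Ico (0 : ℝ) 8, F (z + n) := by
    intro n
    refine (hmain K i (h n) (hmem n) (hzero n) lam hlam).trans (le_of_eq ?_)
    set I : ℝ := ∫ z in Ico 0 8, |h n z| ^ p with hI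
    have hI0 : 0 ≤ I := integral_nonneg fun z => by positivity
    have e1 : (C₁ * 2 ^ (-(c₁ * i)) * I ^ (1 / p) / lam) ^ p = D ^ p * I := by
      rw [mul_div_right_comm, ← hD, Real.mul_rpow hD0 (by positivity), ← Real.rpow_mul hI0,
        one_div_mul_cancel hp.ne', Real.rpow_one]
    rw [e1, ENNReal.ofReal_mul (by positivity)]
    congr 1
    have hint : Integrable (fun z => |h n z| ^ p) (volume.restrict (Ico 0 8)) := by
      have := (hmem n).integrable_norm_rpow hp0 ENNReal.ofReal_ne_top
      rw [ENNReal.toReal_ofReal hp.le] at this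
      exact this
    rw [hI, ofReal_integral_eq_lintegral_ofReal hint
      (Filter.Eventually.of_forall fun z => by positivity)]
    refine lintegral_congr fun z => ?_
    simp only [F, h]
    rw [Real.enorm_eq_ofReal_abs, ENNReal.ofReal_rpow_of_nonneg (abs_nonneg _) hp.le]
  have hsub : {x : ℝ | ∃ r ∈ Icc R (2 * R), lam < |∫ u, b (x + r * u) * m K ⌊2 ^ K * u⌋₊|} ⊆
      ⋃ n : ℤ, (fun x => x * R⁻¹) ⁻¹' ((fun x => x + (-(n : ℝ))) ⁻¹' E n) := by
    rintro x ⟨r, hr, hlt⟩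
    simp only [mem_iUnion, mem_preimage]
    have hx1 := Int.floor_le (x * R⁻¹)
    have hx2 := Int.lt_floor_add_one (x * R⁻¹)
    have hx : x * R⁻¹ + -(⌊x * R⁻¹⌋ : ℝ) ∈ Ico (0 : ℝ) 1 := ⟨by linarith, by linarith⟩
    have hr' : r / R ∈ Icc (1 : ℝ) 2 :=
      ⟨(one_le_div hR).2 hr.1, (div_le_iff₀ hR).2 hr.2⟩
    refine ⟨⌊x * R⁻¹⌋, hx, r / R, hr', ?_⟩
    rw [hm.stepIntegral_eq K _ hx hr', abs_mul, abs_of_pos (zero_lt_one.trans_le hr'.1)]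
    have e : ∀ u, h ⌊x * R⁻¹⌋ (x * R⁻¹ + -(⌊x * R⁻¹⌋ : ℝ) + r / R * u) = b (x + r * u) := by
      intro u
      simp only [h]
      congr 1
      field_simp
      ring
    simp_rw [e]
    exact hlt.trans_le (le_mul_of_one_le_left (abs_nonneg _) hr'.1)
  have hvol : ∀ n : ℤ, volume ((fun x => x * R⁻¹) ⁻¹' ((fun x => x + (-(n : ℝ))) ⁻¹' E n)) ≤
      ENNReal.ofReal R * (ENNReal.ofReal (D ^ p) * ∫⁻ z in Ico (0 : ℝ) 8, F (z + n)) := by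
    intro n
    rw [Real.volume_preimage_mul_right (inv_pos.2 hR).ne', measure_preimage_add_right, inv_inv,
      abs_of_pos hR]
    exact mul_le_mul_right (hE n) _
  calc _ ≤ ∑' n : ℤ, volume ((fun x => x * R⁻¹) ⁻¹' ((fun x => x + (-(n : ℝ))) ⁻¹' E n)) :=
        (measure_mono hsub).trans (measure_iUnion_le _)
    _ ≤ ∑' n : ℤ, ENNReal.ofReal R *
          (ENNReal.ofReal (D ^ p) * ∫⁻ z in Ico (0 : ℝ) 8, F (z + n)) := ENNReal.tsum_le_tsum hvol
    _ = ENNReal.ofReal R * (ENNReal.ofReal (D ^ p) *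
          ∑' n : ℤ, ∫⁻ z in Ico (0 : ℝ) (8 : ℕ), F (z + n)) := by
        rw [ENNReal.tsum_mul_left, ENNReal.tsum_mul_left]
        norm_cast
    _ ≤ ENNReal.ofReal R * (ENNReal.ofReal (D ^ p) * ((8 : ℕ) * ∫⁻ z, F z)) := by
        gcongr
        exact tsum_lintegral_Ico_add_le hF 8
    _ = _ := by
        have e1 : (8 ^ (1 / p) * C₁ * 2 ^ (-(c₁ * i)) / lam) ^ p = 8 * D ^ p := by
          have : 8 ^ (1 / p) * C₁ * 2 ^ (-(c₁ * i)) / lam = 8 ^ (1 / p) * D := by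
            rw [hD]; ring
          rw [this, Real.mul_rpow (by positivity) hD0, ← Real.rpow_mul (by norm_num),
            one_div_mul_cancel hp.ne', Real.rpow_one]
        rw [e1, hFint, ENNReal.ofReal_mul (by norm_num)]
        have e2 : ENNReal.ofReal R * ENNReal.ofReal R⁻¹ = 1 := by
          rw [← ENNReal.ofReal_mul hR.le, mul_inv_cancel₀ hR.ne', ENNReal.ofReal_one]
        have e3 : ENNReal.ofReal 8 = ((8 : ℕ) : ENNReal) := by
          rw [← ENNReal.ofReal_natCast]; norm_num
        rw [e3]
        calc _ = (ENNReal.ofReal R * ENNReal.ofReal R⁻¹) *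
              ((8 : ℕ) * ENNReal.ofReal (D ^ p) * ∫⁻ z, ‖b z‖ₑ ^ p) := by ring
          _ = _ := by rw [e2, one_mul]

/-- Mass given to a cell by the finer levels of the cascade. -/
lemma setLIntegral_cell (hm : IsCascade κ m ε) (h0 : 0 ≤ κ) (h1 : κ ≤ 1) (n k q : ℕ) :
    ∫⁻ u in Ico (q / 2 ^ k : ℝ) ((q + 1) / 2 ^ k), ENNReal.ofReal (m (k + n) ⌊2 ^ (k + n) * u⌋₊) =
      ENNReal.ofReal (m k q / 2 ^ k) := by
  induction n generalizing k q with
  | zero =>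
    have h2 : (0 : ℝ) < 2 ^ k := by positivity
    have e1 : ∫⁻ u in Ico (q / 2 ^ k : ℝ) ((q + 1) / 2 ^ k),
        ENNReal.ofReal (m (k + 0) ⌊2 ^ (k + 0) * u⌋₊) =
        ∫⁻ _ in Ico (q / 2 ^ k : ℝ) ((q + 1) / 2 ^ k), ENNReal.ofReal (m k q) := by
      refine setLIntegral_congr_fun measurableSet_Ico fun u hu => ?_
      have : ⌊2 ^ k * u⌋₊ = q := by
        have hu0 : 0 ≤ 2 ^ k * u := mul_nonneg h2.le ((by positivity : (0 : ℝ) ≤ q / 2 ^ k).trans hu.1)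
        rw [Nat.floor_eq_iff hu0]
        have u1 := (div_le_iff₀ h2).1 hu.1
        have u2 := (lt_div_iff₀ h2).1 hu.2
        exact ⟨by linarith, by linarith⟩
      simp only [add_zero, this]
    rw [e1, setLIntegral_const, Real.volume_Ico, ← ENNReal.ofReal_mul (hm.nonneg h0 h1 k q)]
    congr 1
    field_simp
    ring
  | succ n ih =>
    have e2 := ih (k + 1) (2 * q)
    have e3 := ih (k + 1) (2 * q + 1)
    have e4 : Ico (q / 2 ^ k : ℝ) ((q + 1) / 2 ^ k) =
        Ico ((2 * q : ℕ) / 2 ^ (k + 1) : ℝ) (((2 * q : ℕ) + 1) / 2 ^ (k + 1)) ∪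
        Ico ((2 * q + 1 : ℕ) / 2 ^ (k + 1) : ℝ) (((2 * q + 1 : ℕ) + 1) / 2 ^ (k + 1)) := by
      have e5 : (((2 * q : ℕ) : ℝ) + 1) / 2 ^ (k + 1) = (2 * q + 1 : ℕ) / 2 ^ (k + 1) := by
        push_cast; rfl
      rw [e5, Ico_union_Ico_eq_Ico (by gcongr; simp) (by gcongr; linarith)]
      congr 1
      · push_cast; rw [pow_succ]; field_simp
      · push_cast; rw [pow_succ]; field_simp; ring
    rw [e4, lintegral_union measurableSet_Ico, show k + (n + 1) = k + 1 + n by ring, e2, e3,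
      ← ENNReal.ofReal_add (div_nonneg (hm.nonneg h0 h1 _ _) (by positivity))
        (div_nonneg (hm.nonneg h0 h1 _ _) (by positivity)), ← add_div, hm.children, pow_succ]
    · congr 1
      field_simp
    · rw [disjoint_left]
      intro z hz hz'
      have := hz.2
      have := hz'.1
      push_cast at *
      linarith

/-- The density of every level of the cascade has total mass `1`. -/
lemma lintegral_step (hm : IsCascade κ m ε) (h0 : 0 ≤ κ) (h1 : κ ≤ 1) (K : ℕ) :
    ∫⁻ u : ℝ, ENNReal.ofReal (m K ⌊2 ^ K * u⌋₊) = 1 := by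
  have e := hm.setLIntegral_cell h0 h1 K 0 1
  rw [zero_add, hm.zero] at e
  rw [← setLIntegral_eq_of_support_subset (s := Ico (1 : ℝ) 2)]
  · norm_num at e
    convert e using 3
  · intro u hu
    by_contra hne
    simp [hm.step_eq_zero K hne] at hu

end IsCascade

/-- The dyadic interval of length `2 ^ m` and index `q`. -/
def dyadicCell (m q : ℤ) : Set ℝ := Ico (q * 2 ^ m : ℝ) ((q + 1) * 2 ^ m)

lemma measurableSet_dyadicCell (m q : ℤ) : MeasurableSet (dyadicCell m q) := measurableSet_Ico

lemma mem_dyadicCell {m q : ℤ} {z : ℝ} : z ∈ dyadicCell m q ↔ ⌊z / 2 ^ m⌋ = q := by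
  have h2 : (0 : ℝ) < 2 ^ m := by positivity
  rw [Int.floor_eq_iff, le_div_iff₀ h2, div_lt_iff₀ h2]
  rfl

lemma volume_dyadicCell (m q : ℤ) : volume (dyadicCell m q) = ENNReal.ofReal (2 ^ m) := by
  unfold dyadicCell
  rw [Real.volume_Ico]
  congr 1
  ring

lemma floor_div_zpow_congr {x y : ℝ} {m n : ℤ} (h : ⌊x / 2 ^ m⌋ = ⌊y / 2 ^ m⌋) (hmn : m ≤ n) :
    ⌊x / 2 ^ n⌋ = ⌊y / 2 ^ n⌋ := by
  obtain ⟨k, rfl⟩ := Int.le.dest hmn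
  have e : ∀ z : ℝ, z / 2 ^ (m + k : ℤ) = z / 2 ^ m / ((2 ^ k : ℕ) : ℝ) := by
    intro z
    rw [zpow_add₀ (by norm_num), div_div]
    push_cast
    rw [zpow_natCast]
  rw [e, e, Int.floor_div_natCast, Int.floor_div_natCast, h]

/-- The dyadic interval with parameters `m`, `q` has `F`-average larger than `a`. -/
def Heavy (F : ℝ → ENNReal) (a : ENNReal) (m q : ℤ) : Prop :=
  a * ENNReal.ofReal (2 ^ m) < ∫⁻ z in dyadicCell m q, F z

/-- Union of the heavy dyadic intervals of length `2 ^ m` that are maximal. -/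
def stopSet (F : ℝ → ENNReal) (a : ENNReal) (m : ℤ) : Set ℝ :=
  {x | Heavy F a m ⌊x / 2 ^ m⌋ ∧ ∀ n > m, ¬ Heavy F a n ⌊x / 2 ^ n⌋}

section StoppingSets

variable {F : ℝ → ENNReal} {a : ENNReal}

lemma stopSet_congr {m : ℤ} {x y : ℝ} (h : ⌊x / 2 ^ m⌋ = ⌊y / 2 ^ m⌋) (hx : x ∈ stopSet F a m) :
    y ∈ stopSet F a m := by
  refine ⟨h ▸ hx.1, fun n hn => ?_⟩
  rw [← floor_div_zpow_congr h (le_of_lt hn)]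
  exact hx.2 n hn

lemma stopSet_eq_iUnion (m : ℤ) :
    stopSet F a m = ⋃ q : {q : ℤ // ∃ x ∈ stopSet F a m, ⌊x / 2 ^ m⌋ = q}, dyadicCell m q := by
  ext y
  simp only [mem_iUnion, mem_dyadicCell, Subtype.exists, exists_prop]
  constructor
  · intro hy
    exact ⟨_, ⟨y, hy, rfl⟩, rfl⟩
  · rintro ⟨q, ⟨x, hx, rfl⟩, h⟩
    exact stopSet_congr h.symm hx

lemma measurableSet_stopSet (m : ℤ) : MeasurableSet (stopSet F a m) := by
  rw [stopSet_eq_iUnion]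
  exact MeasurableSet.iUnion fun q => measurableSet_dyadicCell _ _

lemma pairwise_disjoint_dyadicCell (m : ℤ) :
    Pairwise (Function.onFun Disjoint (dyadicCell m)) := by
  intro q q' hqq'
  rw [Function.onFun, disjoint_left]
  intro z hz hz'
  exact hqq' ((mem_dyadicCell.1 hz).symm.trans (mem_dyadicCell.1 hz'))

lemma eq_of_mem_stopSet {m n : ℤ} {x : ℝ} (hm : x ∈ stopSet F a m) (hn : x ∈ stopSet F a n) :
    m = n := by
  rcases lt_trichotomy m n with h | h | h
  · exact absurd hn.1 (hm.2 n h)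
  · exact h
  · exact absurd hm.1 (hn.2 m h)

lemma mul_volume_stopSet_le (m : ℤ) :
    a * volume (stopSet F a m) ≤ ∫⁻ z in stopSet F a m, F z := by
  have hd : Pairwise (Function.onFun Disjoint
      fun q : {q : ℤ // ∃ x ∈ stopSet F a m, ⌊x / 2 ^ m⌋ = q} => dyadicCell m q) :=
    fun q q' h => pairwise_disjoint_dyadicCell m (fun h2 => h (Subtype.ext h2))
  rw [stopSet_eq_iUnion, measure_iUnion hd fun q => measurableSet_dyadicCell _ _,
    lintegral_iUnion (fun q => measurableSet_dyadicCell _ _) hd, ← ENNReal.tsum_mul_left]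
  refine ENNReal.tsum_le_tsum ?_
  rintro ⟨q, x, hx, rfl⟩
  rw [volume_dyadicCell]
  exact hx.1.le

lemma tsum_setLIntegral_stopSet_le :
    ∑' m : ℤ, ∫⁻ z in stopSet F a m, F z ≤ ∫⁻ z, F z := by
  rw [← lintegral_iUnion (fun m => measurableSet_stopSet m)]
  · exact setLIntegral_le_lintegral _ _
  · intro m n hmn
    rw [Function.onFun, disjoint_left]
    exact fun z hz hz' => hmn (eq_of_mem_stopSet hz hz')

lemma exists_mem_stopSet (hF : ∫⁻ z, F z ≠ ⊤) (ha0 : a ≠ 0) (ha : a ≠ ⊤) {m : ℤ} {x : ℝ}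
    (hx : Heavy F a m ⌊x / 2 ^ m⌋) : ∃ n, x ∈ stopSet F a n := by
  have hb : ∃ b : ℤ, ∀ n : ℤ, Heavy F a n ⌊x / 2 ^ n⌋ → n ≤ b := by
    obtain ⟨M, hM⟩ := pow_unbounded_of_one_lt ((∫⁻ z, F z) / a).toReal (one_lt_two (α := ℝ))
    refine ⟨M, fun n hn => ?_⟩
    by_contra hlt
    have h1 : (2 : ℝ) ^ M ≤ 2 ^ n := by
      rw [← zpow_natCast]
      exact zpow_le_zpow_right₀ (by norm_num) (by omega)
    have h2 : (∫⁻ z, F z) / a ≤ ENNReal.ofReal (2 ^ n) :=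
      ENNReal.le_ofReal_iff_toReal_le (ENNReal.div_ne_top hF ha0) (by positivity) |>.2
        (hM.le.trans h1)
    rw [ENNReal.div_le_iff ha0 ha, mul_comm] at h2
    exact absurd (hn.trans_le (setLIntegral_le_lintegral _ _)) (not_lt.2 h2)
  obtain ⟨n, hn, hmax⟩ := Int.exists_greatest_of_bdd hb ⟨m, hx⟩
  exact ⟨n, hn, fun k hk hk' => absurd (hmax k hk') (not_le.2 hk)⟩

/-- Points at distance comparable to `2 ^ m` from `stopSet F a m`. -/
def enlargedStopSet (F : ℝ → ENNReal) (a : ENNReal) (m : ℤ) : Set ℝ :=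
  ⋃ l ∈ Finset.Icc (-4 : ℤ) 4, (fun x => x + (l * 2 ^ m : ℝ)) ⁻¹' stopSet F a m

lemma volume_enlargedStopSet_le (m : ℤ) :
    volume (enlargedStopSet F a m) ≤ 9 * volume (stopSet F a m) := by
  refine (measure_biUnion_finset_le _ _).trans ?_
  simp only [measure_preimage_add_right, Finset.sum_const]
  simp

lemma notMem_stopSet_of_notMem_enlargedStopSet {m : ℤ} {x y : ℝ} (hx : x ∉ enlargedStopSet F a m)
    (h1 : x ≤ y) (h2 : y ≤ x + 2 * 2 ^ m) : y ∉ stopSet F a m := by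
  intro hy
  have h2m : (0 : ℝ) < 2 ^ m := by positivity
  have h3 : x / 2 ^ m ≤ y / 2 ^ m := by gcongr
  have h4 : y / 2 ^ m ≤ x / 2 ^ m + 2 := by
    rw [div_le_iff₀ h2m, add_mul, div_mul_cancel₀ _ h2m.ne']
    exact h2
  have h5 : ⌊x / 2 ^ m⌋ ≤ ⌊y / 2 ^ m⌋ := Int.floor_le_floor h3
  have h6 : ⌊y / 2 ^ m⌋ ≤ ⌊x / 2 ^ m⌋ + 2 := by
    have := Int.floor_le_floor h4
    rwa [Int.floor_add_ofNat] at this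
  refine hx (mem_iUnion₂.2 ⟨⌊y / 2 ^ m⌋ - ⌊x / 2 ^ m⌋, ?_, ?_⟩)
  · rw [Finset.mem_Icc]
    constructor <;> omega
  · rw [mem_preimage]
    refine stopSet_congr ?_ hy
    rw [add_div, mul_div_assoc, div_self h2m.ne', mul_one, Int.floor_add_intCast]
    ring

end StoppingSets

/-- Average of `f` over a dyadic interval. -/
noncomputable def cellAverage (f : ℝ → ℝ) (m q : ℤ) : ℝ := (∫ z in dyadicCell m q, f z) / 2 ^ m

/-- The part of `f` at scale `2 ^ m` in its Calderón-Zygmund decomposition. -/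
noncomputable def badPart (f : ℝ → ℝ) (F : ℝ → ENNReal) (a : ENNReal) (m : ℤ) : ℝ → ℝ :=
  (stopSet F a m).indicator fun z => f z - cellAverage f m ⌊z / 2 ^ m⌋

lemma measurable_badPart {f : ℝ → ℝ} (hf : Measurable f) (F : ℝ → ENNReal) (a : ENNReal) (m : ℤ) :
    Measurable (badPart f F a m) := by
  refine Measurable.indicator (hf.sub ?_) (measurableSet_stopSet m)
  exact (measurable_of_countable (cellAverage f m)).comp (Int.measurable_floor.comp (by fun_prop))

lemma setIntegral_badPart {f : ℝ → ℝ} (hf : Measurable f) {B : ℝ} (hB : ∀ z, |f z| ≤ B)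
    (F : ℝ → ENNReal) (a : ENNReal) (m q : ℤ) : ∫ z in dyadicCell m q, badPart f F a m z = 0 := by
  have h2m : (0 : ℝ) < 2 ^ m := by positivity
  by_cases hq : ∃ x ∈ stopSet F a m, ⌊x / 2 ^ m⌋ = q
  · obtain ⟨x, hx, hxq⟩ := hq
    have e : ∫ z in dyadicCell m q, badPart f F a m z =
        ∫ z in dyadicCell m q, (f z - cellAverage f m q) := by
      refine setIntegral_congr_fun (measurableSet_dyadicCell m q) fun z hz => ?_
      have hz' := mem_dyadicCell.1 hz
      simp only [badPart]
      rw [indicator_of_mem (stopSet_congr (hxq.trans hz'.symm) hx), hz']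
    have hfin : volume (dyadicCell m q) ≠ ⊤ := by
      rw [volume_dyadicCell]; exact ENNReal.ofReal_ne_top
    have hint : IntegrableOn f (dyadicCell m q) :=
      Measure.integrableOn_of_bounded hfin hf.aestronglyMeasurable
        (Filter.Eventually.of_forall fun z => hB z)
    rw [e, integral_sub hint (integrableOn_const hfin), setIntegral_const, measureReal_def,
      volume_dyadicCell, ENNReal.toReal_ofReal h2m.le, smul_eq_mul, cellAverage,
      mul_div_cancel₀ _ h2m.ne', sub_self]
  · rw [setIntegral_congr_fun (g := fun _ => (0 : ℝ)) (measurableSet_dyadicCell m q), integral_zero]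
    intro z hz
    simp only [badPart]
    rw [indicator_of_notMem]
    exact fun hz' => hq ⟨z, hz', mem_dyadicCell.1 hz⟩

section CalderonZygmund

variable {f : ℝ → ℝ} {p α B : ℝ}

lemma cellAverage_nonneg (h0 : ∀ z, 0 ≤ f z) (m q : ℤ) : 0 ≤ cellAverage f m q :=
  div_nonneg (integral_nonneg fun z => h0 z) (by positivity)

lemma le_of_forall_notMem_stopSet (hf : LowerSemicontinuous f) (hp : 0 < p) (hα : 0 < α)
    (hfin : ∫⁻ z, ENNReal.ofReal (f z ^ p) ≠ ⊤) {x : ℝ}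
    (hx : ∀ m, x ∉ stopSet (fun z => ENNReal.ofReal (f z ^ p)) (ENNReal.ofReal (α ^ p)) m) :
    f x ≤ α := by
  by_contra hlt
  obtain ⟨β, hαβ, hβ⟩ := exists_between (not_le.1 hlt)
  obtain ⟨δ, hδ, hball⟩ := Metric.eventually_nhds_iff.1 (hf x β hβ)
  obtain ⟨n, hn⟩ := exists_pow_lt_of_lt_one hδ (one_half_lt_one (α := ℝ))
  set m : ℤ := -(n : ℤ) with hm
  have h2m : (0 : ℝ) < 2 ^ m := by positivity
  have hmδ : (2 : ℝ) ^ m < δ := by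
    rw [hm, zpow_neg, zpow_natCast, ← inv_pow]
    simpa using hn
  have hcell : ∀ z ∈ dyadicCell m ⌊x / 2 ^ m⌋, β < f z := by
    intro z hz
    refine hball ?_
    have hx' : x ∈ dyadicCell m ⌊x / 2 ^ m⌋ := mem_dyadicCell.2 rfl
    rw [Real.dist_eq, abs_lt]
    have h1 := hz.1
    have h2 := hz.2
    have h3 := hx'.1
    have h4 := hx'.2
    rw [add_mul, one_mul] at h2 h4
    constructor <;> linarith
  have hheavy : Heavy (fun z => ENNReal.ofReal (f z ^ p)) (ENNReal.ofReal (α ^ p)) m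
      ⌊x / 2 ^ m⌋ := by
    unfold Heavy
    calc ENNReal.ofReal (α ^ p) * ENNReal.ofReal (2 ^ m)
        < ENNReal.ofReal (β ^ p) * ENNReal.ofReal (2 ^ m) := by
          refine ENNReal.mul_lt_mul_left (by simpa using h2m) ENNReal.ofReal_ne_top ?_
          exact (ENNReal.ofReal_lt_ofReal_iff (Real.rpow_pos_of_pos (hα.trans hαβ) _)).2
            (Real.rpow_lt_rpow hα.le hαβ hp)
      _ = ∫⁻ _ in dyadicCell m ⌊x / 2 ^ m⌋, ENNReal.ofReal (β ^ p) := by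
          rw [setLIntegral_const, volume_dyadicCell]
      _ ≤ _ := by
          refine setLIntegral_mono' (measurableSet_dyadicCell _ _) fun z hz => ?_
          exact ENNReal.ofReal_le_ofReal
            (Real.rpow_le_rpow (hα.trans hαβ).le (hcell z hz).le hp.le)
  obtain ⟨n, hn⟩ := exists_mem_stopSet hfin
    (by simpa using Real.rpow_pos_of_pos hα p) ENNReal.ofReal_ne_top hheavy
  exact hx n hn

lemma le_add_rpow (hα : 0 < α) (hp : 1 ≤ p) {y : ℝ} (hy : 0 ≤ y) :
    y ≤ α + α ^ (1 - p) * y ^ p := by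
  rcases le_or_gt y α with h | h
  · have : 0 ≤ α ^ (1 - p) * y ^ p := by positivity
    linarith
  · have hy' := hα.trans h
    have e1 : y ^ (1 - p) ≤ α ^ (1 - p) :=
      Real.rpow_le_rpow_of_nonpos hα h.le (by linarith)
    have e2 : y = y ^ (1 - p) * y ^ p := by
      rw [← Real.rpow_add hy']
      simp
    have e3 : y ^ (1 - p) * y ^ p ≤ α ^ (1 - p) * y ^ p := by gcongr
    linarith

lemma cellAverage_le (hf : Measurable f) (h0 : ∀ z, 0 ≤ f z) (hB : ∀ z, f z ≤ B) (hp : 1 ≤ p)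
    (hα : 0 < α) {m : ℤ} {x : ℝ}
    (hx : x ∈ stopSet (fun z => ENNReal.ofReal (f z ^ p)) (ENNReal.ofReal (α ^ p)) m) :
    cellAverage f m ⌊x / 2 ^ m⌋ ≤ 3 * α := by
  have h2m : (0 : ℝ) < 2 ^ m := by positivity
  have hp0 : 0 ≤ p := by linarith
  set D := dyadicCell m ⌊x / 2 ^ m⌋ with hD
  have hfin : volume D ≠ ⊤ := by
    rw [hD, volume_dyadicCell]; exact ENNReal.ofReal_ne_top
  have hint : IntegrableOn f D :=
    Measure.integrableOn_of_bounded hfin hf.aestronglyMeasurable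
      (Filter.Eventually.of_forall fun z => by
        rw [Real.norm_eq_abs, abs_of_nonneg (h0 z)]
        exact hB z)
  have hint' : IntegrableOn (fun z => f z ^ p) D :=
    Measure.integrableOn_of_bounded (M := B ^ p) hfin (hf.pow_const p).aestronglyMeasurable
      (Filter.Eventually.of_forall fun z => by
        rw [Real.norm_eq_abs, abs_of_nonneg (Real.rpow_nonneg (h0 z) _)]
        exact Real.rpow_le_rpow (h0 z) (hB z) hp0)
  have hDD : D ⊆ dyadicCell (m + 1) ⌊x / 2 ^ (m + 1)⌋ := by
    intro z hz
    exact mem_dyadicCell.2 (floor_div_zpow_congr (mem_dyadicCell.1 hz) (by omega))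
  have hFp : ∫ z in D, f z ^ p ≤ α ^ p * (2 * 2 ^ m) := by
    have h3 := not_lt.1 (hx.2 (m + 1) (by omega))
    have h4 : ENNReal.ofReal (∫ z in D, f z ^ p) ≤ ENNReal.ofReal (α ^ p * (2 * 2 ^ m)) := by
      rw [ofReal_integral_eq_lintegral_ofReal hint'
        (Filter.Eventually.of_forall fun z => Real.rpow_nonneg (h0 z) _)]
      refine (lintegral_mono_set hDD).trans (h3.trans (le_of_eq ?_))
      rw [← ENNReal.ofReal_mul (by positivity), zpow_add₀ (by norm_num), zpow_one, mul_comm 2]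
    exact (ENNReal.ofReal_le_ofReal_iff (by positivity)).1 h4
  have hconst : Integrable (fun _ : ℝ => α) (volume.restrict D) := integrableOn_const hfin
  have hmul : Integrable (fun z => α ^ (1 - p) * f z ^ p) (volume.restrict D) :=
    hint'.const_mul _
  have h5 : ∫ z in D, f z ≤ ∫ z in D, (α + α ^ (1 - p) * f z ^ p) :=
    integral_mono hint (hconst.add hmul)
      fun z => le_add_rpow hα hp (h0 z)
  rw [integral_add hconst hmul, integral_const_mul,
    setIntegral_const, measureReal_def, hD, volume_dyadicCell, ENNReal.toReal_ofReal h2m.le,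
    smul_eq_mul, ← hD] at h5
  have h6 : α ^ (1 - p) * ∫ z in D, f z ^ p ≤ α ^ (1 - p) * (α ^ p * (2 * 2 ^ m)) := by gcongr
  have h7 : α ^ (1 - p) * α ^ p = α := by
    rw [← Real.rpow_add hα]; simp
  rw [← mul_assoc, h7] at h6
  rw [cellAverage, div_le_iff₀ h2m]
  linarith

lemma lintegral_badPart_le (hf : Measurable f) (h0 : ∀ z, 0 ≤ f z) (hB : ∀ z, f z ≤ B)
    (hp : 1 ≤ p) (hα : 0 < α) (m : ℤ) :
    ∫⁻ z, ‖badPart f (fun z => ENNReal.ofReal (f z ^ p)) (ENNReal.ofReal (α ^ p)) m z‖ₑ ^ p ≤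
      ENNReal.ofReal (1 + 3 ^ p) *
        ∫⁻ z in stopSet (fun z => ENNReal.ofReal (f z ^ p)) (ENNReal.ofReal (α ^ p)) m,
          ENNReal.ofReal (f z ^ p) := by
  have hp0 : 0 < p := by linarith
  set F : ℝ → ENNReal := fun z => ENNReal.ofReal (f z ^ p) with hF
  set a : ENNReal := ENNReal.ofReal (α ^ p) with ha
  have hpt : ∀ z, ‖badPart f F a m z‖ₑ ^ p ≤
      (stopSet F a m).indicator (fun z => F z + ENNReal.ofReal (3 ^ p) * a) z := by
    intro z
    by_cases hz : z ∈ stopSet F a m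
    · rw [badPart, indicator_of_mem hz, indicator_of_mem hz, Real.enorm_eq_ofReal_abs,
        ENNReal.ofReal_rpow_of_nonneg (abs_nonneg _) hp0.le, hF, ha,
        ← ENNReal.ofReal_mul (by positivity),
        ← ENNReal.ofReal_add (Real.rpow_nonneg (h0 z) _) (by positivity)]
      refine ENNReal.ofReal_le_ofReal ?_
      rw [← Real.mul_rpow (by norm_num) hα.le]
      have e1 := cellAverage_nonneg h0 m ⌊z / 2 ^ m⌋
      have e2 := cellAverage_le hf h0 hB hp hα hz
      have e3 : 0 ≤ f z ^ p := Real.rpow_nonneg (h0 z) _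
      have e4 : 0 ≤ (3 * α) ^ p := by positivity
      rcases le_total (f z) (cellAverage f m ⌊z / 2 ^ m⌋) with h | h
      · have : |f z - cellAverage f m ⌊z / 2 ^ m⌋| ^ p ≤ (3 * α) ^ p := by
          refine Real.rpow_le_rpow (abs_nonneg _) ?_ hp0.le
          rw [abs_of_nonpos (by linarith)]
          linarith [h0 z]
        linarith
      · have : |f z - cellAverage f m ⌊z / 2 ^ m⌋| ^ p ≤ f z ^ p := by
          refine Real.rpow_le_rpow (abs_nonneg _) ?_ hp0.le
          rw [abs_of_nonneg (by linarith)]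
          linarith
        linarith
    · rw [badPart, indicator_of_notMem hz, indicator_of_notMem hz, enorm_zero,
        ENNReal.zero_rpow_of_pos hp0]
  have hFm : Measurable F := (hf.pow_const p).ennreal_ofReal
  calc ∫⁻ z, ‖badPart f F a m z‖ₑ ^ p
      ≤ ∫⁻ z, (stopSet F a m).indicator (fun z => F z + ENNReal.ofReal (3 ^ p) * a) z :=
        lintegral_mono hpt
    _ = (∫⁻ z in stopSet F a m, F z) + ENNReal.ofReal (3 ^ p) * (a * volume (stopSet F a m)) := by
        rw [lintegral_indicator (measurableSet_stopSet m), lintegral_add_left hFm,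
          setLIntegral_const, mul_assoc]
    _ ≤ (∫⁻ z in stopSet F a m, F z) +
          ENNReal.ofReal (3 ^ p) * ∫⁻ z in stopSet F a m, F z := by
        gcongr
        exact mul_volume_stopSet_le m
    _ = _ := by
        rw [ENNReal.ofReal_add one_pos.le (by positivity), ENNReal.ofReal_one, add_mul, one_mul]

lemma sum_badPart_eq_zero (f : ℝ → ℝ) (F : ℝ → ENNReal) (a : ENNReal) {j : ℤ} {n : ℕ} {z : ℝ}
    (h : ∀ i < n, z ∉ stopSet F a (j - i)) :
    ∑ i ∈ Finset.range n, badPart f F a (j - i) z = 0 :=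
  Finset.sum_eq_zero fun i hi => indicator_of_notMem (h i (Finset.mem_range.1 hi)) _

lemma sum_badPart_eq (f : ℝ → ℝ) (F : ℝ → ENNReal) (a : ENNReal) {j : ℤ} {n i : ℕ} {z : ℝ}
    (hi : i < n) (hz : z ∈ stopSet F a (j - i)) :
    ∑ i ∈ Finset.range n, badPart f F a (j - i) z =
      f z - cellAverage f (j - i) ⌊z / 2 ^ (j - i)⌋ := by
  rw [Finset.sum_eq_single i]
  · exact indicator_of_mem hz _
  · intro k _ hki
    refine indicator_of_notMem (fun hk => hki ?_) _
    have := eq_of_mem_stopSet hz hk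
    omega
  · exact fun h => absurd (Finset.mem_range.2 hi) h

/-- Removing finitely many scales of the bad part leaves a bounded nonnegative function. -/
lemma sub_sum_badPart_mem (hf : Measurable f) (h0 : ∀ z, 0 ≤ f z) (hB : ∀ z, f z ≤ B)
    (hp : 1 ≤ p) (hα : 0 < α) (j : ℤ) (n : ℕ) (z : ℝ) :
    f z - ∑ i ∈ Finset.range n, badPart f (fun z => ENNReal.ofReal (f z ^ p))
      (ENNReal.ofReal (α ^ p)) (j - i) z ∈ Icc 0 (B + 3 * α) := by
  by_cases h : ∃ i < n, z ∈ stopSet (fun z => ENNReal.ofReal (f z ^ p)) (ENNReal.ofReal (α ^ p))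
      (j - i)
  · obtain ⟨i, hi, hz⟩ := h
    rw [sum_badPart_eq f _ _ hi hz, sub_sub_cancel]
    have := cellAverage_le hf h0 hB hp hα hz
    exact ⟨cellAverage_nonneg h0 _ _, by linarith [h0 z, hB z]⟩
  · rw [sum_badPart_eq_zero f _ _ fun i hi hz => h ⟨i, hi, hz⟩, sub_zero]
    exact ⟨h0 z, by linarith [hB z]⟩

/-- Away from the stopping intervals of large scale, removing all the small scales of the bad part
leaves a function bounded by `3 * α`. -/
lemma exists_eventually_sub_sum_badPart_eq (hf : LowerSemicontinuous f) (h0 : ∀ z, 0 ≤ f z)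
    (hB : ∀ z, f z ≤ B) (hp : 1 ≤ p) (hα : 0 < α) (hfin : ∫⁻ z, ENNReal.ofReal (f z ^ p) ≠ ⊤)
    {j : ℤ} {z : ℝ} (hz : ∀ m > j, z ∉ stopSet (fun z => ENNReal.ofReal (f z ^ p))
      (ENNReal.ofReal (α ^ p)) m) :
    ∃ y ∈ Icc 0 (3 * α), ∀ᶠ n in Filter.atTop,
      f z - ∑ i ∈ Finset.range n, badPart f (fun z => ENNReal.ofReal (f z ^ p))
        (ENNReal.ofReal (α ^ p)) (j - i) z = y := by
  by_cases h : ∃ i : ℕ, z ∈ stopSet (fun z => ENNReal.ofReal (f z ^ p)) (ENNReal.ofReal (α ^ p))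
      (j - i)
  · obtain ⟨i, hi⟩ := h
    refine ⟨_, ⟨cellAverage_nonneg h0 _ _, cellAverage_le hf.measurable h0 hB hp hα hi⟩, ?_⟩
    filter_upwards [Filter.eventually_gt_atTop i] with n hn
    rw [sum_badPart_eq f _ _ hn hi, sub_sub_cancel]
  · refine ⟨f z, ⟨h0 z, ?_⟩, Filter.Eventually.of_forall fun n => ?_⟩
    · refine (le_of_forall_notMem_stopSet hf (by linarith) hα hfin fun m => ?_).trans
        (by linarith)
      rcases lt_or_ge j m with hm | hm
      · exact hz m hm
      · obtain ⟨k, hk⟩ := Int.le.dest hm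
        intro hzm
        exact h ⟨k, by rwa [show j - (k : ℤ) = m by omega]⟩
    · rw [sum_badPart_eq_zero f _ _ fun i _ hi => h ⟨i, hi⟩, sub_zero]

end CalderonZygmund

/-- Weak type inequality with exponential decay for averages, with respect to the weight `w`, of
functions that have mean zero on a fine grid. -/
def MeanZeroBound (w : ℝ → ℝ) (p C c : ℝ) : Prop :=
  ∀ (i : ℕ) (R : ℝ), 0 < R → ∀ b : ℝ → ℝ, Measurable b → MemLp b (ENNReal.ofReal p) →
    (∀ q : ℤ, ∫ z in Ico (q * (R / 2 ^ i) : ℝ) ((q + 1) * (R / 2 ^ i)), b z = 0) →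
    ∀ lam : ℝ, 0 < lam → volume {x : ℝ | ∃ r ∈ Icc R (2 * R),
        lam < |∫ u, b (x + r * u) * w u|} ≤
      ENNReal.ofReal ((C * 2 ^ (-(c * i)) / lam) ^ p) * ∫⁻ z, ‖b z‖ₑ ^ p

section weakType

variable {f w : ℝ → ℝ} {p α B : ℝ}

lemma average_le_of_abs_average_badPart_le (hf : LowerSemicontinuous f) (h0 : ∀ z, 0 ≤ f z)
    (hB : ∀ z, f z ≤ B) (hp : 1 ≤ p) (hα : 0 < α) (hfin : ∫⁻ z, ENNReal.ofReal (f z ^ p) ≠ ⊤)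
    (hw0 : ∀ u, 0 ≤ w u) (hws : ∀ u ∉ Ico (1 : ℝ) 2, w u = 0) (hwi : Integrable w)
    (hw1 : ∫ u, w u = 1) {x r ρ : ℝ} {j : ℤ} (hr : r ∈ Icc (2 ^ j : ℝ) (2 * 2 ^ j)) (hρ : 0 ≤ ρ)
    (hx : ∀ m, x ∉ enlargedStopSet (fun z => ENNReal.ofReal (f z ^ p)) (ENNReal.ofReal (α ^ p)) m)
    (hbad : ∀ i : ℕ, |∫ u, badPart f (fun z => ENNReal.ofReal (f z ^ p)) (ENNReal.ofReal (α ^ p))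
      (j - i) (x + r * u) * w u| ≤ α * ((1 - ρ) * ρ ^ i)) :
    ∫ u, f (x + r * u) * w u ≤ 4 * α := by
  set F : ℝ → ENNReal := fun z => ENNReal.ofReal (f z ^ p) with hF
  set a : ENNReal := ENNReal.ofReal (α ^ p) with ha
  have hfm := hf.measurable
  have h2j : (0 : ℝ) < 2 ^ j := by positivity
  have hr0 : 0 < r := h2j.trans_le hr.1
  have hwm := hwi.aestronglyMeasurable
  have hmeas : ∀ g : ℝ → ℝ, Measurable g → AEStronglyMeasurable (fun u => g (x + r * u)) volume :=
    fun g hg => (hg.comp (by fun_prop)).aestronglyMeasurable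
  let T : ℕ → ℝ → ℝ := fun n z => f z - ∑ i ∈ Finset.range n, badPart f F a (j - i) z
  have hTm : ∀ n, Measurable (T n) := fun n =>
    hfm.sub (Finset.measurable_fun_sum _ fun i _ => measurable_badPart hfm F a _)
  have hT : ∀ n z, T n z ∈ Icc 0 (B + 3 * α) := sub_sum_badPart_mem hfm h0 hB hp hα j
  have hintb : ∀ g : ℝ → ℝ, Measurable g → ∀ M, (∀ z, |g z| ≤ M) →
      Integrable (fun u => g (x + r * u) * w u) := fun g hg M hM =>
    hwi.bdd_mul (hmeas g hg) (Filter.Eventually.of_forall fun u => hM _)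
  have hTint : ∀ n, Integrable (fun u => T n (x + r * u) * w u) := fun n =>
    hintb (T n) (hTm n) (B + 3 * α) fun z => abs_le.2 ⟨by linarith [(hT n z).1, (hT n z).2],
      (hT n z).2⟩
  have hfint : Integrable (fun u => f (x + r * u) * w u) :=
    hintb f hfm B fun z => abs_le.2 ⟨by linarith [h0 z, hB z], hB z⟩
  have hbint : ∀ i : ℕ, Integrable (fun u => badPart f F a (j - i) (x + r * u) * w u) := by
    intro i
    refine hintb _ (measurable_badPart hfm F a _) (B + 3 * α) fun z => ?_
    by_cases hz : z ∈ stopSet F a (j - i)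
    · rw [badPart, indicator_of_mem hz]
      have h1 := cellAverage_nonneg h0 (j - i) ⌊z / 2 ^ (j - (i : ℤ))⌋
      have h2 := cellAverage_le hfm h0 hB hp hα hz
      exact abs_le.2 ⟨by linarith [h0 z, hB z], by linarith [h0 z, hB z]⟩
    · rw [badPart, indicator_of_notMem hz, abs_zero]
      linarith [h0 z, hB z]
  have hlim : ∀ u, ∃ y ∈ Icc 0 (3 * α), ∀ᶠ n in Filter.atTop,
      T n (x + r * u) * w u = y * w u := by
    intro u
    by_cases hu : u ∈ Ico (1 : ℝ) 2
    · obtain ⟨y, hy, hev⟩ := exists_eventually_sub_sum_badPart_eq (z := x + r * u) (j := j) hf h0 hB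
        hp hα hfin (by
          intro m hm
          have hu1 : r * 0 ≤ r * u := mul_le_mul_of_nonneg_left (by linarith [hu.1]) hr0.le
          have hu2 : r * u ≤ r * 2 := mul_le_mul_of_nonneg_left hu.2.le hr0.le
          have h3 : (2 : ℝ) ^ (j + 1) ≤ 2 ^ m := zpow_le_zpow_right₀ (by norm_num) (by omega)
          rw [zpow_add₀ (by norm_num), zpow_one] at h3
          refine notMem_stopSet_of_notMem_enlargedStopSet (hx m) ?_ ?_
          · linarith
          · linarith [hr.2])
      refine ⟨y, hy, ?_⟩
      filter_upwards [hev] with n hn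
      rw [← hn]
    · refine ⟨0, ⟨le_rfl, by positivity⟩, Filter.Eventually.of_forall fun n => ?_⟩
      rw [hws u hu, mul_zero, mul_zero]
  choose y hy hev using hlim
  have htend : Filter.Tendsto (fun n => ∫ u, T n (x + r * u) * w u) Filter.atTop
      (nhds (∫ u, y u * w u)) := by
    refine tendsto_integral_of_dominated_convergence (fun u => (B + 3 * α) * w u)
      (fun n => (hTint n).aestronglyMeasurable) (hwi.const_mul _)
      (fun n => Filter.Eventually.of_forall fun u => ?_)
      (Filter.Eventually.of_forall fun u => tendsto_nhds_of_eventually_eq (hev u))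
    rw [Real.norm_eq_abs, abs_of_nonneg (mul_nonneg (hT n _).1 (hw0 u))]
    exact mul_le_mul_of_nonneg_right (hT n _).2 (hw0 u)
  have hy3 : ∫ u, y u * w u ≤ 3 * α := by
    calc ∫ u, y u * w u ≤ ∫ u, 3 * α * w u :=
          integral_mono_of_nonneg (Filter.Eventually.of_forall fun u =>
            mul_nonneg (hy u).1 (hw0 u)) (hwi.const_mul _)
            (Filter.Eventually.of_forall fun u => mul_le_mul_of_nonneg_right (hy u).2 (hw0 u))
      _ = 3 * α := by rw [integral_const_mul, hw1, mul_one]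
  have hge : ∀ n, (∫ u, f (x + r * u) * w u) - α ≤ ∫ u, T n (x + r * u) * w u := by
    intro n
    have e1 : ∫ u, T n (x + r * u) * w u = (∫ u, f (x + r * u) * w u) -
        ∑ i ∈ Finset.range n, ∫ u, badPart f F a (j - i) (x + r * u) * w u := by
      rw [← integral_finsetSum _ fun i _ => hbint i, ← integral_sub hfint
        (integrable_finsetSum _ fun i _ => hbint i)]
      refine integral_congr_ae (Filter.Eventually.of_forall fun u => ?_)
      simp only [T, sub_mul, Finset.sum_mul]
    have e2 := (abs_le.1 (abs_sum_le_of_geometric hα.le hρ fun i (_ : i < n) => hbad i)).2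
    rw [e1]
    linarith
  linarith [ge_of_tendsto' htend hge]

lemma memLp_badPart (hfm : Measurable f) (h0 : ∀ z, 0 ≤ f z) (hB : ∀ z, f z ≤ B) (hp : 1 ≤ p)
    (hα : 0 < α) (hfin : ∫⁻ z, ENNReal.ofReal (f z ^ p) ≠ ⊤) (m : ℤ) :
    MemLp (badPart f (fun z => ENNReal.ofReal (f z ^ p)) (ENNReal.ofReal (α ^ p)) m)
      (ENNReal.ofReal p) := by
  have hp0 : 0 < p := by linarith
  refine ⟨(measurable_badPart hfm _ _ m).aestronglyMeasurable, ?_⟩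
  rw [eLpNorm_lt_top_iff_lintegral_rpow_enorm_lt_top (by simpa using hp0) ENNReal.ofReal_ne_top,
    ENNReal.toReal_ofReal hp0.le]
  refine (lintegral_badPart_le hfm h0 hB hp hα m).trans_lt (ENNReal.mul_lt_top
    ENNReal.ofReal_lt_top ?_)
  exact (setLIntegral_le_lintegral _ _).trans_lt hfin.lt_top

/-- Calderón-Zygmund theory: a weak type inequality for the full maximal operator. -/
lemma volume_average_le (hf : LowerSemicontinuous f) (h0 : ∀ z, 0 ≤ f z)
    (hB : ∀ z, f z ≤ B) (hp : 1 ≤ p) (hα : 0 < α) (hfin : ∫⁻ z, ENNReal.ofReal (f z ^ p) ≠ ⊤)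
    (hw0 : ∀ u, 0 ≤ w u) (hws : ∀ u ∉ Ico (1 : ℝ) 2, w u = 0) (hwi : Integrable w)
    (hw1 : ∫ u, w u = 1) {C c ρ : ℝ} (hC : 0 < C) (hc : 0 < c) (hρ : ρ = 2 ^ (-(c / 2)))
    (hmz : MeanZeroBound w p C c) :
    ENNReal.ofReal (α ^ p) * volume {x : ℝ | ∃ r > 0, 4 * α < ∫ u, f (x + r * u) * w u} ≤
      ENNReal.ofReal (9 + (C / (1 - ρ)) ^ p * (1 + 3 ^ p) / (1 - ρ ^ p)) *
        ∫⁻ z, ENNReal.ofReal (f z ^ p) := by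
  have hp0 : 0 < p := by linarith
  set F : ℝ → ENNReal := fun z => ENNReal.ofReal (f z ^ p) with hF
  set a : ENNReal := ENNReal.ofReal (α ^ p) with ha
  have hfm := hf.measurable
  have hρ0 : 0 < ρ := by rw [hρ]; positivity
  have hρ1 : ρ < 1 := by
    rw [hρ]
    exact Real.rpow_lt_one_of_one_lt_of_neg (by norm_num) (by linarith)
  have hρp0 : 0 < ρ ^ p := by positivity
  have hρp : ρ ^ p < 1 := Real.rpow_lt_one hρ0.le hρ1 hp0
  have h1ρ : 0 < 1 - ρ := by linarith
  have h1ρp : 0 < 1 - ρ ^ p := by linarith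
  let L : ℕ → ℝ := fun i => α * ((1 - ρ) * ρ ^ i)
  have hL : ∀ i, 0 < L i := fun i => by positivity
  let E : ℤ → ℕ → Set ℝ := fun j i => {x | ∃ r ∈ Icc (2 ^ j : ℝ) (2 * 2 ^ j),
    L i < |∫ u, badPart f F a (j - i) (x + r * u) * w u|}
  let X : ℤ → ENNReal := fun m => ∫⁻ z in stopSet F a m, F z
  have hE : ∀ j i, a * volume (E j i) ≤
      ENNReal.ofReal ((C / (1 - ρ)) ^ p * (1 + 3 ^ p) * (ρ ^ p) ^ i) * X (j - i) := by
    intro j i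
    have e0 : (2 : ℝ) ^ j / 2 ^ i = 2 ^ (j - i : ℤ) := by
      rw [zpow_sub₀ (by norm_num), zpow_natCast]
    have h1 := hmz i (2 ^ j) (by positivity) _ (measurable_badPart hfm F a (j - i))
      (memLp_badPart hfm h0 hB hp hα hfin (j - i)) (by
        intro q
        rw [e0]
        refine setIntegral_badPart hfm (B := B) (fun z => ?_) F a (j - i) q
        rw [abs_of_nonneg (h0 z)]
        exact hB z) (L i) (hL i)
    have e1 : C * 2 ^ (-(c * i)) / L i = C / (1 - ρ) * ρ ^ i / α := by
      have : (2 : ℝ) ^ (-(c * i)) = ρ ^ i * ρ ^ i := by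
        rw [hρ, ← Real.rpow_natCast, ← Real.rpow_mul (by norm_num), ← Real.rpow_add (by norm_num)]
        congr 1
        ring
      rw [this]
      simp only [L]
      field_simp
    have e2 : α ^ p * (C * 2 ^ (-(c * i)) / L i) ^ p = (C / (1 - ρ)) ^ p * (ρ ^ p) ^ i := by
      rw [e1, ← Real.mul_rpow hα.le (by positivity), mul_div_cancel₀ _ hα.ne',
        Real.mul_rpow (by positivity) (by positivity), ← Real.rpow_natCast, ← Real.rpow_natCast,
        ← Real.rpow_mul hρ0.le, ← Real.rpow_mul hρ0.le, mul_comm p]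
    calc a * volume (E j i)
        ≤ a * (ENNReal.ofReal ((C * 2 ^ (-(c * i)) / L i) ^ p) *
            (ENNReal.ofReal (1 + 3 ^ p) * X (j - i))) := by
          refine mul_le_mul_right (h1.trans (mul_le_mul_right ?_ _)) _
          exact lintegral_badPart_le hfm h0 hB hp hα _
      _ = ENNReal.ofReal (α ^ p * (C * 2 ^ (-(c * i)) / L i) ^ p * (1 + 3 ^ p)) * X (j - i) := by
          rw [ENNReal.ofReal_mul (mul_nonneg (by positivity) (Real.rpow_nonneg
            (div_nonneg (by positivity) (hL i).le) _)), ENNReal.ofReal_mul (by positivity), ha]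
          ring
      _ = _ := by rw [e2]; congr 2; ring
  have hsub : {x : ℝ | ∃ r > 0, 4 * α < ∫ u, f (x + r * u) * w u} ⊆
      (⋃ m, enlargedStopSet F a m) ∪ ⋃ j, ⋃ i, E j i := by
    rintro x ⟨r, hr, hlt⟩
    by_contra hx
    simp only [mem_union, mem_iUnion, not_or, not_exists] at hx
    obtain ⟨j, hj1, hj2⟩ := exists_mem_Ico_zpow (y := (2 : ℝ)) hr (by norm_num)
    have hrj : r ∈ Icc (2 ^ j : ℝ) (2 * 2 ^ j) := by
      refine ⟨hj1, ?_⟩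
      rw [zpow_add₀ (by norm_num), zpow_one] at hj2
      linarith
    refine absurd hlt (not_lt.2 (average_le_of_abs_average_badPart_le hf h0 hB hp hα hfin hw0 hws
      hwi hw1 hrj hρ0.le hx.1 fun i => ?_))
    by_contra hi
    exact hx.2 j i ⟨r, hrj, not_le.1 hi⟩
  have hX : ∑' m, X m ≤ ∫⁻ z, F z := tsum_setLIntegral_stopSet_le
  have hfirst : a * volume (⋃ m, enlargedStopSet F a m) ≤ ENNReal.ofReal 9 * ∫⁻ z, F z := by
    calc a * volume (⋃ m, enlargedStopSet F a m)
        ≤ a * ∑' m, volume (enlargedStopSet F a m) := by gcongr; exact measure_iUnion_le _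
      _ = ∑' m, a * volume (enlargedStopSet F a m) := ENNReal.tsum_mul_left.symm
      _ ≤ ∑' m, 9 * X m := by
          refine ENNReal.tsum_le_tsum fun m => ?_
          calc a * volume (enlargedStopSet F a m) ≤ a * (9 * volume (stopSet F a m)) := by
                gcongr; exact volume_enlargedStopSet_le m
            _ = 9 * (a * volume (stopSet F a m)) := by ring
            _ ≤ 9 * X m := by gcongr; exact mul_volume_stopSet_le m
      _ = 9 * ∑' m, X m := ENNReal.tsum_mul_left
      _ ≤ 9 * ∫⁻ z, F z := by gcongr
      _ = _ := by norm_num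
  have hgeom : ∑' i : ℕ, ENNReal.ofReal ((C / (1 - ρ)) ^ p * (1 + 3 ^ p) * (ρ ^ p) ^ i) =
      ENNReal.ofReal ((C / (1 - ρ)) ^ p * (1 + 3 ^ p) / (1 - ρ ^ p)) := by
    rw [← ENNReal.ofReal_tsum_of_nonneg (fun i => by positivity)
      ((summable_geometric_of_lt_one hρp0.le hρp).mul_left _), tsum_mul_left,
      tsum_geometric_of_lt_one hρp0.le hρp, ← div_eq_mul_inv]
  have hsecond : a * volume (⋃ j, ⋃ i, E j i) ≤
      ENNReal.ofReal ((C / (1 - ρ)) ^ p * (1 + 3 ^ p) / (1 - ρ ^ p)) * ∫⁻ z, F z := by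
    calc a * volume (⋃ j, ⋃ i, E j i) ≤ a * ∑' j, ∑' i, volume (E j i) := by
          gcongr
          exact (measure_iUnion_le _).trans (ENNReal.tsum_le_tsum fun j => measure_iUnion_le _)
      _ = ∑' j, ∑' i, a * volume (E j i) := by
          rw [← ENNReal.tsum_mul_left]
          simp_rw [← ENNReal.tsum_mul_left]
      _ ≤ ∑' j : ℤ, ∑' i : ℕ,
          ENNReal.ofReal ((C / (1 - ρ)) ^ p * (1 + 3 ^ p) * (ρ ^ p) ^ i) * X (j - i) :=
          ENNReal.tsum_le_tsum fun j => ENNReal.tsum_le_tsum fun i => hE j i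
      _ = ∑' i : ℕ, ENNReal.ofReal ((C / (1 - ρ)) ^ p * (1 + 3 ^ p) * (ρ ^ p) ^ i) *
            ∑' m, X m := by
          rw [ENNReal.tsum_comm]
          refine tsum_congr fun i => ?_
          rw [ENNReal.tsum_mul_left, ← (Equiv.subRight (i : ℤ)).tsum_eq X]
          rfl
      _ ≤ _ := by
          rw [ENNReal.tsum_mul_right, hgeom]
          gcongr
  calc _ ≤ a * (volume (⋃ m, enlargedStopSet F a m) + volume (⋃ j, ⋃ i, E j i)) := by
        gcongr
        exact (measure_mono hsub).trans (measure_union_le _ _)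
    _ ≤ _ := by
        rw [mul_add, ENNReal.ofReal_add (by norm_num) (by positivity), add_mul]
        exact add_le_add hfirst hsecond

end weakType

/-- The measure whose density is the `K`-th step function of the weights `m`. -/
noncomputable def stepMeasure (m : ℕ → ℕ → ℝ) (K : ℕ) : Measure ℝ :=
  volume.withDensity fun u => ENNReal.ofReal (m K ⌊2 ^ K * u⌋₊)

lemma mem_Ico_floor_two_pow (k : ℕ) {u : ℝ} (hu : 0 ≤ u) :
    u ∈ Ico ((⌊2 ^ k * u⌋₊ : ℝ) / 2 ^ k) ((⌊2 ^ k * u⌋₊ + 1) / 2 ^ k) := by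
  have h2 : (0 : ℝ) < 2 ^ k := by positivity
  constructor
  · rw [div_le_iff₀' h2]
    exact Nat.floor_le (by positivity)
  · rw [lt_div_iff₀' h2]
    exact Nat.lt_floor_add_one _

namespace IsCascade

variable {κ : ℝ} {m ε : ℕ → ℕ → ℝ}

lemma isProbabilityMeasure_stepMeasure (hm : IsCascade κ m ε) (h0 : 0 ≤ κ) (h1 : κ ≤ 1) (K : ℕ) :
    IsProbabilityMeasure (stepMeasure m K) :=
  ⟨by rw [stepMeasure, withDensity_apply _ MeasurableSet.univ, Measure.restrict_univ,
    hm.lintegral_step h0 h1 K]⟩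

lemma stepMeasure_eq_zero (hm : IsCascade κ m ε) (K : ℕ) {s : Set ℝ} (hs : MeasurableSet s)
    (hd : Disjoint s (Ico 1 2)) : stepMeasure m K s = 0 := by
  rw [stepMeasure, withDensity_apply _ hs, setLIntegral_congr_fun (g := fun _ => 0) hs]
  · simp
  · intro u hu
    simp [hm.step_eq_zero K (disjoint_left.1 hd hu)]

lemma stepMeasure_cell (hm : IsCascade κ m ε) (h0 : 0 ≤ κ) (h1 : κ ≤ 1) {k K : ℕ} (hk : k ≤ K)
    (q : ℕ) : stepMeasure m K (Ico (q / 2 ^ k : ℝ) ((q + 1) / 2 ^ k)) =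
      ENNReal.ofReal (m k q / 2 ^ k) := by
  obtain ⟨n, rfl⟩ := Nat.exists_eq_add_of_le hk
  rw [stepMeasure, withDensity_apply _ measurableSet_Ico, hm.setLIntegral_cell h0 h1]

lemma exists_limit_stepMeasure (hm : IsCascade κ m ε) (h0 : 0 ≤ κ) (h1 : κ ≤ 1) :
    ∃ (ν : Measure ℝ) (φ : ℕ → ℕ), IsProbabilityMeasure ν ∧ StrictMono φ ∧
      (∀ G, IsOpen G → ν G ≤ Filter.atTop.liminf fun n => stepMeasure m (φ n) G) ∧
      (∀ F, IsClosed F → (Filter.atTop.limsup fun n => stepMeasure m (φ n) F) ≤ ν F) := by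
  let μ : ℕ → ProbabilityMeasure ℝ := fun K =>
    ⟨stepMeasure m K, hm.isProbabilityMeasure_stepMeasure h0 h1 K⟩
  have htight : IsTightMeasureSet {((P : ProbabilityMeasure ℝ) : Measure ℝ) | P ∈ range μ} := by
    rw [isTightMeasureSet_iff_exists_isCompact_measure_compl_le]
    intro δ _
    refine ⟨Icc 1 2, isCompact_Icc, ?_⟩
    rintro _ ⟨_, ⟨K, rfl⟩, rfl⟩
    have : stepMeasure m K (Icc 1 2)ᶜ = 0 := by
      refine hm.stepMeasure_eq_zero K measurableSet_Icc.compl ?_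
      exact disjoint_compl_left.mono_right Ico_subset_Icc_self
    change stepMeasure m K (Icc 1 2)ᶜ ≤ δ
    rw [this]
    exact bot_le
  obtain ⟨ν, -, φ, hφ, hlim⟩ := (isCompact_closure_of_isTightMeasureSet htight).tendsto_subseq
    (fun K => subset_closure (mem_range_self K))
  exact ⟨ν, φ, inferInstance, hφ,
    fun G hG => ProbabilityMeasure.le_liminf_measure_open_of_tendsto hlim hG,
    fun F hF => ProbabilityMeasure.limsup_measure_closed_le_of_tendsto hlim hF⟩

lemma stepMeasure_ball_le (hm : IsCascade κ m ε) (h0 : 0 ≤ κ) (h1 : κ ≤ 1) {k K : ℕ} (hk : k ≤ K)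
    {x r : ℝ} (hr : r ≤ 2 * (1 / 2 ^ k)) :
    stepMeasure m K (Ioo (x - 2 * r) (x + 2 * r)) ≤ ENNReal.ofReal (9 * (1 / 2 ^ k) ^ (1 - κ)) := by
  have h2 : (0 : ℝ) < 2 ^ k := by positivity
  set a := ⌊2 ^ k * (x - 2 * r)⌋₊ with ha
  have hsub : Ioo (x - 2 * r) (x + 2 * r) ⊆ Iio 1 ∪ ⋃ q ∈ Finset.Icc a (a + 8),
      Ico (q / 2 ^ k : ℝ) ((q + 1) / 2 ^ k) := by
    intro u hu
    by_cases hu1 : u < 1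
    · exact Or.inl hu1
    push Not at hu1
    have hu0 : 0 ≤ 2 ^ k * u := by positivity
    refine Or.inr (mem_iUnion₂.2 ⟨⌊2 ^ k * u⌋₊, ?_, ?_⟩)
    · rw [Finset.mem_Icc]
      refine ⟨Nat.floor_mono (mul_le_mul_of_nonneg_left hu.1.le h2.le), ?_⟩
      have e1 : 2 ^ k * (4 * r) ≤ 8 := by
        calc 2 ^ k * (4 * r) ≤ 2 ^ k * (4 * (2 * (1 / 2 ^ k))) := by gcongr
          _ = 8 := by field_simp; norm_num
      have e2 : 2 ^ k * u < 2 ^ k * (x - 2 * r) + 8 := by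
        have := mul_lt_mul_of_pos_left hu.2 h2
        calc 2 ^ k * u < 2 ^ k * (x + 2 * r) := this
          _ = 2 ^ k * (x - 2 * r) + 2 ^ k * (4 * r) := by ring
          _ ≤ _ := by linarith
      have e3 := Nat.lt_floor_add_one (2 ^ k * (x - 2 * r))
      rw [← ha] at e3
      have e4 : 2 ^ k * u < ((a + 9 : ℕ) : ℝ) := by push_cast; linarith
      have := (Nat.floor_lt hu0).2 e4
      omega
    · exact mem_Ico_floor_two_pow k (by linarith)
  have hcell : ∀ q : ℕ, stepMeasure m K (Ico (q / 2 ^ k : ℝ) ((q + 1) / 2 ^ k)) ≤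
      ENNReal.ofReal ((1 / 2 ^ k) ^ (1 - κ)) := by
    intro q
    rw [hm.stepMeasure_cell h0 h1 hk]
    refine ENNReal.ofReal_le_ofReal ?_
    rw [Real.rpow_sub (by positivity), Real.rpow_one, div_le_div_iff₀ h2 (by positivity)]
    have e1 := hm.le_rpow h0 h1 k q
    have e2 : ((1 : ℝ) / 2 ^ k) ^ κ * 2 ^ (κ * k) = 1 := by
      rw [one_div, Real.inv_rpow h2.le, mul_comm κ, Real.rpow_mul (by norm_num), Real.rpow_natCast]
      exact inv_mul_cancel₀ (by positivity)
    calc m k q * (1 / 2 ^ k) ^ κ ≤ 2 ^ (κ * k) * (1 / 2 ^ k) ^ κ := by gcongr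
      _ = 1 := by rw [mul_comm, e2]
      _ = 1 / 2 ^ k * 2 ^ k := by field_simp
  calc stepMeasure m K (Ioo (x - 2 * r) (x + 2 * r))
      ≤ stepMeasure m K (Iio 1) + stepMeasure m K (⋃ q ∈ Finset.Icc a (a + 8),
          Ico (q / 2 ^ k : ℝ) ((q + 1) / 2 ^ k)) :=
        (measure_mono hsub).trans (measure_union_le _ _)
    _ ≤ 0 + ∑ q ∈ Finset.Icc a (a + 8), stepMeasure m K (Ico (q / 2 ^ k : ℝ) ((q + 1) / 2 ^ k)) := by
        refine add_le_add (le_of_eq ?_) (measure_biUnion_finset_le _ _)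
        refine hm.stepMeasure_eq_zero K measurableSet_Iio (disjoint_left.2 fun u hu hu' => ?_)
        exact absurd hu'.1 (not_le.2 hu)
    _ ≤ ∑ q ∈ Finset.Icc a (a + 8), ENNReal.ofReal ((1 / 2 ^ k) ^ (1 - κ)) := by
        rw [zero_add]
        exact Finset.sum_le_sum fun q _ => hcell q
    _ = ENNReal.ofReal (9 * (1 / 2 ^ k) ^ (1 - κ)) := by
        rw [Finset.sum_const, Nat.card_Icc, show a + 8 + 1 - a = 9 by omega, nsmul_eq_mul,
          ENNReal.ofReal_mul (by norm_num)]
        norm_num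

lemma le_stepMeasure_Icc (hm : IsCascade κ m ε) (h0 : 0 ≤ κ) (h1 : κ ≤ 1) {k K : ℕ} (hk : k ≤ K)
    {x r : ℝ} (hr : 2 * (1 / 2 ^ k) ≤ r) (hpos : 0 < stepMeasure m K (Metric.ball x (r / 2))) :
    ENNReal.ofReal (2 ^ (κ * k) / 2 / 2 ^ k) ≤ stepMeasure m K (Icc (x - r) (x + r)) := by
  have h2 : (0 : ℝ) < 2 ^ k := by positivity
  have hex : ∃ u ∈ Metric.ball x (r / 2) ∩ Ico 1 2,
      m k ⌊2 ^ k * u⌋₊ ≠ 0 := by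
    by_contra! hno
    have hcover : Metric.ball x (r / 2) ⊆ (Ico 1 2)ᶜ ∪
        ⋃ q : {q : ℕ // m k q = 0}, Ico (q / 2 ^ k : ℝ) ((q + 1) / 2 ^ k) := by
      intro u hu
      by_cases hu1 : u ∈ Ico (1 : ℝ) 2
      · refine Or.inr (mem_iUnion.2 ⟨⟨⌊2 ^ k * u⌋₊, hno u ⟨hu, hu1⟩⟩, ?_⟩)
        exact mem_Ico_floor_two_pow k (by linarith [hu1.1])
      · exact Or.inl hu1
    refine hpos.ne' (measure_mono_null hcover (measure_union_null ?_ (measure_iUnion_null ?_)))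
    · exact hm.stepMeasure_eq_zero K measurableSet_Ico.compl disjoint_compl_left
    · rintro ⟨q, hq⟩
      simp only
      rw [hm.stepMeasure_cell h0 h1 hk, hq]
      simp
  obtain ⟨u, ⟨hu, hu1⟩, hne⟩ := hex
  rw [Metric.mem_ball, Real.dist_eq, abs_lt] at hu
  have hsub : Ico (⌊2 ^ k * u⌋₊ / 2 ^ k : ℝ) ((⌊2 ^ k * u⌋₊ + 1) / 2 ^ k) ⊆
      Icc (x - r) (x + r) := by
    have e1 : u - 1 / 2 ^ k ≤ ⌊2 ^ k * u⌋₊ / 2 ^ k := by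
      rw [le_div_iff₀ h2, sub_mul, one_div, inv_mul_cancel₀ h2.ne', mul_comm u]
      exact (sub_lt_iff_lt_add.2 (Nat.lt_floor_add_one _)).le
    have e2 : (⌊2 ^ k * u⌋₊ + 1) / 2 ^ k ≤ u + 1 / 2 ^ k := by
      rw [add_div]
      linarith [(mem_Ico_floor_two_pow k (u := u) (by linarith [hu1.1])).1]
    intro v hv
    exact ⟨by linarith [hv.1], by linarith [hv.2]⟩
  refine le_trans ?_ (measure_mono hsub)
  rw [hm.stepMeasure_cell h0 h1 hk, (hm.eq_zero_or h0 h1 k _).resolve_left hne]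
  refine ENNReal.ofReal_le_ofReal (div_le_div_of_nonneg_right ?_ h2.le)
  linarith [le_two_pow_halvings κ k]

end IsCascade

lemma isClosed_msupport (ν : Measure ℝ) : IsClosed (msupport ν) := by
  rw [← isOpen_compl_iff, Metric.isOpen_iff]
  intro x hx
  simp only [msupport, mem_compl_iff, mem_ofPred_eq, not_forall, not_lt, nonpos_iff_eq_zero] at hx
  obtain ⟨δ, hδ, h0⟩ := hx
  refine ⟨δ / 2, half_pos hδ, fun y hy hy' => ?_⟩
  refine (hy' (δ / 2) (half_pos hδ)).ne' (measure_mono_null ?_ h0)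
  refine Metric.ball_subset_ball' ?_
  rw [Metric.mem_ball] at hy
  linarith

namespace IsCascade

variable {κ : ℝ} {m ε : ℕ → ℕ → ℝ} {ν : Measure ℝ} {φ : ℕ → ℕ}

lemma msupport_limit_subset (hm : IsCascade κ m ε)
    (hopen : ∀ G, IsOpen G → ν G ≤ Filter.atTop.liminf fun n => stepMeasure m (φ n) G) :
    msupport ν ⊆ Icc 1 2 := by
  intro x hx
  by_contra hne
  obtain ⟨δ, hδ, hsub⟩ := Metric.isOpen_iff.1 isClosed_Icc.isOpen_compl x hne
  refine (hx δ hδ).ne' (le_antisymm ((hopen _ Metric.isOpen_ball).trans ?_) bot_le)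
  have h0 : ∀ n, stepMeasure m (φ n) (Metric.ball x δ) = 0 := fun n =>
    hm.stepMeasure_eq_zero _ measurableSet_ball
      ((disjoint_compl_left.mono_right Ico_subset_Icc_self).mono_left hsub)
  simp [h0]

lemma isAhlforsRegular_limit (hm : IsCascade κ m ε) (h0 : 0 ≤ κ) (h1 : κ ≤ 1)
    (hφ : StrictMono φ)
    (hopen : ∀ G, IsOpen G → ν G ≤ Filter.atTop.liminf fun n => stepMeasure m (φ n) G)
    (hclosed : ∀ F, IsClosed F → (Filter.atTop.limsup fun n => stepMeasure m (φ n) F) ≤ ν F) :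
    IsAhlforsRegular ν (1 - κ) := by
  refine ⟨9, by norm_num, fun x hx r hr hr1 => ?_⟩
  have hs0 : 0 ≤ 1 - κ := by linarith
  obtain ⟨k, hk1, hk2⟩ := exists_nat_pow_near_of_lt_one hr hr1
    (by norm_num : (0 : ℝ) < 1 / 2) (by norm_num)
  have hlarge : ∀ j : ℕ, ∀ᶠ n in Filter.atTop, j ≤ φ n := fun j =>
    hφ.tendsto_atTop.eventually_ge_atTop j
  have e1 : (1 : ℝ) / 2 ^ (k + 1) = (1 / 2) ^ (k + 1) := by rw [one_div_pow]
  have e2 : (1 : ℝ) / 2 ^ (k + 2) = (1 / 2) ^ (k + 1) / 2 := by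
    rw [one_div_pow, pow_succ 2 (k + 1)]
    field_simp
  constructor
  · have hk : 2 * (1 / 2 ^ (k + 2)) ≤ r := by rw [e2]; linarith
    have hr4 : r / 4 ≤ 1 / 2 ^ (k + 2) := by
      rw [e2, pow_succ]
      linarith
    refine le_trans ?_ (hclosed _ isClosed_Icc)
    have hpos : ∀ᶠ n in Filter.atTop, 0 < stepMeasure m (φ n) (Metric.ball x (r / 2)) :=
      Filter.eventually_lt_of_lt_liminf
        ((hx (r / 2) (half_pos hr)).trans_le (hopen _ Metric.isOpen_ball))
    refine Filter.le_limsup_of_frequently_le' (Filter.Eventually.frequently ?_)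
    filter_upwards [hpos, hlarge (k + 2)] with n hn hn'
    refine le_trans (ENNReal.ofReal_le_ofReal ?_) (hm.le_stepMeasure_Icc h0 h1 hn' hk hn)
    have e3 : (2 : ℝ) ^ (κ * (k + 2 : ℕ)) / 2 / 2 ^ (k + 2) = (1 / 2 ^ (k + 2)) ^ (1 - κ) / 2 := by
      rw [one_div, Real.inv_rpow (by positivity), ← Real.rpow_natCast, ← Real.rpow_mul (by norm_num),
        ← Real.rpow_neg (by norm_num), div_right_comm, ← Real.rpow_sub (by norm_num)]
      congr 2
      ring
    rw [e3]
    have e4 : (4 : ℝ) ^ (1 - κ) ≤ 4 := by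
      calc (4 : ℝ) ^ (1 - κ) ≤ 4 ^ (1 : ℝ) :=
            Real.rpow_le_rpow_of_exponent_le (by norm_num) (by linarith)
        _ = 4 := Real.rpow_one 4
    have hrs : 0 ≤ r ^ (1 - κ) := by positivity
    calc (9 : ℝ)⁻¹ * r ^ (1 - κ) ≤ r ^ (1 - κ) / 4 / 2 := by linarith
      _ ≤ r ^ (1 - κ) / 4 ^ (1 - κ) / 2 := by gcongr
      _ = (r / 4) ^ (1 - κ) / 2 := by rw [Real.div_rpow hr.le (by norm_num)]
      _ ≤ (1 / 2 ^ (k + 2)) ^ (1 - κ) / 2 := by gcongr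
  · have hk : r ≤ 2 * (1 / 2 ^ (k + 1)) := by
      rw [e1, pow_succ]
      linarith
    calc ν (Icc (x - r) (x + r)) ≤ ν (Ioo (x - 2 * r) (x + 2 * r)) :=
          measure_mono (Icc_subset_Ioo (by linarith) (by linarith))
      _ ≤ Filter.atTop.liminf fun n => stepMeasure m (φ n) (Ioo (x - 2 * r) (x + 2 * r)) :=
          hopen _ isOpen_Ioo
      _ ≤ ENNReal.ofReal (9 * (1 / 2 ^ (k + 1)) ^ (1 - κ)) := by
          refine Filter.liminf_le_of_frequently_le' (Filter.Eventually.frequently ?_)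
          filter_upwards [hlarge (k + 1)] with n hn
          exact hm.stepMeasure_ball_le h0 h1 hn hk
      _ ≤ ENNReal.ofReal (9 * r ^ (1 - κ)) := by
          refine ENNReal.ofReal_le_ofReal ?_
          have : (1 : ℝ) / 2 ^ (k + 1) ≤ r := by rw [e1]; exact hk1.le
          gcongr

end IsCascade

/-- The weak type `(p, p)` inequality for the unrestricted maximal operator of `ν`. -/
def WeakTypeBound (ν : Measure ℝ) (p D : ℝ) : Prop :=
  ∀ F : ℝ → ENNReal, Measurable F → ∀ α : ℝ, 0 < α →
    ENNReal.ofReal (α ^ p) *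
      volume {x : ℝ | ∃ r > 0, ENNReal.ofReal (4 * α) < ∫⁻ y, F (x + r * y) ∂ν} ≤
    ENNReal.ofReal D * ∫⁻ z, F z ^ p

lemma lintegral_le_liminf_of_lowerSemicontinuous {ν : Measure ℝ} {μ : ℕ → Measure ℝ}
    {f : ℝ → ℝ} (hf : LowerSemicontinuous f) (h0 : ∀ x, 0 ≤ f x)
    (hopen : ∀ G, IsOpen G → ν G ≤ Filter.atTop.liminf fun n => μ n G) :
    ∫⁻ x, ENNReal.ofReal (f x) ∂ν ≤
      Filter.atTop.liminf fun n => ∫⁻ x, ENNReal.ofReal (f x) ∂(μ n) := by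
  simp_rw [lintegral_eq_lintegral_meas_lt _ (Filter.Eventually.of_forall h0)
    hf.measurable.aemeasurable]
  calc ∫⁻ t in Ioi (0 : ℝ), ν {a | t < f a}
      ≤ ∫⁻ t in Ioi (0 : ℝ), Filter.atTop.liminf (fun n => (μ n) {a | t < f a}) :=
        lintegral_mono fun t => hopen _ (hf.isOpen_preimage t)
    _ ≤ Filter.atTop.liminf (fun n => ∫⁻ t in Ioi (0 : ℝ), (μ n) {a | t < f a}) :=
        lintegral_liminf_le fun n => Antitone.measurable fun s t hst =>
          measure_mono fun ω hω => lt_of_le_of_lt hst hω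

lemma volume_iUnion_iInter_le {E : ℕ → Set ℝ} {a c : ENNReal} (h : ∀ n, a * volume (E n) ≤ c) :
    a * volume (⋃ N, ⋂ n ∈ Ici N, E n) ≤ c := by
  have hmono : Monotone fun N => ⋂ n ∈ Ici N, E n := fun M N hMN =>
    biInter_subset_biInter_left (Ici_subset_Ici.2 hMN)
  rw [hmono.measure_iUnion, ENNReal.mul_iSup]
  refine iSup_le fun N => (mul_le_mul_right ?_ a).trans (h N)
  exact measure_mono (biInter_subset_of_mem (mem_Ici.2 le_rfl))

namespace IsCascade

variable {κ : ℝ} {m ε : ℕ → ℕ → ℝ} {ν : Measure ℝ} {φ : ℕ → ℕ}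

lemma integrable_step (hm : IsCascade κ m ε) (h0 : 0 ≤ κ) (h1 : κ ≤ 1) (K : ℕ) :
    Integrable fun u : ℝ => m K ⌊2 ^ K * u⌋₊ := by
  refine ⟨((measurable_of_countable (m K)).comp
    (Nat.measurable_floor.comp (measurable_const_mul _))).aestronglyMeasurable, ?_⟩
  rw [hasFiniteIntegral_iff_ofReal (Filter.Eventually.of_forall fun u => hm.nonneg h0 h1 K _),
    hm.lintegral_step h0 h1 K]
  exact ENNReal.one_lt_top

lemma integral_step (hm : IsCascade κ m ε) (h0 : 0 ≤ κ) (h1 : κ ≤ 1) (K : ℕ) :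
    ∫ u : ℝ, m K ⌊2 ^ K * u⌋₊ = 1 := by
  rw [integral_eq_lintegral_of_nonneg_ae (Filter.Eventually.of_forall fun u => hm.nonneg h0 h1 K _)
    (hm.integrable_step h0 h1 K).aestronglyMeasurable, hm.lintegral_step h0 h1 K, ENNReal.toReal_one]

lemma lintegral_stepMeasure (hm : IsCascade κ m ε) (h0 : 0 ≤ κ) (h1 : κ ≤ 1) (K : ℕ)
    {g : ℝ → ℝ} {B : ℝ} (hg : Measurable g) (hg0 : ∀ u, 0 ≤ g u) (hgB : ∀ u, g u ≤ B) :
    ∫⁻ u, ENNReal.ofReal (g u) ∂(stepMeasure m K) =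
      ENNReal.ofReal (∫ u, g u * m K ⌊2 ^ K * u⌋₊) := by
  have hi := hm.integrable_step h0 h1 K
  have hwm : Measurable fun u : ℝ => m K ⌊2 ^ K * u⌋₊ := (measurable_of_countable (m K)).comp
    (Nat.measurable_floor.comp (measurable_const_mul _))
  rw [stepMeasure, lintegral_withDensity_eq_lintegral_mul _ hwm.ennreal_ofReal hg.ennreal_ofReal,
    ofReal_integral_eq_lintegral_ofReal]
  · refine lintegral_congr fun u => ?_
    rw [Pi.mul_apply, mul_comm, ENNReal.ofReal_mul (hg0 u)]
  · refine hi.bdd_mul (c := B) hg.aestronglyMeasurable (Filter.Eventually.of_forall fun u => ?_)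
    rw [Real.norm_eq_abs, abs_of_nonneg (hg0 u)]
    exact hgB u
  · exact Filter.Eventually.of_forall fun u => mul_nonneg (hg0 u) (hm.nonneg h0 h1 K _)

lemma volume_average_limit_le (hm : IsCascade κ m ε) (h0 : 0 ≤ κ) (h1 : κ ≤ 1)
    (hopen : ∀ G, IsOpen G → ν G ≤ Filter.atTop.liminf fun n => stepMeasure m (φ n) G)
    {f : ℝ → ℝ} {B α : ℝ} {a c : ENNReal} (hf : LowerSemicontinuous f) (hf0 : ∀ z, 0 ≤ f z)
    (hfB : ∀ z, f z ≤ B) (hα : 0 < α)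
    (hK : ∀ K, a * volume {x : ℝ | ∃ r > 0, 4 * α < ∫ u, f (x + r * u) * m K ⌊2 ^ K * u⌋₊} ≤ c) :
    a * volume {x : ℝ | ∃ r > 0, ENNReal.ofReal (4 * α) <
      ∫⁻ y, ENNReal.ofReal (f (x + r * y)) ∂ν} ≤ c := by
  refine le_trans (mul_le_mul_right (measure_mono ?_) a)
    (volume_iUnion_iInter_le fun n => hK (φ n))
  rintro x ⟨r, hr, hx⟩
  have hcont : Continuous fun y : ℝ => x + r * y := by fun_prop
  have hlsc : LowerSemicontinuous fun y => f (x + r * y) := hf.comp hcont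
  have hlim := lintegral_le_liminf_of_lowerSemicontinuous hlsc (fun y => hf0 _) hopen
  obtain ⟨N, hN⟩ := Filter.eventually_atTop.1
    (Filter.eventually_lt_of_lt_liminf (hx.trans_le hlim))
  refine mem_iUnion.2 ⟨N, mem_iInter₂.2 fun n hn => ⟨r, hr, ?_⟩⟩
  have h := hN n hn
  rw [hm.lintegral_stepMeasure h0 h1 _ hlsc.measurable (fun y => hf0 _) (fun y => hfB _)] at h
  exact (ENNReal.ofReal_lt_ofReal_iff_of_nonneg (by positivity)).1 h

lemma weakTypeBound_limit (hm : IsCascade κ m ε) (h0 : 0 ≤ κ) (h1 : κ ≤ 1)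
    (hopen : ∀ G, IsOpen G → ν G ≤ Filter.atTop.liminf fun n => stepMeasure m (φ n) G)
    {p C c : ℝ} (hp : 1 ≤ p) (hC : 0 < C) (hc : 0 < c)
    (hmz : ∀ K, MeanZeroBound (fun u => m K ⌊2 ^ K * u⌋₊) p C c) :
    ∃ D, 0 < D ∧ WeakTypeBound ν p D := by
  have hp0 : 0 < p := by linarith
  obtain ⟨ρ, hρ⟩ : ∃ ρ : ℝ, ρ = 2 ^ (-(c / 2)) := ⟨_, rfl⟩
  have hρ0 : 0 < ρ := by rw [hρ]; positivity
  have hρ1 : ρ < 1 := by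
    rw [hρ]
    exact Real.rpow_lt_one_of_one_lt_of_neg (by norm_num) (by linarith)
  have hρp : ρ ^ p < 1 := Real.rpow_lt_one hρ0.le hρ1 hp0
  have h1ρ : 0 < 1 - ρ := by linarith
  have h1ρp : 0 < 1 - ρ ^ p := by linarith
  obtain ⟨D, hD⟩ : ∃ D : ℝ, D = 9 + (C / (1 - ρ)) ^ p * (1 + 3 ^ p) / (1 - ρ ^ p) := ⟨_, rfl⟩
  have hD0 : 0 < D := by rw [hD]; positivity
  refine ⟨D, hD0, fun F hF α hα => ?_⟩
  refine ENNReal.le_of_forall_pos_le_add fun δ hδ _ => ?_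
  have hDE : ENNReal.ofReal D ≠ 0 := (ENNReal.ofReal_pos.2 hD0).ne'
  obtain ⟨g, hFg, hg, hgi⟩ := exists_le_lowerSemicontinuous_lintegral_ge (μ := volume)
    (fun z => F z ^ p) (hF.pow_const p) (ε := δ / ENNReal.ofReal D)
    (ENNReal.div_pos (by exact_mod_cast hδ.ne') ENNReal.ofReal_ne_top).ne'
  let G : ℝ → ENNReal := fun z => g z ^ (1 / p)
  have hFG : ∀ z, F z ≤ G z := by
    intro z
    calc F z = (F z ^ p) ^ (1 / p) := by
          rw [← ENNReal.rpow_mul, mul_one_div_cancel hp0.ne', ENNReal.rpow_one]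
      _ ≤ G z := ENNReal.rpow_le_rpow (hFg z) (by positivity)
  have hG : Measurable G := hg.measurable.pow_const _
  let f : ℕ → ℝ → ℝ := fun n z => (min (G z) n).toReal
  have hfE : ∀ n z, ENNReal.ofReal (f n z) = min (G z) n := fun n z =>
    ENNReal.ofReal_toReal (ne_top_of_le_ne_top (ENNReal.natCast_ne_top n) (min_le_right _ _))
  have hflsc : ∀ n, LowerSemicontinuous (f n) := by
    intro n
    have hne : ∀ t : ENNReal, min (t ^ (1 / p)) (n : ENNReal) ≠ ⊤ := fun t =>
      ne_top_of_le_ne_top (ENNReal.natCast_ne_top n) (min_le_right _ _)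
    have hct : Continuous fun t : ENNReal => (min (t ^ (1 / p)) (n : ENNReal)).toReal :=
      ENNReal.continuousOn_toReal.comp_continuous
        (ENNReal.continuous_rpow_const.min continuous_const) hne
    refine hct.comp_lowerSemicontinuous hg fun t u htu => ?_
    exact ENNReal.toReal_mono (hne u)
      (min_le_min_right _ (ENNReal.rpow_le_rpow htu (by positivity)))
  have hfi : ∀ n, ENNReal.ofReal D * ∫⁻ z, ENNReal.ofReal (f n z ^ p) ≤
      ENNReal.ofReal D * (∫⁻ z, F z ^ p) + δ := by
    intro n
    calc ENNReal.ofReal D * ∫⁻ z, ENNReal.ofReal (f n z ^ p)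
        ≤ ENNReal.ofReal D * ∫⁻ z, g z := by
          refine mul_le_mul_right (lintegral_mono fun z => ?_) _
          rw [← ENNReal.ofReal_rpow_of_nonneg ENNReal.toReal_nonneg hp0.le, hfE]
          calc min (G z) n ^ p ≤ G z ^ p := ENNReal.rpow_le_rpow (min_le_left _ _) hp0.le
            _ = g z := by
              simp only [G]
              rw [← ENNReal.rpow_mul, one_div_mul_cancel hp0.ne', ENNReal.rpow_one]
      _ ≤ ENNReal.ofReal D * ((∫⁻ z, F z ^ p) + δ / ENNReal.ofReal D) := mul_le_mul_right hgi _
      _ = _ := by rw [mul_add, ENNReal.mul_div_cancel hDE ENNReal.ofReal_ne_top]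
  by_cases htop : ENNReal.ofReal D * (∫⁻ z, F z ^ p) + δ = ⊤
  · rw [htop]
    exact le_top
  have hweak : ∀ n, ENNReal.ofReal (α ^ p) * volume {x : ℝ | ∃ r > 0, ENNReal.ofReal (4 * α) <
      ∫⁻ y, ENNReal.ofReal (f n (x + r * y)) ∂ν} ≤ ENNReal.ofReal D * (∫⁻ z, F z ^ p) + δ := by
    intro n
    have hB : ∀ z, f n z ≤ n := fun z => by
      have := ENNReal.toReal_mono (ENNReal.natCast_ne_top n) (min_le_right (G z) n)
      simpa using this
    refine hm.volume_average_limit_le h0 h1 hopen (hflsc n) (fun z => ENNReal.toReal_nonneg)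
      hB hα fun K => le_trans ?_ (hfi n)
    have hfin : ∫⁻ z, ENNReal.ofReal (f n z ^ p) ≠ ⊤ := by
      intro htop'
      have := hfi n
      rw [htop', ENNReal.mul_top hDE, top_le_iff] at this
      exact htop this
    rw [hD]
    exact volume_average_le (hflsc n) (fun z => ENNReal.toReal_nonneg) hB hp hα hfin
      (fun u => hm.nonneg h0 h1 K _) (fun u hu => hm.step_eq_zero K hu) (hm.integrable_step h0 h1 K)
      (hm.integral_step h0 h1 K) hC hc hρ (hmz K)
  refine le_trans (mul_le_mul_right (measure_mono ?_) _) (volume_iUnion_iInter_le hweak)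
  rintro x ⟨r, hr, hx⟩
  have hmonof : Monotone fun (n : ℕ) (y : ℝ) => ENNReal.ofReal (f n (x + r * y)) := by
    intro n k hnk y
    simp only [hfE]
    exact min_le_min_left _ (by exact_mod_cast hnk)
  have hsup : ∫⁻ y, G (x + r * y) ∂ν = ⨆ n : ℕ, ∫⁻ y, ENNReal.ofReal (f n (x + r * y)) ∂ν := by
    rw [← lintegral_iSup _ hmonof]
    · refine lintegral_congr fun y => ?_
      simp only [hfE]
      rw [← inf_iSup_eq, ENNReal.iSup_natCast, inf_top_eq]
    · intro n
      exact ((hflsc n).measurable.comp (by fun_prop)).ennreal_ofReal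
  have hlt := hx.trans_le (lintegral_mono fun y => hFG (x + r * y))
  rw [hsup, lt_iSup_iff] at hlt
  obtain ⟨N, hN⟩ := hlt
  refine mem_iUnion.2 ⟨N, mem_iInter₂.2 fun n hn => ⟨r, hr, hN.trans_le ?_⟩⟩
  exact lintegral_mono (hmonof hn)

end IsCascade

lemma exists_lt_lintegral_of_lt_unrestrictedMax {ν : Measure ℝ} {f : ℝ → ℝ} {x t : ℝ}
    (ht : 0 ≤ t) (hx : t < unrestrictedMax ν f x) :
    ∃ r > 0, ENNReal.ofReal t < ∫⁻ y, ENNReal.ofReal |f (x + r * y)| ∂ν := by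
  have : Nonempty (Ioi (0 : ℝ)) := ⟨⟨1, mem_Ioi.2 one_pos⟩⟩
  obtain ⟨⟨r, hr⟩, hlt⟩ := exists_lt_of_lt_ciSup hx
  refine ⟨r, hr, ?_⟩
  have hpos : 0 < ∫ y, |f (x + r * y)| ∂ν := ht.trans_lt hlt
  have hint : Integrable (fun y => |f (x + r * y)|) ν := by
    by_contra hne
    rw [integral_undef hne] at hpos
    exact lt_irrefl _ hpos
  rw [← ofReal_integral_eq_lintegral_ofReal hint (Filter.Eventually.of_forall fun y => abs_nonneg _)]
  exact (ENNReal.ofReal_lt_ofReal_iff hpos).2 hlt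

lemma unrestrictedMax_nonneg (ν : Measure ℝ) (f : ℝ → ℝ) (x : ℝ) : 0 ≤ unrestrictedMax ν f x :=
  Real.iSup_nonneg fun _ => integral_nonneg fun _ => abs_nonneg _

namespace WeakTypeBound

variable {ν : Measure ℝ} [IsProbabilityMeasure ν] {p₁ p D : ℝ} {f : ℝ → ℝ}

lemma volume_lt_unrestrictedMax_le (hw : WeakTypeBound ν p₁ D) (hp₁ : 0 < p₁) (hf : Measurable f)
    {t : ℝ} (ht : 0 < t) :
    ENNReal.ofReal ((t / 8) ^ p₁) * volume {x | t < unrestrictedMax ν f x} ≤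
      ENNReal.ofReal D * (volume.withDensity fun z => ENNReal.ofReal (|f z| ^ p₁))
        {z | t < 2 * |f z|} := by
  have hset : MeasurableSet {z | t < 2 * |f z|} :=
    measurableSet_lt measurable_const (hf.abs.const_mul 2)
  let F : ℝ → ENNReal := {z | t < 2 * |f z|}.indicator fun z => ENNReal.ofReal |f z|
  have hF : Measurable F := hf.abs.ennreal_ofReal.indicator hset
  have hFp : ∫⁻ z, F z ^ p₁ =
      (volume.withDensity fun z => ENNReal.ofReal (|f z| ^ p₁)) {z | t < 2 * |f z|} := by
    rw [withDensity_apply _ hset, ← lintegral_indicator hset]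
    refine lintegral_congr fun z => ?_
    by_cases hz : z ∈ {z | t < 2 * |f z|}
    · simp only [F, indicator_of_mem hz]
      rw [ENNReal.ofReal_rpow_of_nonneg (abs_nonneg _) hp₁.le]
    · simp only [F, indicator_of_notMem hz]
      exact ENNReal.zero_rpow_of_pos hp₁
  rw [← hFp]
  refine le_trans (mul_le_mul_right (measure_mono ?_) _) (hw F hF (t / 8) (by positivity))
  intro x hx
  obtain ⟨r, hr, hlt⟩ := exists_lt_lintegral_of_lt_unrestrictedMax ht.le hx
  refine ⟨r, hr, ?_⟩
  have hle : ∀ z, ENNReal.ofReal |f z| ≤ F z + ENNReal.ofReal (t / 2) := by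
    intro z
    by_cases hz : z ∈ {z | t < 2 * |f z|}
    · simp only [F, indicator_of_mem hz]
      exact le_self_add
    · simp only [F, indicator_of_notMem hz, zero_add]
      rw [mem_ofPred_eq, not_lt] at hz
      exact ENNReal.ofReal_le_ofReal (by linarith)
  have h1 : ENNReal.ofReal (t / 2) + ENNReal.ofReal (t / 2) <
      (∫⁻ y, F (x + r * y) ∂ν) + ENNReal.ofReal (t / 2) := by
    calc ENNReal.ofReal (t / 2) + ENNReal.ofReal (t / 2) = ENNReal.ofReal t := by
          rw [← ENNReal.ofReal_add (by positivity) (by positivity), add_halves]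
      _ < ∫⁻ y, ENNReal.ofReal |f (x + r * y)| ∂ν := hlt
      _ ≤ ∫⁻ y, (F (x + r * y) + ENNReal.ofReal (t / 2)) ∂ν := lintegral_mono fun y => hle _
      _ = _ := by rw [lintegral_add_right _ measurable_const, lintegral_const, measure_univ, mul_one]
  rw [show 4 * (t / 8) = t / 2 by ring]
  exact lt_of_add_lt_add_right h1

lemma lintegral_unrestrictedMax_le (hw : WeakTypeBound ν p₁ D) (hD : 0 < D) (hp₁ : 0 < p₁)
    (hp : p₁ < p) (hf : Measurable f) :
    ∫⁻ x, ‖unrestrictedMax ν f x‖ₑ ^ p ≤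
      ENNReal.ofReal (p * (D * 8 ^ p₁) / (p - p₁) * 2 ^ (p - p₁)) * ∫⁻ z, ‖f z‖ₑ ^ p := by
  have hp0 : 0 < p := hp₁.trans hp
  have hη : 0 < p - p₁ := sub_pos.2 hp
  obtain ⟨h, hh, hle, heq⟩ := exists_measurable_le_lintegral_eq volume
    (fun x => ‖unrestrictedMax ν f x‖ₑ ^ p)
  let g : ℝ → ℝ := fun x => (h x ^ (1 / p)).toReal
  have hroot : ∀ x, h x ^ (1 / p) ≤ ‖unrestrictedMax ν f x‖ₑ := by
    intro x
    calc h x ^ (1 / p) ≤ (‖unrestrictedMax ν f x‖ₑ ^ p) ^ (1 / p) :=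
          ENNReal.rpow_le_rpow (hle x) (by positivity)
      _ = _ := by rw [← ENNReal.rpow_mul, mul_one_div_cancel hp0.ne', ENNReal.rpow_one]
  have hgle : ∀ x, g x ≤ unrestrictedMax ν f x := by
    intro x
    have := ENNReal.toReal_mono enorm_ne_top (hroot x)
    rwa [toReal_enorm, Real.norm_eq_abs, abs_of_nonneg (unrestrictedMax_nonneg ν f x)] at this
  have hg0 : ∀ x, 0 ≤ g x := fun x => ENNReal.toReal_nonneg
  have hgm : Measurable g := (hh.pow_const _).ennreal_toReal
  have hgh : ∀ x, ENNReal.ofReal (g x ^ p) = h x := by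
    intro x
    rw [← ENNReal.ofReal_rpow_of_nonneg (hg0 x) hp0.le,
      ENNReal.ofReal_toReal (ne_top_of_le_ne_top enorm_ne_top (hroot x)), ← ENNReal.rpow_mul,
      one_div_mul_cancel hp0.ne', ENNReal.rpow_one]
  rw [heq, ← lintegral_congr hgh, lintegral_rpow_eq_lintegral_meas_lt_mul volume
    (Filter.Eventually.of_forall hg0) hgm.aemeasurable hp0]
  set μ : Measure ℝ := volume.withDensity fun z => ENNReal.ofReal (|f z| ^ p₁) with hμ
  have hlevel : ∀ t ∈ Ioi (0 : ℝ), volume {x | t < g x} * ENNReal.ofReal (t ^ (p - 1)) ≤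
      ENNReal.ofReal (D * 8 ^ p₁) *
        (μ {z | t < 2 * |f z|} * ENNReal.ofReal (t ^ (p - p₁ - 1))) := by
    intro t ht
    rw [mem_Ioi] at ht
    have e1 : t ^ (p - 1) = (t / 8) ^ p₁ * (8 ^ p₁ * t ^ (p - p₁ - 1)) := by
      rw [Real.div_rpow ht.le (by norm_num), ← mul_assoc, div_mul_cancel₀ _ (by positivity),
        ← Real.rpow_add ht]
      congr 1
      ring
    calc volume {x | t < g x} * ENNReal.ofReal (t ^ (p - 1))
        ≤ volume {x | t < unrestrictedMax ν f x} * ENNReal.ofReal (t ^ (p - 1)) :=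
          mul_le_mul_left (measure_mono fun x hx => lt_of_lt_of_le hx (hgle x)) _
      _ = (ENNReal.ofReal ((t / 8) ^ p₁) * volume {x | t < unrestrictedMax ν f x}) *
          ENNReal.ofReal (8 ^ p₁ * t ^ (p - p₁ - 1)) := by
          rw [e1, ENNReal.ofReal_mul (by positivity)]
          ring
      _ ≤ (ENNReal.ofReal D * μ {z | t < 2 * |f z|}) *
          ENNReal.ofReal (8 ^ p₁ * t ^ (p - p₁ - 1)) :=
          mul_le_mul_left (hw.volume_lt_unrestrictedMax_le hp₁ hf ht) _
      _ = _ := by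
          rw [ENNReal.ofReal_mul (by positivity), ENNReal.ofReal_mul (by positivity)]
          ring
  have hlayer := lintegral_rpow_eq_lintegral_meas_lt_mul μ (f := fun z => 2 * |f z|)
    (Filter.Eventually.of_forall fun z => by positivity) (hf.abs.const_mul 2).aemeasurable hη
  have hdens : ∫⁻ z, ENNReal.ofReal ((2 * |f z|) ^ (p - p₁)) ∂μ =
      ENNReal.ofReal (2 ^ (p - p₁)) * ∫⁻ z, ‖f z‖ₑ ^ p := by
    rw [hμ, lintegral_withDensity_eq_lintegral_mul _ (hf.abs.pow_const p₁).ennreal_ofReal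
      ((hf.abs.const_mul 2).pow_const _).ennreal_ofReal, ← lintegral_const_mul _
      (hf.enorm.pow_const p)]
    refine lintegral_congr fun z => ?_
    rw [Pi.mul_apply, Real.enorm_eq_ofReal_abs, ENNReal.ofReal_rpow_of_nonneg (abs_nonneg _) hp0.le,
      ← ENNReal.ofReal_mul (by positivity), ← ENNReal.ofReal_mul (by positivity)]
    congr 1
    rw [Real.mul_rpow (by norm_num) (abs_nonneg _), mul_left_comm,
      ← Real.rpow_add_of_nonneg (abs_nonneg _) hp₁.le hη.le, add_sub_cancel]
  have hI : ∫⁻ t in Ioi (0 : ℝ), μ {z | t < 2 * |f z|} * ENNReal.ofReal (t ^ (p - p₁ - 1)) =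
      ENNReal.ofReal ((p - p₁)⁻¹) * (ENNReal.ofReal (2 ^ (p - p₁)) * ∫⁻ z, ‖f z‖ₑ ^ p) := by
    rw [← hdens, hlayer, ← mul_assoc, ← ENNReal.ofReal_mul (by positivity),
      inv_mul_cancel₀ hη.ne', ENNReal.ofReal_one, one_mul]
  calc ENNReal.ofReal p * ∫⁻ t in Ioi (0 : ℝ), volume {x | t < g x} * ENNReal.ofReal (t ^ (p - 1))
      ≤ ENNReal.ofReal p * ∫⁻ t in Ioi (0 : ℝ), ENNReal.ofReal (D * 8 ^ p₁) *
          (μ {z | t < 2 * |f z|} * ENNReal.ofReal (t ^ (p - p₁ - 1))) :=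
        mul_le_mul_right (setLIntegral_mono' measurableSet_Ioi hlevel) _
    _ = ENNReal.ofReal p * (ENNReal.ofReal (D * 8 ^ p₁) * (ENNReal.ofReal ((p - p₁)⁻¹) *
          (ENNReal.ofReal (2 ^ (p - p₁)) * ∫⁻ z, ‖f z‖ₑ ^ p))) := by
        rw [lintegral_const_mul' _ _ ENNReal.ofReal_ne_top, hI]
    _ = _ := by
        rw [div_eq_mul_inv, ENNReal.ofReal_mul (by positivity : 0 ≤ p * (D * 8 ^ p₁) * (p - p₁)⁻¹),
          ENNReal.ofReal_mul (by positivity : 0 ≤ p * (D * 8 ^ p₁)), ENNReal.ofReal_mul hp0.le,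
          ENNReal.ofReal_mul hD.le]
        ring

/-- Marcinkiewicz interpolation of a weak type bound with the trivial bound on `L^∞`. -/
lemma exists_eLpNorm_unrestrictedMax_le (hw : WeakTypeBound ν p₁ D) (hD : 0 < D) (hp₁ : 0 < p₁)
    (hp : p₁ < p) :
    ∃ C : ℝ, 0 ≤ C ∧ ∀ f : ℝ → ℝ, Measurable f →
      eLpNorm (unrestrictedMax ν f) (ENNReal.ofReal p) volume ≤
        ENNReal.ofReal C * eLpNorm f (ENNReal.ofReal p) volume := by
  have hp0 : 0 < p := hp₁.trans hp
  have hη : 0 < p - p₁ := sub_pos.2 hp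
  refine ⟨(p * (D * 8 ^ p₁) / (p - p₁) * 2 ^ (p - p₁)) ^ (1 / p), by positivity, fun f hf => ?_⟩
  have hpE : ENNReal.ofReal p ≠ 0 := (ENNReal.ofReal_pos.2 hp0).ne'
  rw [eLpNorm_eq_lintegral_rpow_enorm_toReal hpE ENNReal.ofReal_ne_top,
    eLpNorm_eq_lintegral_rpow_enorm_toReal hpE ENNReal.ofReal_ne_top, ENNReal.toReal_ofReal hp0.le,
    ← ENNReal.ofReal_rpow_of_nonneg (by positivity) (by positivity),
    ← ENNReal.mul_rpow_of_nonneg _ _ (by positivity)]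
  exact ENNReal.rpow_le_rpow (hw.lintegral_unrestrictedMax_le hD hp₁ hp hf) (by positivity)

end WeakTypeBound

lemma ceil_exponent_bounds {s : ℝ} (hs : s ∈ Ioo (1 / 2 : ℝ) 1) {d : ℕ}
    (hd : (d : ℤ) = 2 * ⌈1 / (2 - 2 * s) - 1⌉) :
    Even d ∧ 0 < d ∧ (d : ℝ) * (1 - s) < 1 ∧ 1 ≤ ((d : ℝ) + 2) * (1 - s) := by
  obtain ⟨hs1, hs2⟩ := hs
  have hpos : 0 < 2 - 2 * s := by linarith
  obtain ⟨N, hN⟩ : ∃ N : ℤ, N = ⌈1 / (2 - 2 * s) - 1⌉ := ⟨_, rfl⟩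
  rw [← hN] at hd
  have h1 : 1 / (2 - 2 * s) - 1 ≤ N := hN ▸ Int.le_ceil _
  have h2 : (N : ℝ) < 1 / (2 - 2 * s) - 1 + 1 := hN ▸ Int.ceil_lt_add_one _
  have hdN : (d : ℝ) = 2 * N := by exact_mod_cast hd
  have h3 : 1 / (2 - 2 * s) ≤ N + 1 := by linarith
  have h4 : (N : ℝ) < 1 / (2 - 2 * s) := by linarith
  rw [div_le_iff₀ hpos] at h3
  rw [lt_div_iff₀ hpos] at h4
  have h5 : 0 < N := by
    have h6 : (1 : ℝ) < 1 / (2 - 2 * s) := by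
      rw [lt_div_iff₀ hpos]
      linarith
    have : (0 : ℝ) < N := by linarith
    exact_mod_cast this
  refine ⟨(Int.even_coe_nat d).1 ⟨N, by rw [hd]; ring⟩, by omega, ?_, ?_⟩
  · rw [hdN]
    linarith
  · rw [hdN]
    linarith

lemma exists_interpolation_parameter {d θ ξ p : ℝ} (hd : 1 < d) (hθ : 0 < θ) (hξ : 0 ≤ ξ)
    (hp : ((2 + d) * θ + d * ξ) / ((1 + d) * θ + (d - 1) * ξ) < p) :
    ∃ t : ℝ, 0 < t ∧ t < 1 ∧ 0 < θ * (1 - t) - ξ * t ∧ (d + 2 * t) / (d + 2 * t - 1) < p := by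
  have hS : 0 < θ + ξ := by linarith
  have hden : 0 < (1 + d) * θ + (d - 1) * ξ :=
    add_pos_of_pos_of_nonneg (mul_pos (by linarith) hθ) (mul_nonneg (by linarith) hξ)
  have hp1 : 1 < p := by
    refine lt_of_lt_of_le ?_ hp.le
    rw [lt_div_iff₀ hden]
    linarith
  rw [div_lt_iff₀ hden] at hp
  obtain ⟨T, hT⟩ : ∃ T : ℝ, T = θ / (θ + ξ) := ⟨_, rfl⟩
  have hT0 : 0 < T := by rw [hT]; positivity
  have hTS : T * (θ + ξ) = θ := by rw [hT]; exact div_mul_cancel₀ _ hS.ne'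
  have hT1 : T ≤ 1 := by
    rw [hT]
    exact div_le_one_of_le₀ (by linarith) hS.le
  obtain ⟨g, hg⟩ : ∃ g : ℝ, g = (d + 2 * T) * (p - 1) - p := ⟨_, rfl⟩
  have hg0 : 0 < g := by
    refine pos_of_mul_pos_left (b := θ + ξ) ?_ hS.le
    have e : g * (θ + ξ) = p * ((1 + d) * θ + (d - 1) * ξ) - ((2 + d) * θ + d * ξ) := by
      rw [hg]
      linear_combination (2 * (p - 1)) * hTS
    rw [e]
    linarith
  have hp1' : 0 < p - 1 := by linarith
  obtain ⟨t, ht⟩ : ∃ t : ℝ, t = max (T / 2) (T - g / (4 * (p - 1))) := ⟨_, rfl⟩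
  have htT : t < T := by
    rw [ht]
    exact max_lt (by linarith) (sub_lt_self _ (by positivity))
  have ht0 : 0 < t := by
    rw [ht]
    exact lt_max_of_lt_left (by linarith)
  have htg : T - g / (4 * (p - 1)) ≤ t := ht ▸ le_max_right _ _
  refine ⟨t, ht0, by linarith, ?_, ?_⟩
  · have := mul_lt_mul_of_pos_right htT hS
    linarith
  · rw [div_lt_iff₀ (by linarith)]
    have e1 : T * (p - 1) - g / 4 ≤ t * (p - 1) := by
      calc T * (p - 1) - g / 4 = (T - g / (4 * (p - 1))) * (p - 1) := by field_simp
        _ ≤ t * (p - 1) := mul_le_mul_of_nonneg_right htg hp1'.le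
    linarith

theorem stmt1 (s : ℝ) (hs : s ∈ Ioo (1/2 : ℝ) 1)
    (d : ℕ) (hd : (d : ℤ) = 2 * ⌈1 / (2 - 2*s) - 1⌉)
    (θ₀ ξ₀ p₀ : ℝ)
    (hθ₀ : θ₀ = ((d : ℝ) * s + 1 - d) / 2)
    (hξ₀ : ξ₀ = (d : ℝ) + 1 - ((d : ℝ) + 2) * s)
    (hp₀ : p₀ = ((2 + (d : ℝ)) * θ₀ + (d : ℝ) * ξ₀) /
      ((1 + (d : ℝ)) * θ₀ + ((d : ℝ) - 1) * ξ₀)) :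
    ∃ (A : Set ℝ) (ν : Measure ℝ), IsCompact A ∧ A ⊆ Icc 1 2 ∧
      IsProbabilityMeasure ν ∧ msupport ν = A ∧ IsAhlforsRegular ν s ∧
      ∀ p : ℝ, p₀ < p → ∃ C : ℝ, 0 ≤ C ∧ ∀ f : ℝ → ℝ, Measurable f →
        eLpNorm (unrestrictedMax ν f) (ENNReal.ofReal p) volume ≤
          ENNReal.ofReal C * eLpNorm f (ENNReal.ofReal p) volume := by
  obtain ⟨heven, hd0, hdκ, hdκ2⟩ := ceil_exponent_bounds hs hd
  have h0 : 0 ≤ 1 - s := by linarith [hs.2]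
  have h1 : 1 - s ≤ 1 := by linarith [hs.1]
  obtain ⟨m, ε, hm⟩ := exists_isCascade h0 h1
  obtain ⟨ν, φ, hν, hφ, hopen, hclosed⟩ := hm.exists_limit_stepMeasure h0 h1
  have hsub := hm.msupport_limit_subset hopen
  refine ⟨msupport ν, ν, isCompact_Icc.of_isClosed_subset (isClosed_msupport ν) hsub, hsub, hν, rfl,
    ?_, fun p hp => ?_⟩
  · have := hm.isAhlforsRegular_limit h0 h1 hφ hopen hclosed
    rwa [sub_sub_cancel] at this
  have hd1 : (1 : ℝ) < d := by
    obtain ⟨n, hn⟩ := heven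
    have : 1 < d := by omega
    exact_mod_cast this
  have hθ : θ₀ = (1 - d * (1 - s)) / 2 := by rw [hθ₀]; ring
  have hξ : ξ₀ = ((d : ℝ) + 2) * (1 - s) - 1 := by rw [hξ₀]; ring
  rw [hp₀] at hp
  obtain ⟨t, ht0, ht1, hδ, hpt⟩ := exists_interpolation_parameter hd1
    (by rw [hθ]; linarith) (by rw [hξ]; linarith) hp
  rw [hθ, hξ] at hδ
  have hpq := (Real.HolderConjugate.conjExponent
    (by linarith : (1 : ℝ) < d + 2 * t)).symm
  obtain ⟨C, c, hC, hc, hinc⟩ := volume_stepIntegral_increment_le h0 h1 heven hd0 hdκ.le hdκ2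
    ht0 ht1 hδ hpq
  obtain ⟨C', c', hC', hc', hmz⟩ := hm.volume_average_le_of_mean_zero h0 h1 hpq hC hc (hinc m ε hm)
  obtain ⟨D, hD, hw⟩ := hm.weakTypeBound_limit h0 h1 hopen hpq.lt.le hC' hc' hmz
  exact hw.exists_eLpNorm_unrestrictedMax_le hD hpq.pos hpt
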